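/- For d = 5, b = 2 (the pushforward of O_{ℙ²}(2) under the 5-uple embedding): dim K_{p,0}(ℙ²,2;5) for p = 0,…,5 equals 6, 90, 595, 2160, 4200, 2002 respectively; dim K_{p,1}(ℙ²,2;5) for p = 3,…,17 equals 375, 4858, 39780, 134640, 291720, 464100, 568854, 548080, 417690, 250920, 117300, 41616, 10710, 1830, 165 respectively; dim K_{18,2}(ℙ²,2;5) = 1; and K_{p,q}(ℙ²,2;5) = 0 for all other pairs (p,q) with p ≥ 0 and q ∈ ℤ. -/

import Mathlib

open scoped TensorProduct

set_option maxHeartbeats 2000000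
set_option synthInstance.maxHeartbeats 1000000

noncomputable section

/-- The dimension (over `ℂ`) of a complex vector space, as a natural number. -/
def cdim (M : Type*) [AddCommMonoid M] [Module ℂ M] : ℕ := (Module.rank ℂ M).toNat

/-- The polynomial ring `S = ℂ[x₀,…,x_{N-1}]`. -/
abbrev PolyC (N : ℕ) : Type := MvPolynomial (Fin N) ℂ

/-- The space `S_e` of homogeneous polynomials of degree `e` (zero for `e < 0`). -/
def Sdeg (N : ℕ) (e : ℤ) : Submodule ℂ (PolyC N) :=
  if 0 ≤ e then MvPolynomial.homogeneousSubmodule (Fin N) ℂ e.toNat else ⊥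

/-- The monomial `x^σ`. -/
def monoC (N : ℕ) (σ : Fin N →₀ ℕ) : PolyC N := MvPolynomial.monomial σ (1 : ℂ)

/-- The wedge product `m₁ ∧ ⋯ ∧ mₙ` as an element of the `n`-th exterior power. -/
def wedgeE (R : Type*) [CommRing R] (M : Type*) [AddCommGroup M] [Module R M]
    (n : ℕ) (m : Fin n → M) : ↥(⋀[R]^n M) :=
  ⟨ExteriorAlgebra.ιMulti R n m, ExteriorAlgebra.ιMulti_range R n ⟨m, rfl⟩⟩

/-- The module `⋀^p S_d ⊗ S_e`. -/
abbrev KosModule (N : ℕ) (d : ℤ) (p : ℕ) (e : ℤ) : Type :=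
  (↥(⋀[ℂ]^p ↥(Sdeg N d))) ⊗[ℂ] ↥(Sdeg N e)

/-- `D` satisfies the defining formula of the Koszul differential
`∂_{p+1} : ⋀^{p+1} S_d ⊗ S_e → ⋀^p S_d ⊗ S_{e'}` (for `e' = e + d`), namely
`∂(m₁∧⋯∧m_{p+1} ⊗ f) = ∑ₖ (−1)ᵏ m₁∧⋯∧m̂ₖ∧⋯∧m_{p+1} ⊗ (mₖ·f)`; the equality is
stated after applying the (injective) inclusion `⋀^p S_d ⊗ S_{e'} → ⋀^p S_d ⊗ S`. -/
def IsKoszulDiff (N : ℕ) (d e e' : ℤ) (p : ℕ)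
    (D : KosModule N d (p + 1) e →ₗ[ℂ] KosModule N d p e') : Prop :=
  ∀ (m : Fin (p + 1) → ↥(Sdeg N d)) (f : ↥(Sdeg N e)),
    TensorProduct.map (LinearMap.id (R := ℂ) (M := ↥(⋀[ℂ]^p ↥(Sdeg N d)))) (Sdeg N e').subtype
        (D (wedgeE ℂ ↥(Sdeg N d) (p + 1) m ⊗ₜ[ℂ] f)) =
      ∑ k : Fin (p + 1), ((-1 : ℂ) ^ ((k : ℕ) + 1)) •
        (wedgeE ℂ ↥(Sdeg N d) p (fun i => m (Fin.succAbove k i)) ⊗ₜ[ℂ]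
          ((m k : PolyC N) * (f : PolyC N)))

/-- A family of maps of the shape of the Koszul differentials. -/
def KFam (N : ℕ) (d : ℤ) : Type :=
  ∀ (p : ℕ) (e e' : ℤ), KosModule N d (p + 1) e →ₗ[ℂ] KosModule N d p e'

/-- The family `D` consists of the Koszul differentials (at all meaningful degrees). -/
def IsKoszulFam (N : ℕ) (d : ℤ) (D : KFam N d) : Prop :=
  ∀ (p : ℕ) (e e' : ℤ), e' = e + d → IsKoszulDiff N d e e' p (D p e e')

/-- `dim K_{p,q}(ℙ^{N-1}, b; d)`: the dimension of the homology `ker ∂_p / im ∂_{p+1}` at the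
middle term of `⋀^{p+1} S_d ⊗ S_{b+(q-1)d} → ⋀^p S_d ⊗ S_{b+qd} → ⋀^{p-1} S_d ⊗ S_{b+(q+1)d}`,
where for `p = 0` the right-hand map is the zero map (the dimension of the quotient is expressed
as `dim ker − dim (im ⊓ ker)`, which agrees with it since all spaces here are
finite-dimensional). -/
def Kdim (N : ℕ) (d : ℤ) (D : KFam N d) (b : ℤ) : ℕ → ℤ → ℕ
  | 0, q =>
      cdim (KosModule N d 0 (b + q * d)) -
        cdim ↥(LinearMap.range (D 0 (b + (q - 1) * d) (b + q * d)))
  | p + 1, q =>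
      cdim ↥(LinearMap.ker (D p (b + q * d) (b + (q + 1) * d))) -
        cdim
          ↥(LinearMap.range (D (p + 1) (b + (q - 1) * d) (b + q * d)) ⊓
            LinearMap.ker (D p (b + q * d) (b + (q + 1) * d)))

/-- The multidegree-`a` component of `⋀^p S_d ⊗ S_e`: the span of the pure tensors
`m₁∧⋯∧m_p ⊗ f` with the `mᵢ` and `f` monomials of total multidegree `a`. -/
def KComp (N : ℕ) (d : ℤ) (p : ℕ) (e : ℤ) (a : Fin N →₀ ℕ) :
    Submodule ℂ (KosModule N d p e) :=
  Submodule.span ℂ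
    { x | ∃ (σ : Fin p → (Fin N →₀ ℕ)) (τ : Fin N →₀ ℕ)
        (hσ : ∀ i, monoC N (σ i) ∈ Sdeg N d) (hτ : monoC N τ ∈ Sdeg N e),
        (∑ i, σ i) + τ = a ∧
        x = wedgeE ℂ ↥(Sdeg N d) p (fun i => (⟨monoC N (σ i), hσ i⟩ : ↥(Sdeg N d))) ⊗ₜ[ℂ]
            (⟨monoC N τ, hτ⟩ : ↥(Sdeg N e)) }

/-- `dim K_{p,q}(ℙ^{N-1}, b; d)_a`: the dimension of the multidegree-`a` component of the
homology, i.e. of `(ker ∂_p ∩ (⋀^p S_d ⊗ S_{b+qd})_a) / (im ∂_{p+1} ∩ (⋀^p S_d ⊗ S_{b+qd})_a)`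
(again expressed as a difference of dimensions). -/
def KdimA (N : ℕ) (d : ℤ) (D : KFam N d) (b : ℤ) : ℕ → ℤ → (Fin N →₀ ℕ) → ℕ
  | 0, q, a =>
      cdim ↥(KComp N d 0 (b + q * d) a) -
        cdim
          ↥(LinearMap.range (D 0 (b + (q - 1) * d) (b + q * d)) ⊓ KComp N d 0 (b + q * d) a)
  | p + 1, q, a =>
      cdim
        ↥(LinearMap.ker (D p (b + q * d) (b + (q + 1) * d)) ⊓ KComp N d (p + 1) (b + q * d) a) -
        cdim
          ↥(LinearMap.range (D (p + 1) (b + (q - 1) * d) (b + q * d)) ⊓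
            (LinearMap.ker (D p (b + q * d) (b + (q + 1) * d)) ⊓
              KComp N d (p + 1) (b + q * d) a))

/-- Build a multidegree in `Fin 3 →₀ ℕ` from three exponents. -/
def mdeg3 (i j k : ℕ) : Fin 3 →₀ ℕ := Finsupp.equivFunOnFinite.symm ![i, j, k]

end

set_option linter.unusedSectionVars false

noncomputable section

/-- Alternating forms with values in `R`. -/
abbrev AltK (ι : Type) (R : Type) [CommRing R] [Algebra ℂ R] (p : ℕ) : Type :=
  (ι → ℂ) [⋀^Fin p]→ₗ[ℂ] R

section altops
variable {ι : Type} [Fintype ι] [DecidableEq ι] {R : Type} [CommRing R] [Algebra ℂ R]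

/-- basis vector -/
def ebas (i : ι) : ι → ℂ := Pi.single i 1

/-- wedge with a functional -/
def wd {p : ℕ} (ψ : (ι → ℂ) →ₗ[ℂ] ℂ) (h : AltK ι R p) : AltK ι R (p + 1) :=
  AlternatingMap.alternatizeUncurryFin (ψ.smulRight h)

/-- Koszul differential on alternating forms -/
def dK (X : ι → R) {p : ℕ} (f : AltK ι R (p + 1)) : AltK ι R p :=
  ∑ i, X i • f.curryLeft (ebas i)

theorem wd_apply {p : ℕ} (ψ : (ι → ℂ) →ₗ[ℂ] ℂ) (h : AltK ι R p) (v : Fin (p + 1) → (ι → ℂ)) :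
    wd ψ h v = ∑ i : Fin (p + 1), (-1 : ℤ) ^ (i : ℕ) • (ψ (v i) • h (Fin.removeNth i v)) := by
  simp [wd, AlternatingMap.alternatizeUncurryFin_apply]

theorem altsum_apply {p : ℕ} {κ : Type} (s : Finset κ) (h : κ → AltK ι R p)
    (v : Fin p → (ι → ℂ)) : (∑ k ∈ s, h k) v = ∑ k ∈ s, h k v := by
  classical
  induction s using Finset.induction_on with
  | empty => simp
  | insert a s ha ih => rw [Finset.sum_insert ha, Finset.sum_insert ha, AlternatingMap.add_apply, ih]

theorem dK_apply (X : ι → R) {p : ℕ} (f : AltK ι R (p + 1)) (v : Fin p → (ι → ℂ)) :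
    dK X f v = ∑ i, X i * f (Matrix.vecCons (ebas i) v) := by
  simp [dK, altsum_apply]

theorem wd_add {p : ℕ} (ψ : (ι → ℂ) →ₗ[ℂ] ℂ) (h h' : AltK ι R p) :
    wd ψ (h + h') = wd ψ h + wd ψ h' := by
  ext v; simp [wd_apply, Finset.sum_add_distrib]

theorem wd_smul {p : ℕ} (ψ : (ι → ℂ) →ₗ[ℂ] ℂ) (c : R) (h : AltK ι R p) :
    wd ψ (c • h) = c • wd ψ h := by
  ext v
  simp only [wd_apply, AlternatingMap.smul_apply, Finset.smul_sum]
  refine Finset.sum_congr rfl fun i _ => ?_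
  rw [smul_comm c, smul_comm c]

theorem wd_neg {p : ℕ} (ψ : (ι → ℂ) →ₗ[ℂ] ℂ) (h : AltK ι R p) :
    wd ψ (-h) = - wd ψ h := by
  ext v; simp [wd_apply]

theorem wd_zero {p : ℕ} (ψ : (ι → ℂ) →ₗ[ℂ] ℂ) :
    wd ψ (0 : AltK ι R p) = 0 := by
  ext v; simp [wd_apply]

theorem wd_sub {p : ℕ} (ψ : (ι → ℂ) →ₗ[ℂ] ℂ) (h h' : AltK ι R p) :
    wd ψ (h - h') = wd ψ h - wd ψ h' := by
  rw [sub_eq_add_neg, wd_add, wd_neg, sub_eq_add_neg]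

theorem wd_sum {p : ℕ} (ψ : (ι → ℂ) →ₗ[ℂ] ℂ) {κ : Type} (s : Finset κ) (h : κ → AltK ι R p) :
    wd ψ (∑ k ∈ s, h k) = ∑ k ∈ s, wd ψ (h k) := by
  classical
  induction s using Finset.induction_on with
  | empty => simp [wd_zero]
  | insert a s ha ih => rw [Finset.sum_insert ha, Finset.sum_insert ha, wd_add, ih]

theorem dK_add (X : ι → R) {p : ℕ} (f g : AltK ι R (p + 1)) :
    dK X (f + g) = dK X f + dK X g := by
  ext v; simp [dK_apply, mul_add, Finset.sum_add_distrib]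

theorem dK_neg (X : ι → R) {p : ℕ} (f : AltK ι R (p + 1)) :
    dK X (-f) = - dK X f := by
  ext v; simp [dK_apply]

theorem dK_sub (X : ι → R) {p : ℕ} (f g : AltK ι R (p + 1)) :
    dK X (f - g) = dK X f - dK X g := by
  rw [sub_eq_add_neg, dK_add, dK_neg, sub_eq_add_neg]

theorem dK_zero (X : ι → R) {p : ℕ} : dK X (0 : AltK ι R (p + 1)) = 0 := by
  ext v; simp [dK_apply]

theorem dK_smul (X : ι → R) {p : ℕ} (c : R) (f : AltK ι R (p + 1)) :
    dK X (c • f) = c • dK X f := by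
  ext v
  simp only [dK_apply, AlternatingMap.smul_apply, smul_eq_mul, Finset.mul_sum]
  exact Finset.sum_congr rfl fun i _ => by ring

theorem dK_sum (X : ι → R) {p : ℕ} {κ : Type} (s : Finset κ) (h : κ → AltK ι R (p + 1)) :
    dK X (∑ k ∈ s, h k) = ∑ k ∈ s, dK X (h k) := by
  classical
  induction s using Finset.induction_on with
  | empty => simp [dK_zero]
  | insert a s ha ih => rw [Finset.sum_insert ha, Finset.sum_insert ha, dK_add, ih]

theorem curryLeft_wd_zero (ψ : (ι → ℂ) →ₗ[ℂ] ℂ) (h : AltK ι R 0) (u : ι → ℂ) :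
    (wd ψ h).curryLeft u = ψ u • h := by
  ext v
  simp only [AlternatingMap.curryLeft_apply_apply, wd_apply, AlternatingMap.smul_apply]
  simp only [Nat.reduceAdd, Finset.univ_unique, Finset.sum_singleton]
  simp

theorem curryLeft_wd {p : ℕ} (ψ : (ι → ℂ) →ₗ[ℂ] ℂ) (h : AltK ι R (p + 1)) (u : ι → ℂ) :
    (wd ψ h).curryLeft u = ψ u • h - wd ψ (h.curryLeft u) := by
  ext v
  simp only [AlternatingMap.curryLeft_apply_apply, wd_apply, AlternatingMap.smul_apply,
    AlternatingMap.sub_apply]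
  rw [Fin.sum_univ_succ, sub_eq_add_neg, ← Finset.sum_neg_distrib]
  congr 1
  · simp
  · refine Finset.sum_congr rfl fun i _ => ?_
    have : Fin.removeNth i.succ (Matrix.vecCons u v) = Matrix.vecCons u (Fin.removeNth i v) := by
      ext j
      refine Fin.cases ?_ (fun k => ?_) j <;> simp [Fin.removeNth, Matrix.vecCons]
    rw [this]
    simp [pow_succ]

/-- pairing of the `X` with a functional -/
def Xof (X : ι → R) (ψ : (ι → ℂ) →ₗ[ℂ] ℂ) : R := ∑ i, ψ (ebas i) • X i

theorem dK_wd_zero (X : ι → R) (ψ : (ι → ℂ) →ₗ[ℂ] ℂ) (h : AltK ι R 0) :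
    dK X (wd ψ h) = Xof X ψ • h := by
  simp only [dK, curryLeft_wd_zero, Xof, Finset.sum_smul]
  refine Finset.sum_congr rfl fun i _ => ?_
  ext v
  simp [mul_smul_comm]

theorem dK_wd (X : ι → R) {p : ℕ} (ψ : (ι → ℂ) →ₗ[ℂ] ℂ) (h : AltK ι R (p + 1)) :
    dK X (wd ψ h) = Xof X ψ • h - wd ψ (dK X h) := by
  simp only [dK, curryLeft_wd, Xof, Finset.sum_smul, wd_sum, smul_sub, Finset.sum_sub_distrib,
    wd_smul]
  congr 1
  refine Finset.sum_congr rfl fun i _ => ?_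
  ext v
  simp [mul_smul_comm]

theorem alt_swap {p : ℕ} (f : AltK ι R (p + 2)) (u w : ι → ℂ) (v : Fin p → (ι → ℂ)) :
    f (Matrix.vecCons u (Matrix.vecCons w v)) = - f (Matrix.vecCons w (Matrix.vecCons u v)) := by
  have h := f.map_swap (Matrix.vecCons w (Matrix.vecCons u v))
    (i := 0) (j := 1) (by simp)
  rw [← h]
  congr 1
  ext j
  refine Fin.cases ?_ (fun k => ?_) j
  · simp
  · refine Fin.cases ?_ (fun k => ?_) k
    · simp
    · rw [Function.comp_apply, Equiv.swap_apply_of_ne_of_ne] <;> simp [Fin.ext_iff]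

theorem curryLeft_dK (X : ι → R) {p : ℕ} (f : AltK ι R (p + 2)) (u : ι → ℂ) :
    (dK X f).curryLeft u = - dK X (f.curryLeft u) := by
  ext v
  simp only [AlternatingMap.curryLeft_apply_apply, dK_apply, AlternatingMap.neg_apply]
  rw [← Finset.sum_neg_distrib]
  refine Finset.sum_congr rfl fun i _ => ?_
  rw [alt_swap, mul_neg]

theorem dK_dK (X : ι → R) {p : ℕ} (f : AltK ι R (p + 2)) : dK X (dK X f) = 0 := by
  ext v
  have h : dK X (dK X f) v = - dK X (dK X f) v := by
    conv_lhs => simp only [dK_apply, Finset.mul_sum]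
    rw [Finset.sum_comm]
    simp only [dK_apply, Finset.mul_sum]
    rw [← Finset.sum_neg_distrib]
    refine Finset.sum_congr rfl fun i _ => ?_
    rw [← Finset.sum_neg_distrib]
    refine Finset.sum_congr rfl fun j _ => ?_
    rw [alt_swap]; ring
  have h2 : (2 : ℂ) • dK X (dK X f) v = 0 := by
    rw [two_smul]; nth_rewrite 1 [h]; simp
  simpa using (smul_eq_zero_iff_right (two_ne_zero)).1 h2

/-- coordinate functional -/
def psi (i : ι) : (ι → ℂ) →ₗ[ℂ] ℂ := LinearMap.proj i

theorem psi_ebas (i j : ι) : psi i (ebas j : ι → ℂ) = if i = j then 1 else 0 := by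
  simp [psi, ebas, Pi.single_apply]

theorem Xof_psi (X : ι → R) (i : ι) : Xof X (psi i) = X i := by
  simp [Xof, psi_ebas, ite_smul]

theorem euler {p : ℕ} (f : AltK ι R (p + 1)) :
    ∑ i, wd (psi i) (f.curryLeft (ebas i)) = ((p : ℂ) + 1) • f := by
  have := AlternatingMap.alternatizeUncurryFin_curryLeft f
  ext v
  have h2 := DFunLike.congr_fun this v
  rw [AlternatingMap.alternatizeUncurryFin_apply] at h2
  simp only [altsum_apply, wd_apply]
  rw [Finset.sum_comm]
  have h3 : ∀ k : Fin (p+1), (∑ i, (-1 : ℤ) ^ (k : ℕ) • (psi i (v k) •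
      (f.curryLeft (ebas i)) (Fin.removeNth k v))) =
      (-1 : ℤ) ^ (k : ℕ) • (f.curryLeft (v k)) (Fin.removeNth k v) := by
    intro k
    have : v k = ∑ i, (v k i) • (ebas i : ι → ℂ) := by
      simpa [ebas] using (pi_eq_sum_univ' (v k))
    conv_rhs => rw [this, map_sum]
    rw [altsum_apply, Finset.smul_sum]
    refine Finset.sum_congr rfl fun i _ => ?_
    simp [psi]
  rw [Finset.sum_congr rfl fun k _ => h3 k, h2]
  simp only [AlternatingMap.smul_apply]
  rw [← Nat.cast_smul_eq_nsmul ℂ]; simp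

/-- values of an alternating form lie in a submodule as soon as basis values do -/
theorem alt_mem_of_basis {p : ℕ} (f : AltK ι R p) (W : Submodule ℂ R)
    (h : ∀ s : Fin p → ι, f (fun k => ebas (s k)) ∈ W) (v : Fin p → (ι → ℂ)) : f v ∈ W := by
  have : v = fun k => ∑ i, (v k i) • (ebas i : ι → ℂ) := by
    ext1 k; simpa [ebas] using (pi_eq_sum_univ' (v k))
  rw [this]
  have := f.toMultilinearMap.map_sum (fun k i => v k i • (ebas i : ι → ℂ))
  simp only [AlternatingMap.coe_multilinearMap] at this
  rw [this]
  refine Submodule.sum_mem _ fun s _ => ?_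
  have := f.toMultilinearMap.map_smul_univ (fun k => v k (s k)) (fun k => (ebas (s k) : ι → ℂ))
  simp only [AlternatingMap.coe_multilinearMap] at this
  rw [this]
  exact Submodule.smul_mem _ _ (h s)

theorem alt_ext_basis {p : ℕ} (f g : AltK ι R p)
    (h : ∀ s : Fin p → ι, f (fun k => ebas (s k)) = g (fun k => ebas (s k))) : f = g := by
  rw [← sub_eq_zero]
  ext v
  have := alt_mem_of_basis (f - g) ⊥ (fun s => by simp [h s]) v
  simpa using this

/-- post composition with a linear map -/
theorem wd_comp {R' : Type} [CommRing R'] [Algebra ℂ R'] {p : ℕ} (ψ : (ι → ℂ) →ₗ[ℂ] ℂ)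
    (L : R →ₗ[ℂ] R') (h : AltK ι R p) :
    L.compAlternatingMap (wd ψ h) = wd ψ (L.compAlternatingMap h) := by
  ext v
  simp only [LinearMap.compAlternatingMap_apply, wd_apply, map_sum, map_zsmul, map_smul]

end altops
end

set_option linter.unusedSectionVars false

noncomputable section

/-- exponent vectors of degree `n` -/
abbrev MIdx (n : ℕ) : Type := {σ : Fin 3 →₀ ℕ // σ.degree = n}

/-- finiteness -/
instance instFintypeMIdx (n : ℕ) : Fintype (MIdx n) :=
  Set.Finite.fintype (s := {f : Fin 3 →₀ ℕ | f.degree = n}) (Finsupp.finite_of_degree_eq n)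

theorem card_MIdx (n : ℕ) : Fintype.card (MIdx n) = (n + 2).choose 2 := by
  have h := Finset.card_finsuppAntidiag_nat_eq_choose (s := (Finset.univ : Finset (Fin 3))) n
  rw [Fintype.card_of_subtype (Finset.finsuppAntidiag (Finset.univ : Finset (Fin 3)) n), h]
  · simp only [Finset.card_univ, Fintype.card_fin]
    rw [show 3 + n - 1 = n + 2 by omega]
    exact Nat.choose_symm_of_eq_add (by omega)
  · intro x
    simp [Finset.mem_finsuppAntidiag, Finsupp.degree_eq_sum]

/-- the 21 quintic monomials -/
abbrev QI : Type := MIdx 5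

/-- decidable equality -/
instance instDecEqQI : DecidableEq QI := Classical.decEq _

/-- quintic monomials as polynomials -/
def XM (i : QI) : PolyC 3 := MvPolynomial.monomial i.1 1

/-- index of the fifth power of a variable -/
def yi (l : Fin 3) : QI := ⟨Finsupp.single l 5, by simp⟩

/-- forms over the polynomial ring -/
abbrev AA (p : ℕ) : Type := AltK QI (PolyC 3) p

/-- monomial ideal generated by the fifth powers of the first `k` variables -/
def Ik (k : ℕ) : Submodule ℂ (PolyC 3) where
  carrier := {P | ∀ m : Fin 3 →₀ ℕ, (∀ l : Fin 3, l.val < k → m l < 5) → P.coeff m = 0}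
  add_mem' := by
    intro a b ha hb m hm
    simp [ha m hm, hb m hm]
  zero_mem' := by intro m _; simp
  smul_mem' := by
    intro c x hx m hm
    simp [hx m hm]

theorem mem_Ik {k : ℕ} {P : PolyC 3} : P ∈ Ik k ↔
    ∀ m : Fin 3 →₀ ℕ, (∀ l : Fin 3, l.val < k → m l < 5) → P.coeff m = 0 := Iff.rfl

theorem Ik_mul {k : ℕ} (Q : PolyC 3) {P : PolyC 3} (h : P ∈ Ik k) : Q * P ∈ Ik k := by
  intro m hm
  rw [MvPolynomial.coeff_mul]
  refine Finset.sum_eq_zero fun x hx => ?_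
  rw [Finset.HasAntidiagonal.mem_antidiagonal] at hx
  rw [h x.2 (fun l hl => ?_), mul_zero]
  have := hm l hl
  rw [← hx] at this
  simp at this; omega

theorem Ik_mono {k k' : ℕ} (hk : k ≤ k') {P : PolyC 3} (h : P ∈ Ik k) : P ∈ Ik k' :=
  fun m hm => h m fun l hl => hm l (by omega)

theorem Ik_zero {P : PolyC 3} (h : P ∈ Ik 0) : P = 0 := by
  ext m
  simpa using h m (fun l hl => by omega)

theorem XM_yi_mem (l : Fin 3) : XM (yi l) ∈ Ik (l.val + 1) := by
  intro m hm
  rw [XM, MvPolynomial.coeff_monomial, if_neg]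
  rintro rfl
  have := hm l (by omega)
  simp [yi] at this

/-- division by a monomial, linear -/
def divL (s : Fin 3 →₀ ℕ) : PolyC 3 →ₗ[ℂ] PolyC 3 where
  toFun P := MvPolynomial.divMonomial P s
  map_add' := fun a b => MvPolynomial.add_divMonomial a b s
  map_smul' := by intro c x; ext m; simp [MvPolynomial.coeff_divMonomial]

theorem coeff_divL (s m : Fin 3 →₀ ℕ) (P : PolyC 3) : (divL s P).coeff m = P.coeff (s + m) := by
  simp [divL, MvPolynomial.coeff_divMonomial]

theorem coeff_XM_mul (i : QI) (P : PolyC 3) (m : Fin 3 →₀ ℕ) :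
    (XM i * P).coeff (i.1 + m) = P.coeff m := by
  rw [XM, MvPolynomial.coeff_monomial_mul, one_mul]

theorem divL_rem (l : Fin 3) {P : PolyC 3} (h : P ∈ Ik (l.val + 1)) :
    P - XM (yi l) * divL (yi l).1 P ∈ Ik l.val := by
  intro m hm
  by_cases h5 : 5 ≤ m l
  · obtain ⟨m', rfl⟩ : ∃ m', m = (yi l).1 + m' := by
      have : (yi l).1 ≤ m := by
        intro j
        by_cases hj : j = l
        · subst hj; simpa [yi] using h5
        · have : l ≠ j := fun h => hj h.symm
          simp [yi, this]
      exact ⟨m - (yi l).1, (add_tsub_cancel_of_le this).symm⟩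
    rw [MvPolynomial.coeff_sub, coeff_XM_mul, coeff_divL, sub_self]
  · rw [MvPolynomial.coeff_sub, h m, XM, MvPolynomial.coeff_monomial_mul', if_neg, sub_zero]
    · intro hle
      have := hle l
      simp [yi] at this; omega
    · intro j hj
      rcases Nat.lt_succ_iff_lt_or_eq.1 hj with h1 | h1
      · exact hm j h1
      · have : j = l := Fin.ext h1
        subst this; omega

theorem Ik_reg (l : Fin 3) {P : PolyC 3} (h : XM (yi l) * P ∈ Ik l.val) : P ∈ Ik l.val := by
  intro m hm
  rw [← coeff_XM_mul (yi l)]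
  apply h
  intro j hj
  have : l ≠ j := fun h => by subst h; omega
  simp [yi, this]
  exact hm j hj

section gen
variable {ι : Type} [Fintype ι] [DecidableEq ι] {R : Type} [CommRing R] [Algebra ℂ R]

theorem wd_mem {p : ℕ} (W : Submodule ℂ R) (ψ : (ι → ℂ) →ₗ[ℂ] ℂ) (h : AltK ι R p)
    (hh : ∀ v, h v ∈ W) (v) : wd ψ h v ∈ W := by
  rw [wd_apply]
  refine Submodule.sum_mem _ fun i _ => ?_
  exact zsmul_mem (Submodule.smul_mem _ _ (hh _)) _

theorem dK_mem {p : ℕ} (W W' : Submodule ℂ R) (X : ι → R) (hX : ∀ i, ∀ r ∈ W, X i * r ∈ W')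
    (h : AltK ι R (p + 1)) (hh : ∀ v, h v ∈ W) (v) : dK X h v ∈ W' := by
  rw [dK_apply]
  exact Submodule.sum_mem _ fun i _ => hX _ _ (hh _)

theorem wd_wd {p : ℕ} (ψ : (ι → ℂ) →ₗ[ℂ] ℂ) (h : AltK ι R p) : wd ψ (wd ψ h) = 0 := by
  have := AlternatingMap.alternatizeUncurryFin_alternatizeUncurryFinLM_comp_of_symmetric
    (f := ψ.smulRight (ψ.smulRight h)) (fun x y => by simp [smul_smul, mul_comm])
  rw [← this]
  unfold wd
  congr 1
  refine LinearMap.ext fun x => ?_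
  change ψ x • AlternatingMap.alternatizeUncurryFin (ψ.smulRight h) =
    AlternatingMap.alternatizeUncurryFin (ψ x • ψ.smulRight h)
  rw [AlternatingMap.alternatizeUncurryFin_smul]

theorem alt_eq_zero_of_mem {p : ℕ} (f : AltK ι R (p + 1)) (u : ι → ℂ) (h : f.curryLeft u = 0)
    (v : Fin (p + 1) → (ι → ℂ)) (j : Fin (p + 1)) (hj : v j = u) : f v = 0 := by
  have h1 : v = j.insertNth u (j.removeNth v) := by rw [← hj, Fin.insertNth_self_removeNth]
  rw [h1, AlternatingMap.map_insertNth, ← AlternatingMap.curryLeft_apply_apply, h]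
  simp

theorem curry_comm {p : ℕ} (f : AltK ι R (p + 2)) (u w : ι → ℂ) :
    (f.curryLeft u).curryLeft w = - (f.curryLeft w).curryLeft u := by
  ext v
  simp [alt_swap f u w]

end gen

/-- the inductive exactness statement -/
def EK (p : ℕ) (N : Submodule ℂ (PolyC 3)) (k : ℕ) : Prop :=
  ∀ f : AA (p + 1), (∀ l : Fin 3, l.val < k → f.curryLeft (ebas (yi l)) = 0) →
    (∀ v, dK XM f v ∈ Ik k) →
    (∀ s : Fin (p + 1) → QI, (∀ j l, s j ≠ yi l) → f (fun j => ebas (s j)) ∈ N) →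
    ∃ g : AA (p + 2), (∀ l : Fin 3, l.val < k → g.curryLeft (ebas (yi l)) = 0) ∧
      ∀ v, (f - dK XM g) v ∈ Ik k

theorem psi_yi (l j : Fin 3) (h : l ≠ j) : psi (yi l) (ebas (yi j)) = 0 := by
  rw [psi_ebas, if_neg]
  intro hh
  have := congrArg (fun i : QI => i.1 l) hh
  simp [yi, h.symm] at this

theorem EK_step (p : ℕ) (N : Submodule ℂ (PolyC 3)) (l : Fin 3) (hE : EK p N (l.val + 1)) :
    EK p N l.val := by
  intro f hf1 hf2 hf3
  set ψ : (QI → ℂ) →ₗ[ℂ] ℂ := psi (yi l) with hψ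
  set y : PolyC 3 := XM (yi l) with hy
  have hXψ : Xof XM ψ = y := Xof_psi _ _
  have hψl : ψ (ebas (yi l)) = 1 := by simp [hψ, psi_ebas]
  set h : AA p := f.curryLeft (ebas (yi l)) with hh
  set f' : AA (p + 1) := f - wd ψ h with hf'
  have c1 : ∀ j : Fin 3, j.val < l.val + 1 → f'.curryLeft (ebas (yi j)) = 0 := by
    intro j hj
    have hsub : f'.curryLeft (ebas (yi j)) =
        f.curryLeft (ebas (yi j)) - (wd ψ h).curryLeft (ebas (yi j)) := rfl
    rw [hsub]
    by_cases hjl : l = j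
    · subst hjl
      cases p with
      | zero => rw [curryLeft_wd_zero, hψl, one_smul, sub_self]
      | succ p => rw [curryLeft_wd, hψl, one_smul, hh, AlternatingMap.curryLeft_same, wd_zero,
          sub_zero, sub_self]
    · have hlt : j.val < l.val := by
        have : l.val ≠ j.val := fun h => hjl (Fin.ext h)
        omega
      have h0 : ψ (ebas (yi j)) = 0 := psi_yi l j hjl
      rw [hf1 j hlt]
      cases p with
      | zero => rw [curryLeft_wd_zero, h0, zero_smul, sub_zero]
      | succ p =>
        rw [curryLeft_wd, h0, hh, curry_comm, hf1 j hlt, AlternatingMap.curryLeft_zero]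
        simp [wd_zero]
  have c2 : ∀ v, dK XM f' v ∈ Ik (l.val + 1) := by
    intro v
    have hyh : (y • h) v ∈ Ik (l.val + 1) := by
      rw [AlternatingMap.smul_apply, smul_eq_mul, mul_comm]
      exact Ik_mul _ (XM_yi_mem l)
    rw [hf', dK_sub]
    refine Submodule.sub_mem _ (Ik_mono (by omega) (hf2 v)) ?_
    cases p with
    | zero => rw [dK_wd_zero, hXψ]; exact hyh
    | succ p =>
      rw [dK_wd, hXψ]
      refine Submodule.sub_mem _ hyh (wd_mem _ _ _ (fun w => ?_) v)
      have := curryLeft_dK XM f (ebas (yi l))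
      have h2 : dK XM h = - (dK XM f).curryLeft (ebas (yi l)) := by rw [this, neg_neg]
      rw [h2, AlternatingMap.neg_apply]
      exact Submodule.neg_mem _ (Ik_mono (by omega) (hf2 _))
  have c3 : ∀ s : Fin (p + 1) → QI, (∀ j l, s j ≠ yi l) → f' (fun j => ebas (s j)) ∈ N := by
    intro s hs
    rw [hf', AlternatingMap.sub_apply, wd_apply]
    rw [Finset.sum_eq_zero, sub_zero]
    · exact hf3 s hs
    · intro j _
      rw [hψ, psi_ebas, if_neg (hs j l).symm]; simp
  obtain ⟨g, hg1, hg2⟩ := hE f' c1 c2 c3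
  set φ : AA (p + 1) := f' - dK XM g with hφ
  set κ : AA (p + 1) := (divL (yi l).1).compAlternatingMap φ with hκ
  set r : AA (p + 1) := φ - y • κ with hr
  have r1 : ∀ v, r v ∈ Ik l.val := fun v => divL_rem l (hg2 v)
  have hφ0 : ∀ j : Fin 3, j.val < l.val → φ.curryLeft (ebas (yi j)) = 0 := by
    intro j hj
    have : φ.curryLeft (ebas (yi j)) = f'.curryLeft (ebas (yi j)) -
      (dK XM g).curryLeft (ebas (yi j)) := rfl
    rw [this, c1 j (by omega), curryLeft_dK, hg1 j (by omega), dK_zero]; simp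
  refine ⟨g + wd ψ κ, fun j hj => ?_, ?_⟩
  · have : (g + wd ψ κ).curryLeft (ebas (yi j)) = g.curryLeft (ebas (yi j)) +
      (wd ψ κ).curryLeft (ebas (yi j)) := rfl
    rw [this, hg1 j (by omega), curryLeft_wd, psi_yi l j (fun h => by subst h; omega), hκ,
      AlternatingMap.curryLeft_compAlternatingMap, hφ0 j hj]
    ext v
    simp [wd_apply]
  · set h' : AA p := h + dK XM κ with hh'
    have key : f - dK XM (g + wd ψ κ) = r + wd ψ h' := by
      rw [dK_add, dK_wd, hXψ, hr, hφ, hf', hh', wd_add]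
      abel
    have k1 : ∀ v, dK XM (wd ψ h') v ∈ Ik l.val := by
      intro v
      have e1 : wd ψ h' = f - dK XM (g + wd ψ κ) - r := by rw [key]; abel
      rw [e1, dK_sub, dK_sub, dK_dK, sub_zero]
      exact Submodule.sub_mem _ (hf2 v) (dK_mem _ _ _ (fun i r hr => Ik_mul _ hr) _ r1 v)
    intro v
    rw [key, AlternatingMap.add_apply]
    refine Submodule.add_mem _ (r1 v) ?_
    cases p with
    | zero =>
      refine wd_mem _ _ _ (fun w => Ik_reg l ?_) v
      have := k1 w
      rwa [dK_wd_zero, hXψ] at this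
    | succ p =>
      apply Ik_reg l
      have e2 : y • wd ψ h' = wd ψ (dK XM (wd ψ h')) := by
        rw [dK_wd, hXψ, wd_sub, wd_wd, sub_zero, wd_smul]
      have := wd_mem (Ik l.val) ψ _ k1 v
      rwa [← e2] at this

theorem EK_descend (p : ℕ) (N : Submodule ℂ (PolyC 3)) (h3 : EK p N 3) : EK p N 0 :=
  EK_step p N 0 (EK_step p N 1 (EK_step p N 2 h3))

theorem exact_of_EK3 (p : ℕ) (N : Submodule ℂ (PolyC 3)) (h3 : EK p N 3) (f : AA (p + 1))
    (hd : dK XM f = 0)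
    (hs : ∀ s : Fin (p + 1) → QI, (∀ j l, s j ≠ yi l) → f (fun j => ebas (s j)) ∈ N) :
    ∃ g, dK XM g = f := by
  obtain ⟨g, -, hg⟩ := EK_descend p N h3 f (fun l hl => by omega)
    (fun v => by rw [hd]; exact Submodule.zero_mem _) hs
  refine ⟨g, ?_⟩
  ext1 v
  have := Ik_zero (hg v)
  rw [AlternatingMap.sub_apply, sub_eq_zero] at this
  exact this.symm

theorem mem_of_nonY {p : ℕ} (f : AA (p + 1)) (W : Submodule ℂ (PolyC 3))
    (h0 : ∀ l : Fin 3, f.curryLeft (ebas (yi l)) = 0)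
    (hs : ∀ s : Fin (p + 1) → QI, (∀ j l, s j ≠ yi l) → f (fun j => ebas (s j)) ∈ W) (v) :
    f v ∈ W := by
  refine alt_mem_of_basis f W (fun s => ?_) v
  by_cases h : ∀ j l, s j ≠ yi l
  · exact hs s h
  · push Not at h
    obtain ⟨j, l, hjl⟩ := h
    rw [alt_eq_zero_of_mem f (ebas (yi l)) (h0 l) _ j (by simp [hjl])]
    exact Submodule.zero_mem _

theorem EK3_I3 (p : ℕ) : EK p (Ik 3) 3 := by
  intro f h0 _ hs
  refine ⟨0, fun l _ => rfl, fun v => ?_⟩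
  rw [dK_zero, sub_zero]
  exact mem_of_nonY f _ (fun l => h0 l (by omega)) hs v

theorem exact_I3 (p : ℕ) (f : AA (p + 1)) (hd : dK XM f = 0)
    (hs : ∀ s : Fin (p + 1) → QI, (∀ j l, s j ≠ yi l) → f (fun j => ebas (s j)) ∈ Ik 3) :
    ∃ g, dK XM g = f := exact_of_EK3 p _ (EK3_I3 p) f hd hs

/-- homogeneous pieces -/
abbrev Hm (e : ℕ) : Submodule ℂ (PolyC 3) := MvPolynomial.homogeneousSubmodule (Fin 3) ℂ e

theorem mem_Hm {e : ℕ} {P : PolyC 3} : P ∈ Hm e ↔ ∀ m, P.coeff m ≠ 0 → m.degree = e := by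
  rw [MvPolynomial.mem_homogeneousSubmodule]
  simp only [MvPolynomial.IsHomogeneous, MvPolynomial.IsWeightedHomogeneous,
    Finsupp.degree_eq_weight_one]
  exact Iff.rfl

theorem Hm_coeff {e : ℕ} {P : PolyC 3} (h : P ∈ Hm e) (m : Fin 3 →₀ ℕ) (hm : m.degree ≠ e) :
    P.coeff m = 0 := by
  by_contra hc
  exact hm (mem_Hm.1 h m hc)

theorem Hm_le_I3 {e : ℕ} (he : 13 ≤ e) {P : PolyC 3} (h : P ∈ Hm e) : P ∈ Ik 3 := by
  intro m hm
  apply Hm_coeff h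
  rw [Finsupp.degree_eq_sum, Fin.sum_univ_three]
  have := hm 0 (by simp); have := hm 1 (by simp); have := hm 2 (by simp)
  omega

theorem exact_ge13 (p e : ℕ) (he : 13 ≤ e) (f : AA (p + 1)) (hf : ∀ v, f v ∈ Hm e)
    (hd : dK XM f = 0) : ∃ g, dK XM g = f :=
  exact_I3 p f hd fun _ _ => Hm_le_I3 he (hf _)

theorem XM_mul_Hm (e : ℕ) (i : QI) (P : PolyC 3) (h : P ∈ Hm e) : XM i * P ∈ Hm (e + 5) := by
  rw [MvPolynomial.mem_homogeneousSubmodule] at *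
  rw [add_comm]
  exact (MvPolynomial.isHomogeneous_monomial _ i.2).mul h

theorem hc_XM_mul (e : ℕ) (i : QI) (P : PolyC 3) :
    MvPolynomial.homogeneousComponent (e + 5) (XM i * P) =
      XM i * MvPolynomial.homogeneousComponent e P := by
  ext m
  rw [MvPolynomial.coeff_homogeneousComponent, XM, MvPolynomial.coeff_monomial_mul',
    MvPolynomial.coeff_monomial_mul', MvPolynomial.coeff_homogeneousComponent]
  by_cases h : i.1 ≤ m
  · obtain ⟨m', rfl⟩ := exists_add_of_le h
    have : 5 + Finsupp.degree m' = e + 5 ↔ Finsupp.degree m' = e := by omega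
    simp [i.2, this]
  · simp [h]

/-- replace a primitive by a homogeneous one -/
theorem homog_prim {p : ℕ} (e : ℕ) (f : AA p) (hf : ∀ v, f v ∈ Hm (e + 5)) (g : AA (p + 1))
    (hg : dK XM g = f) : ∃ g' : AA (p + 1), (∀ v, g' v ∈ Hm e) ∧ dK XM g' = f := by
  refine ⟨(MvPolynomial.homogeneousComponent e).compAlternatingMap g, fun v => ?_, ?_⟩
  · exact MvPolynomial.homogeneousComponent_mem _ _
  · ext1 v
    rw [← hg, dK_apply]
    simp only [LinearMap.compAlternatingMap_apply, ← hc_XM_mul]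
    rw [← map_sum, ← dK_apply, hg]
    exact MvPolynomial.homogeneousComponent_eq_self (hf v)

end

set_option linter.unusedSectionVars false

noncomputable section

/-- the socle exponent -/
def c444 : Fin 3 →₀ ℕ := Finsupp.equivFunOnFinite.symm (fun _ => 4)

theorem c444_apply (l : Fin 3) : c444 l = 4 := rfl

/-- socle coefficient as a constant polynomial -/
def L444 : PolyC 3 →ₗ[ℂ] PolyC 3 where
  toFun P := MvPolynomial.C (P.coeff c444)
  map_add' := by intro a b; simp
  map_smul' := by intro a b; simp [MvPolynomial.smul_eq_C_mul]

/-- socle monomial -/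
def B444 : PolyC 3 := MvPolynomial.monomial c444 1

theorem sub_B444 {P : PolyC 3} (h : P ∈ Hm 12) : P - B444 * L444 P ∈ Ik 3 := by
  intro m hm
  have e1 : (B444 * L444 P).coeff m = if m = c444 then P.coeff c444 else 0 := by
    change (B444 * MvPolynomial.C (P.coeff c444)).coeff m = _
    rw [mul_comm, MvPolynomial.coeff_C_mul, B444, MvPolynomial.coeff_monomial]
    by_cases h : m = c444
    · simp [h]
    · simp [h, Ne.symm h]
  rw [MvPolynomial.coeff_sub, e1]
  split_ifs with h1
  · rw [h1, sub_self]
  · rw [sub_zero]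
    apply Hm_coeff h
    intro hd
    apply h1
    rw [Finsupp.degree_eq_sum, Fin.sum_univ_three] at hd
    have := hm 0 (by simp); have := hm 1 (by simp); have := hm 2 (by simp)
    ext l
    rw [c444_apply]
    fin_cases l <;> simp at * <;> omega

/-- indices that are not fifth powers -/
def nonY : Finset QI := Finset.univ.filter fun i => ∀ l, i ≠ yi l

theorem mem_nonY (i : QI) : i ∈ nonY ↔ ∀ l, i ≠ yi l := by simp [nonY]

theorem nonY_le {i : QI} (hi : i ∈ nonY) (l : Fin 3) : i.1 l ≤ 4 := by
  by_contra hc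
  rw [mem_nonY] at hi
  apply hi l
  apply Subtype.ext
  have h := i.2
  rw [Finsupp.degree_eq_sum, Fin.sum_univ_three] at h
  ext j
  fin_cases l <;> fin_cases j <;> simp [yi] at * <;> omega

theorem yi_inj : Function.Injective yi := by
  intro a b h
  by_contra hab
  have := psi_yi a b hab
  rw [h] at this
  simp [psi_ebas] at this

theorem card_nonY : nonY.card = 18 := by
  have h : nonY = (Finset.univ.image yi)ᶜ := by
    ext i; simp [mem_nonY, eq_comm]
  rw [h, Finset.card_compl, Finset.card_image_of_injective _ yi_inj]
  have := card_MIdx 5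
  simp [this, Nat.choose]

/-- complementary monomial -/
def Mc (i : QI) : PolyC 3 := MvPolynomial.monomial (c444 - i.1) 1

theorem Mc_mul_self {i : QI} (hi : i ∈ nonY) : Mc i * XM i = B444 := by
  rw [Mc, XM, MvPolynomial.monomial_mul, B444, one_mul]
  have : c444 - i.1 + i.1 = c444 := by
    ext l
    have := nonY_le hi l
    simp [c444_apply]; omega
  rw [this]

theorem Mc_mul_ne {i j : QI} (hi : i ∈ nonY) (hij : i ≠ j) : Mc i * XM j ∈ Ik 3 := by
  intro m hm
  rw [Mc, XM, MvPolynomial.monomial_mul, MvPolynomial.coeff_monomial, if_neg]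
  rintro rfl
  apply hij
  apply Subtype.ext
  have h1 := i.2
  have h2 := j.2
  rw [Finsupp.degree_eq_sum, Fin.sum_univ_three] at h1 h2
  have a0 := hm 0 (by simp); have a1 := hm 1 (by simp); have a2 := hm 2 (by simp)
  have b0 := nonY_le hi 0; have b1 := nonY_le hi 1; have b2 := nonY_le hi 2
  simp [c444_apply] at a0 a1 a2
  ext l
  fin_cases l <;> simp <;> omega

theorem EK3_12 (p : ℕ) (hp : p + 1 ≠ 18) : EK p (Hm 12) 3 := by
  intro f h0 _ hs
  have h0' : ∀ l : Fin 3, f.curryLeft (ebas (yi l)) = 0 := fun l => h0 l (by omega)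
  have hf : ∀ v, f v ∈ Hm 12 := mem_of_nonY f _ h0' hs
  set f0 : AA (p + 1) := L444.compAlternatingMap f with hf0
  have hf00 : ∀ l : Fin 3, f0.curryLeft (ebas (yi l)) = 0 := by
    intro l
    rw [hf0, AlternatingMap.curryLeft_compAlternatingMap, h0' l]
    ext; simp
  have hB : ∀ v, (f - B444 • f0) v ∈ Ik 3 := fun v => sub_B444 (hf v)
  set c : PolyC 3 := MvPolynomial.C (1 / (18 - ((p : ℂ) + 1))) with hc
  set g0 : AA (p + 2) := ∑ i ∈ nonY, Mc i • wd (psi i) f0 with hg0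
  have hne : (18 - ((p : ℂ) + 1)) ≠ 0 := by
    intro h
    apply hp
    have : ((p + 1 : ℕ) : ℂ) = 18 := by push_cast; linear_combination -h
    exact_mod_cast this
  have hterm : ∀ i ∈ nonY, ∀ v, (wd (psi i) (Mc i • dK XM f0 -
      B444 • f0.curryLeft (ebas i))) v ∈ Ik 3 := by
    intro i hi v
    refine wd_mem _ _ _ (fun w => ?_) v
    have : (Mc i • dK XM f0 - B444 • f0.curryLeft (ebas i)) w =
        ∑ j ∈ Finset.univ.erase i, Mc i * XM j * f0 (Matrix.vecCons (ebas j) w) := by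
      rw [AlternatingMap.sub_apply, AlternatingMap.smul_apply, AlternatingMap.smul_apply, dK_apply,
        smul_eq_mul, smul_eq_mul, Finset.mul_sum, ← Finset.add_sum_erase _ _ (Finset.mem_univ i),
        AlternatingMap.curryLeft_apply_apply, ← mul_assoc, Mc_mul_self hi]
      simp only [mul_assoc]
      ring
    rw [this]
    refine Submodule.sum_mem _ fun j hj => ?_
    rw [mul_comm]
    exact Ik_mul _ (Mc_mul_ne hi (Finset.ne_of_mem_erase hj).symm)
  have hdg0 : ∀ v, (dK XM g0 - (B444 * MvPolynomial.C (18 - ((p : ℂ) + 1))) • f0) v ∈ Ik 3 := by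
    have e1 : ∑ i ∈ nonY, wd (psi i) (f0.curryLeft (ebas i)) = ((p : ℂ) + 1) • f0 := by
      rw [← euler]
      refine Finset.sum_subset (Finset.subset_univ _) fun i _ hi => ?_
      rw [mem_nonY] at hi
      push Not at hi
      obtain ⟨l, rfl⟩ := hi
      rw [hf00, wd_zero]
    have e2 : dK XM g0 - (B444 * MvPolynomial.C (18 - ((p : ℂ) + 1))) • f0 =
        - ∑ i ∈ nonY, wd (psi i) (Mc i • dK XM f0 - B444 • f0.curryLeft (ebas i)) := by
      have e3 : dK XM g0 = ∑ i ∈ nonY, (B444 • f0 - wd (psi i) (Mc i • dK XM f0)) := by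
        rw [hg0, dK_sum]
        refine Finset.sum_congr rfl fun i hi => ?_
        rw [dK_smul, dK_wd, Xof_psi, smul_sub, smul_smul, Mc_mul_self hi, wd_smul]
      rw [e3]
      simp only [wd_sub, Finset.sum_sub_distrib, wd_smul, ← Finset.smul_sum]
      rw [e1, Finset.sum_const, card_nonY]
      ext1 v
      simp only [AlternatingMap.sub_apply, AlternatingMap.smul_apply, AlternatingMap.neg_apply,
        smul_eq_mul, MvPolynomial.smul_eq_C_mul, map_sub, map_add, nsmul_eq_mul]
      have e18 : (MvPolynomial.C (18 : ℂ) : PolyC 3) = 18 := map_ofNat _ 18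
      rw [e18]
      simp
      ring
    intro v
    rw [e2, AlternatingMap.neg_apply, altsum_apply]
    exact Submodule.neg_mem _ (Submodule.sum_mem _ fun i hi => hterm i hi v)
  refine ⟨c • g0, fun l _ => ?_, fun v => ?_⟩
  · have : (c • g0).curryLeft (ebas (yi l)) = c • g0.curryLeft (ebas (yi l)) := rfl
    rw [this]
    have e4 : g0.curryLeft (ebas (yi l)) = 0 := by
      ext1 v
      rw [AlternatingMap.curryLeft_apply_apply, hg0, altsum_apply]
      refine Finset.sum_eq_zero fun i hi => ?_
      rw [AlternatingMap.smul_apply, ← AlternatingMap.curryLeft_apply_apply, curryLeft_wd, hf00,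
        wd_zero, psi_ebas, if_neg ((mem_nonY i).1 hi l)]
      simp
    rw [e4, smul_zero]
  · have e5 : f - dK XM (c • g0) = (f - B444 • f0) -
        c • (dK XM g0 - (B444 * MvPolynomial.C (18 - ((p : ℂ) + 1))) • f0) := by
      have e6 : c * (B444 * MvPolynomial.C (18 - ((p : ℂ) + 1))) = B444 := by
        rw [hc, mul_left_comm, ← MvPolynomial.C_mul, one_div_mul_cancel hne]; simp
      rw [dK_smul, smul_sub, smul_smul, e6]
      abel
    rw [e5, AlternatingMap.sub_apply]
    exact Submodule.sub_mem _ (hB v) (Ik_mul _ (hdg0 v))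

theorem exact_12 (p : ℕ) (hp : p + 1 ≠ 18) (f : AA (p + 1)) (hf : ∀ v, f v ∈ Hm 12)
    (hd : dK XM f = 0) : ∃ g, dK XM g = f :=
  exact_of_EK3 p _ (EK3_12 p hp) f hd fun _ _ => hf _

/-- enumeration of the non-fifth-powers -/
def enY : Fin 18 ≃ nonY := (nonY.equivFinOfCardEq card_nonY).symm

/-- the functional detecting the last syzygy -/
def lam18 : AA 18 →ₗ[ℂ] ℂ where
  toFun f := (f (fun k => ebas (enY k).1)).coeff c444
  map_add' := by intro a b; simp
  map_smul' := by intro a b; simp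

theorem exact_18 (f : AA 18) (hf : ∀ v, f v ∈ Hm 12) (hd : dK XM f = 0) (hl : lam18 f = 0) :
    ∃ g, dK XM g = f := by
  refine exact_I3 17 f hd fun s hs => ?_
  by_cases hinj : Function.Injective s
  · have hs' : ∀ j, s j ∈ nonY := fun j => (mem_nonY _).2 (hs j)
    set t : Fin 18 → Fin 18 := fun j => enY.symm ⟨s j, hs' j⟩ with ht
    have htinj : Function.Injective t := by
      intro a b hab
      apply hinj
      have := enY.symm.injective hab
      exact congrArg Subtype.val this
    set σ : Equiv.Perm (Fin 18) := Equiv.ofBijective t (Finite.injective_iff_bijective.1 htinj)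
    have e1 : (fun j => (ebas (s j) : QI → ℂ)) = (fun k => ebas (enY k).1) ∘ σ := by
      ext1 j
      have : enY (σ j) = ⟨s j, hs' j⟩ := by
        change enY (enY.symm _) = _
        simp
      simp [this]
    rw [e1, AlternatingMap.map_perm]
    have h2 : f (fun k => ebas (enY k).1) ∈ Ik 3 := by
      have h3 := sub_B444 (hf (fun k => ebas (enY k).1))
      have h4 : L444 (f (fun k => ebas (enY k).1)) = 0 := by
        change MvPolynomial.C _ = _
        have : (f (fun k => ebas (enY k).1)).coeff c444 = 0 := hl
        rw [this]; simp
      rwa [h4, mul_zero, sub_zero] at h3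
    rw [Units.smul_def]
    exact zsmul_mem h2 _
  · rw [AlternatingMap.map_eq_zero_of_not_injective]
    · exact Submodule.zero_mem _
    · intro h
      apply hinj
      intro a b hab
      exact h (by simp [hab])

/-- multiplication by quintic monomials is surjective in large degree -/
theorem mu_surj (e : ℕ) (P : PolyC 3) (hP : P ∈ Hm (e + 5)) :
    ∃ c : QI → PolyC 3, (∀ i, c i ∈ Hm e) ∧ ∑ i, XM i * c i = P := by
  let T : Submodule ℂ (PolyC 3) :=
    { carrier := {P | ∃ c : QI → PolyC 3, (∀ i, c i ∈ Hm e) ∧ ∑ i, XM i * c i = P}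
      add_mem' := by
        rintro a b ⟨c, hc, rfl⟩ ⟨c', hc', rfl⟩
        exact ⟨c + c', fun i => Submodule.add_mem _ (hc i) (hc' i), by
          simp [mul_add, Finset.sum_add_distrib]⟩
      zero_mem' := ⟨0, fun i => Submodule.zero_mem _, by simp⟩
      smul_mem' := by
        rintro a b ⟨c, hc, rfl⟩
        exact ⟨a • c, fun i => Submodule.smul_mem _ _ (hc i), by
          simp [Finset.smul_sum]⟩ }
  change P ∈ T
  rw [← MvPolynomial.support_sum_monomial_coeff P]
  refine Submodule.sum_mem _ fun m hm => ?_
  have hdeg : m.degree = e + 5 := mem_Hm.1 hP m (by simpa using hm)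
  obtain ⟨i, hi1, hi2⟩ := Finsupp.exists_le_degree_eq m 5 (by omega)
  obtain ⟨m', rfl⟩ := exists_add_of_le hi1
  refine ⟨Pi.single ⟨i, hi2⟩ (MvPolynomial.monomial m' (P.coeff (i + m'))), fun j => ?_, ?_⟩
  · by_cases hj : j = ⟨i, hi2⟩
    · subst hj
      rw [Pi.single_eq_same]
      refine MvPolynomial.isHomogeneous_monomial _ ?_
      rw [map_add, hi2] at hdeg; omega
    · rw [Pi.single_eq_of_ne hj]; exact Submodule.zero_mem _
  · rw [Finset.sum_eq_single ⟨i, hi2⟩]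
    · rw [Pi.single_eq_same, XM, MvPolynomial.monomial_mul, one_mul]
    · intro j _ hj
      rw [Pi.single_eq_of_ne hj, mul_zero]
    · simp

theorem exact_p0 (e : ℕ) (f : AA 0) (hf : ∀ v, f v ∈ Hm (e + 5)) :
    ∃ g : AA 1, (∀ v, g v ∈ Hm e) ∧ dK XM g = f := by
  obtain ⟨c, hc, hs⟩ := mu_surj e (f 0) (hf 0)
  refine ⟨∑ i, wd (psi i) (AlternatingMap.constOfIsEmpty ℂ (QI → ℂ) (Fin 0) (c i)), ?_, ?_⟩
  · intro v
    rw [altsum_apply]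
    refine Submodule.sum_mem _ fun i _ => wd_mem _ _ _ (fun w => ?_) v
    exact hc i
  · rw [dK_sum]
    ext1 v
    rw [altsum_apply, Subsingleton.elim v 0, ← hs]
    refine Finset.sum_congr rfl fun i _ => ?_
    rw [dK_wd_zero, Xof_psi]
    rfl

end

set_option linter.unusedSectionVars false

noncomputable section

/-- variables -/
abbrev xv (k : Fin 3) : PolyC 3 := MvPolynomial.X k

theorem hc_mul {d : ℕ} (n : ℕ) {Q : PolyC 3} (hQ : Q ∈ Hm d) (P : PolyC 3) :
    MvPolynomial.homogeneousComponent (n + d) (Q * P) =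
      Q * MvPolynomial.homogeneousComponent n P := by
  have key : (MvPolynomial.homogeneousComponent (n + d)) ∘ₗ (LinearMap.mulLeft ℂ Q) =
      (LinearMap.mulLeft ℂ Q) ∘ₗ (MvPolynomial.homogeneousComponent (R := ℂ) (σ := Fin 3) n) := by
    refine MvPolynomial.linearMap_ext fun m => LinearMap.ext fun c => ?_
    have h1 : (MvPolynomial.monomial m c : PolyC 3) ∈ Hm m.degree :=
      MvPolynomial.isHomogeneous_monomial _ rfl
    have h2 : Q * MvPolynomial.monomial m c ∈ Hm (d + m.degree) :=
      MvPolynomial.IsHomogeneous.mul hQ h1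
    simp only [LinearMap.coe_comp, Function.comp_apply, LinearMap.mulLeft_apply]
    rw [MvPolynomial.homogeneousComponent_of_mem h1, MvPolynomial.homogeneousComponent_of_mem h2]
    have : (n + d = d + m.degree) ↔ n = m.degree := by omega
    simp [this]
  exact LinearMap.congr_fun key P

theorem xv_mem (k : Fin 3) : xv k ∈ Hm 1 := MvPolynomial.isHomogeneous_X _ _

theorem xv_mul_mem {e : ℕ} (k : Fin 3) {P : PolyC 3} (h : P ∈ Hm e) : xv k * P ∈ Hm (e + 1) := by
  rw [add_comm]; exact MvPolynomial.IsHomogeneous.mul (xv_mem k) h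

theorem hc_mem (n : ℕ) (P : PolyC 3) : MvPolynomial.homogeneousComponent n P ∈ Hm n :=
  MvPolynomial.homogeneousComponent_mem _ _

theorem hc_self {n : ℕ} {P : PolyC 3} (h : P ∈ Hm n) :
    MvPolynomial.homogeneousComponent n P = P := MvPolynomial.homogeneousComponent_eq_self h

theorem dvd_sub_subst (l : PolyC 3) (σ : PolyC 3 →ₐ[ℂ] PolyC 3)
    (h : ∀ k, l ∣ xv k - σ (xv k)) (P : PolyC 3) : l ∣ P - σ P := by
  induction P using MvPolynomial.induction_on with
  | C a =>
    have : σ (MvPolynomial.C a) = MvPolynomial.C a := σ.commutes a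
    rw [this, sub_self]; exact dvd_zero _
  | add p q hp hq =>
    rw [map_add, add_sub_add_comm]; exact dvd_add hp hq
  | mul_X p k hp =>
    have : p * MvPolynomial.X k - σ (p * MvPolynomial.X k) =
        (p - σ p) * xv k + σ p * (xv k - σ (xv k)) := by
      rw [map_mul]; ring
    rw [this]
    exact dvd_add (Dvd.dvd.mul_right hp _) (Dvd.dvd.mul_left (h k) _)

/-- Koszul exactness, first step -/
theorem koszul1 {e : ℕ} (c0 c1 c2 : PolyC 3) (h0 : c0 ∈ Hm (e + 1)) (h1 : c1 ∈ Hm (e + 1))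
    (h2 : c2 ∈ Hm (e + 1)) (h : xv 0 * c0 + xv 1 * c1 + xv 2 * c2 = 0) :
    ∃ u0 u1 u2 : PolyC 3, u0 ∈ Hm e ∧ u1 ∈ Hm e ∧ u2 ∈ Hm e ∧
      c0 = xv 1 * u2 - xv 2 * u1 ∧ c1 = xv 2 * u0 - xv 0 * u2 ∧ c2 = xv 0 * u1 - xv 1 * u0 := by
  let σ : PolyC 3 →ₐ[ℂ] PolyC 3 := MvPolynomial.aeval ![0, xv 1, xv 2]
  have s0 : σ (xv 0) = 0 := by simp [σ]
  have s1 : σ (xv 1) = xv 1 := by simp [σ]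
  have s2 : σ (xv 2) = xv 2 := by simp [σ]
  have hσ : ∀ P, xv 0 ∣ P - σ P := by
    apply dvd_sub_subst
    intro k
    fin_cases k
    · change xv 0 ∣ xv 0 - σ (xv 0)
      rw [s0, sub_zero]
    · change xv 0 ∣ xv 1 - σ (xv 1)
      rw [s1, sub_self]; exact dvd_zero _
    · change xv 0 ∣ xv 2 - σ (xv 2)
      rw [s2, sub_self]; exact dvd_zero _
  obtain ⟨a1, ha1⟩ := hσ c1
  obtain ⟨a2, ha2⟩ := hσ c2
  have hr : xv 1 * σ c1 + xv 2 * σ c2 = 0 := by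
    have := congrArg σ h
    simp only [map_add, map_mul, s0, s1, s2, map_zero] at this
    linear_combination this
  have hne0 : xv 0 ≠ 0 := MvPolynomial.X_ne_zero _
  have hne2 : xv 2 ≠ 0 := MvPolynomial.X_ne_zero _
  obtain ⟨s, hs⟩ : xv 2 ∣ σ c1 := by
    have hd : xv 2 ∣ xv 1 * σ c1 := ⟨-σ c2, by linear_combination hr⟩
    rcases (MvPolynomial.X_prime (R := ℂ) (i := (2 : Fin 3))).dvd_or_dvd hd with h3 | h3
    · rw [MvPolynomial.X_dvd_X] at h3
      rcases h3 with h3 | h3 <;> simp at h3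
    · exact h3
  have hs2 : σ c2 = - (xv 1 * s) := by
    apply mul_left_cancel₀ hne2
    rw [hs] at hr
    linear_combination hr
  have e0 : c0 = - (xv 1 * a1) - xv 2 * a2 := by
    apply mul_left_cancel₀ hne0
    have e1 : c1 = xv 0 * a1 + xv 2 * s := by rw [← hs]; linear_combination ha1
    have e2 : c2 = xv 0 * a2 - xv 1 * s := by linear_combination ha2 + hs2
    rw [e1, e2] at h
    linear_combination h
  have e1 : c1 = xv 0 * a1 + xv 2 * s := by rw [← hs]; linear_combination ha1
  have e2 : c2 = xv 0 * a2 - xv 1 * s := by linear_combination ha2 + hs2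
  refine ⟨MvPolynomial.homogeneousComponent e s, MvPolynomial.homogeneousComponent e a2,
    - MvPolynomial.homogeneousComponent e a1, hc_mem _ _, hc_mem _ _,
    Submodule.neg_mem _ (hc_mem _ _), ?_, ?_, ?_⟩
  · conv_lhs => rw [← hc_self h0, e0]
    rw [map_sub, map_neg, hc_mul e (xv_mem 1), hc_mul e (xv_mem 2)]; ring
  · conv_lhs => rw [← hc_self h1, e1]
    rw [map_add, hc_mul e (xv_mem 0), hc_mul e (xv_mem 2)]; ring
  · conv_lhs => rw [← hc_self h2, e2]
    rw [map_sub, hc_mul e (xv_mem 0), hc_mul e (xv_mem 1)]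

/-- Koszul exactness, second step -/
theorem koszul2 {e : ℕ} (u0 u1 u2 : PolyC 3) (h0 : u0 ∈ Hm (e + 1))
    (h01 : xv 0 * u1 = xv 1 * u0) (h02 : xv 0 * u2 = xv 2 * u0) :
    ∃ c ∈ Hm e, u0 = xv 0 * c ∧ u1 = xv 1 * c ∧ u2 = xv 2 * c := by
  have hne0 : xv 0 ≠ 0 := MvPolynomial.X_ne_zero _
  obtain ⟨c', hc'⟩ : xv 0 ∣ u0 := by
    have hd : xv 0 ∣ xv 1 * u0 := ⟨u1, h01.symm⟩
    rcases (MvPolynomial.X_prime (R := ℂ) (i := (0 : Fin 3))).dvd_or_dvd hd with h3 | h3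
    · rw [MvPolynomial.X_dvd_X] at h3
      rcases h3 with h3 | h3 <;> simp at h3
    · exact h3
  have hc : u0 = xv 0 * MvPolynomial.homogeneousComponent e c' := by
    conv_lhs => rw [← hc_self h0, hc']
    rw [hc_mul e (xv_mem 0)]
  refine ⟨_, hc_mem e c', hc, ?_, ?_⟩
  · apply mul_left_cancel₀ hne0
    rw [h01]; conv_lhs => rw [hc]
    ring
  · apply mul_left_cancel₀ hne0
    rw [h02]; conv_lhs => rw [hc]
    ring

theorem lift1 (e : ℕ) (P : PolyC 3) (hP : P ∈ Hm (e + 1)) :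
    ∃ c : Fin 3 → PolyC 3, (∀ i, c i ∈ Hm e) ∧ P = xv 0 * c 0 + xv 1 * c 1 + xv 2 * c 2 := by
  let T : Submodule ℂ (PolyC 3) :=
    { carrier := {P | ∃ c : Fin 3 → PolyC 3, (∀ i, c i ∈ Hm e) ∧ P = ∑ i, xv i * c i}
      add_mem' := by
        rintro a b ⟨c, hc, rfl⟩ ⟨c', hc', rfl⟩
        exact ⟨c + c', fun i => Submodule.add_mem _ (hc i) (hc' i), by
          simp [mul_add, Finset.sum_add_distrib]⟩
      zero_mem' := ⟨0, fun i => Submodule.zero_mem _, by simp⟩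
      smul_mem' := by
        rintro a b ⟨c, hc, rfl⟩
        exact ⟨a • c, fun i => Submodule.smul_mem _ _ (hc i), by
          simp [Finset.smul_sum]⟩ }
  suffices h : P ∈ T by
    obtain ⟨c, hc, h⟩ := h
    exact ⟨c, hc, by rw [h, Fin.sum_univ_three]⟩
  rw [← MvPolynomial.support_sum_monomial_coeff P]
  refine Submodule.sum_mem _ fun m hm => ?_
  have hdeg : m.degree = e + 1 := mem_Hm.1 hP m (by simpa using hm)
  obtain ⟨i, hi⟩ : ∃ i, m i ≠ 0 := by
    by_contra hcon
    push Not at hcon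
    have : m = 0 := by ext i; exact hcon i
    rw [this] at hdeg; simp at hdeg
  have hle : Finsupp.single i 1 ≤ m := by
    rw [Finsupp.single_le_iff]; omega
  obtain ⟨m', rfl⟩ := exists_add_of_le hle
  refine ⟨Pi.single i (MvPolynomial.monomial m' (P.coeff (Finsupp.single i 1 + m'))),
    fun j => ?_, ?_⟩
  · by_cases hj : j = i
    · subst hj
      rw [Pi.single_eq_same]
      refine MvPolynomial.isHomogeneous_monomial _ ?_
      rw [map_add, Finsupp.degree_single] at hdeg; omega
    · rw [Pi.single_eq_of_ne hj]; exact Submodule.zero_mem _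
  · rw [Finset.sum_eq_single i]
    · rw [Pi.single_eq_same, xv, MvPolynomial.X, MvPolynomial.monomial_mul, one_mul]
    · intro j _ hj
      rw [Pi.single_eq_of_ne hj, mul_zero]
    · simp

/-- linear syzygy map -/
def muS : (QI → PolyC 3) →ₗ[PolyC 3] PolyC 3 := ∑ i, XM i • LinearMap.proj i

theorem muS_apply (n : QI → PolyC 3) : muS n = ∑ i, XM i * n i := by simp [muS]

theorem muS_mem {e : ℕ} (n : QI → PolyC 3) (h : ∀ i, n i ∈ Hm e) : muS n ∈ Hm (e + 5) := by
  rw [muS_apply]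
  exact Submodule.sum_mem _ fun i _ => XM_mul_Hm _ _ _ (h i)

/-- degree `e` syzygies among the quintic monomials -/
def NS (e : ℕ) : AddSubgroup (QI → PolyC 3) where
  carrier := {n | (∀ i, n i ∈ Hm e) ∧ muS n = 0}
  add_mem' := by
    rintro a b ⟨ha, ha'⟩ ⟨hb, hb'⟩
    exact ⟨fun i => Submodule.add_mem _ (ha i) (hb i), by rw [map_add, ha', hb', add_zero]⟩
  zero_mem' := ⟨fun i => Submodule.zero_mem _, map_zero _⟩
  neg_mem' := by
    rintro a ⟨ha, ha'⟩
    exact ⟨fun i => Submodule.neg_mem _ (ha i), by rw [map_neg, ha', neg_zero]⟩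

theorem NS_lift (e : ℕ) (f : QI → PolyC 3) (hf : f ∈ NS (e + 2)) :
    ∃ n : Fin 3 → (QI → PolyC 3), (∀ k, n k ∈ NS (e + 1)) ∧
      f = xv 0 • n 0 + xv 1 • n 1 + xv 2 • n 2 := by
  obtain ⟨hf1, hf2⟩ := hf
  choose c hc1 hc2 using fun i => lift1 (e + 1) (f i) (hf1 i)
  let φ : Fin 3 → (QI → PolyC 3) := fun k i => c i k
  have hφ : f = xv 0 • φ 0 + xv 1 • φ 1 + xv 2 • φ 2 := by
    ext1 i; rw [hc2 i]; rfl
  have hφm : ∀ k, muS (φ k) ∈ Hm (e + 5 + 1) := fun k => muS_mem (e := e + 1) _ fun i => hc1 i k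
  have hrel : xv 0 * muS (φ 0) + xv 1 * muS (φ 1) + xv 2 * muS (φ 2) = 0 := by
    rw [hφ] at hf2
    simpa only [map_add, map_smul, smul_eq_mul] using hf2
  obtain ⟨u0, u1, u2, h0, h1, h2, e0, e1, e2⟩ := koszul1 _ _ _ (hφm 0) (hφm 1) (hφm 2) hrel
  obtain ⟨d0, hd0, hs0⟩ := mu_surj e u0 h0
  obtain ⟨d1, hd1, hs1⟩ := mu_surj e u1 h1
  obtain ⟨d2, hd2, hs2⟩ := mu_surj e u2 h2
  rw [← muS_apply] at hs0 hs1 hs2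
  refine ⟨![φ 0 - (xv 1 • d2 - xv 2 • d1), φ 1 - (xv 2 • d0 - xv 0 • d2),
    φ 2 - (xv 0 • d1 - xv 1 • d0)], fun k => ?_, ?_⟩
  · have hx : ∀ k (d : QI → PolyC 3) i, d i ∈ Hm e → (xv k • d) i ∈ Hm (e + 1) :=
      fun k d i h => xv_mul_mem k h
    fin_cases k
    · refine ⟨fun i => Submodule.sub_mem _ (hc1 i 0) (Submodule.sub_mem _ (hx _ _ _ (hd2 i))
        (hx _ _ _ (hd1 i))), ?_⟩
      change muS (φ 0 - (xv 1 • d2 - xv 2 • d1)) = 0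
      rw [map_sub, map_sub, map_smul, map_smul, hs1, hs2, e0]; simp
    · refine ⟨fun i => Submodule.sub_mem _ (hc1 i 1) (Submodule.sub_mem _ (hx _ _ _ (hd0 i))
        (hx _ _ _ (hd2 i))), ?_⟩
      change muS (φ 1 - (xv 2 • d0 - xv 0 • d2)) = 0
      rw [map_sub, map_sub, map_smul, map_smul, hs0, hs2, e1]; simp
    · refine ⟨fun i => Submodule.sub_mem _ (hc1 i 2) (Submodule.sub_mem _ (hx _ _ _ (hd1 i))
        (hx _ _ _ (hd0 i))), ?_⟩
      change muS (φ 2 - (xv 0 • d1 - xv 1 • d0)) = 0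
      rw [map_sub, map_sub, map_smul, map_smul, hs0, hs1, e2]; simp
  · conv_lhs => rw [hφ]
    ext1 i
    simp
    ring

theorem NS_koszul (j : ℕ) (n0 n1 n2 : QI → PolyC 3) (h0 : n0 ∈ NS (j + 2)) (h1 : n1 ∈ NS (j + 2))
    (h2 : n2 ∈ NS (j + 2)) (h : xv 0 • n0 + xv 1 • n1 + xv 2 • n2 = 0) :
    ∃ r0 r1 r2 : QI → PolyC 3, r0 ∈ NS (j + 1) ∧ r1 ∈ NS (j + 1) ∧ r2 ∈ NS (j + 1) ∧
      n0 = xv 1 • r2 - xv 2 • r1 ∧ n1 = xv 2 • r0 - xv 0 • r2 ∧ n2 = xv 0 • r1 - xv 1 • r0 := by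
  choose u0 u1 u2 a0 a1 a2 e0 e1 e2 using fun i =>
    koszul1 (n0 i) (n1 i) (n2 i) (h0.1 i) (h1.1 i) (h2.1 i) (by simpa using congrFun h i)
  have E0 : n0 = xv 1 • u2 - xv 2 • u1 := funext e0
  have E1 : n1 = xv 2 • u0 - xv 0 • u2 := funext e1
  have E2 : n2 = xv 0 • u1 - xv 1 • u0 := funext e2
  have m1 := h1.2
  have m2 := h2.2
  rw [E1, map_sub, map_smul, map_smul, smul_eq_mul, smul_eq_mul] at m1
  rw [E2, map_sub, map_smul, map_smul, smul_eq_mul, smul_eq_mul] at m2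
  obtain ⟨c, hc, k0, k1, k2⟩ := koszul2 (e := j + 5) (muS u0) (muS u1) (muS u2)
    (muS_mem (e := j + 1) _ a0) (by linear_combination m2) (by linear_combination -m1)
  obtain ⟨d, hd, hs⟩ := mu_surj j c hc
  rw [← muS_apply] at hs
  have hx : ∀ k (d : QI → PolyC 3) i, d i ∈ Hm j → (xv k • d) i ∈ Hm (j + 1) :=
      fun k d i h => xv_mul_mem k h
  refine ⟨u0 - xv 0 • d, u1 - xv 1 • d, u2 - xv 2 • d, ?_, ?_, ?_, ?_, ?_, ?_⟩
  · exact ⟨fun i => Submodule.sub_mem _ (a0 i) (hx _ _ _ (hd i)), by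
      rw [map_sub, map_smul, hs, k0]; simp⟩
  · exact ⟨fun i => Submodule.sub_mem _ (a1 i) (hx _ _ _ (hd i)), by
      rw [map_sub, map_smul, hs, k1]; simp⟩
  · exact ⟨fun i => Submodule.sub_mem _ (a2 i) (hx _ _ _ (hd i)), by
      rw [map_sub, map_smul, hs, k2]; simp⟩
  · rw [E0]; ext1 i; simp; ring
  · rw [E1]; ext1 i; simp; ring
  · rw [E2]; ext1 i; simp; ring

/-- iterating a lifting property along monomials -/
theorem iter_lift {M : Type} [AddCommGroup M] [Module (PolyC 3) M] (T : ℕ → AddSubgroup M) (e : ℕ)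
    (hT : ∀ d, ∀ F ∈ T (e + d + 1), ∃ G : Fin 3 → M, (∀ k, G k ∈ T (e + d)) ∧
      F = xv 0 • G 0 + xv 1 • G 1 + xv 2 • G 2) (d : ℕ) :
    ∀ F ∈ T (e + d), ∃ s : MIdx d → M, (∀ j, s j ∈ T e) ∧
      F = ∑ j, (MvPolynomial.monomial j.1 (1 : ℂ) : PolyC 3) • s j := by
  classical
  induction d with
  | zero =>
    intro F hF
    refine ⟨fun _ => F, fun _ => hF, ?_⟩
    have hu : (Finset.univ : Finset (MIdx 0)) = {⟨0, by simp⟩} := by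
      ext x
      simp only [Finset.mem_univ, Finset.mem_singleton, true_iff]
      apply Subtype.ext
      exact (Finsupp.degree_eq_zero_iff _).1 x.2
    rw [hu, Finset.sum_singleton]
    change F = (1 : PolyC 3) • F
    rw [one_smul]
  | succ d ih =>
    intro F hF
    obtain ⟨G, hG, hFG⟩ := hT d F hF
    let T' : AddSubgroup M :=
      { carrier := {F | ∃ s : MIdx (d + 1) → M, (∀ j, s j ∈ T e) ∧
          F = ∑ j, (MvPolynomial.monomial j.1 (1 : ℂ) : PolyC 3) • s j}
        add_mem' := by
          rintro a b ⟨c, hc, rfl⟩ ⟨c', hc', rfl⟩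
          exact ⟨c + c', fun i => AddSubgroup.add_mem _ (hc i) (hc' i), by
            simp [Finset.sum_add_distrib]⟩
        zero_mem' := ⟨0, fun i => AddSubgroup.zero_mem _, by simp⟩
        neg_mem' := by
          rintro a ⟨c, hc, rfl⟩
          exact ⟨-c, fun i => AddSubgroup.neg_mem _ (hc i), by simp⟩ }
    have key : ∀ k, xv k • G k ∈ T' := by
      intro k
      obtain ⟨s, hs, hGs⟩ := ih (G k) (hG k)
      rw [hGs, Finset.smul_sum]
      refine AddSubgroup.sum_mem _ fun j _ => ?_
      have hj : (Finsupp.single k 1 + j.1).degree = d + 1 := by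
        rw [map_add, Finsupp.degree_single, j.2, add_comm]
      refine ⟨Pi.single ⟨Finsupp.single k 1 + j.1, hj⟩ (s j), fun i => ?_, ?_⟩
      · by_cases hi : i = ⟨Finsupp.single k 1 + j.1, hj⟩
        · subst hi; rw [Pi.single_eq_same]; exact hs j
        · rw [Pi.single_eq_of_ne hi]; exact AddSubgroup.zero_mem _
      · rw [Finset.sum_eq_single ⟨Finsupp.single k 1 + j.1, hj⟩]
        · rw [Pi.single_eq_same, smul_smul, xv, MvPolynomial.X, MvPolynomial.monomial_mul, one_mul]
        · intro i _ hi
          rw [Pi.single_eq_of_ne hi, smul_zero]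
        · simp
    have : F ∈ T' := by
      rw [hFG]
      exact T'.add_mem (T'.add_mem (key 0) (key 1)) (key 2)
    exact this

theorem NS_lift5 (e : ℕ) (f : QI → PolyC 3) (hf : f ∈ NS (e + 1 + 5)) :
    ∃ s : QI → QI → PolyC 3, (∀ j, s j ∈ NS (e + 1)) ∧ f = ∑ j, XM j • s j := by
  refine iter_lift NS (e + 1) (fun d F hF => ?_) 5 f hf
  have e1 : e + 1 + d + 1 = (e + d) + 2 := by omega
  have e2 : e + 1 + d = (e + d) + 1 := by omega
  rw [e1] at hF
  rw [e2]
  exact NS_lift _ F hF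

/-- bisyzygies -/
def TS (e : ℕ) : AddSubgroup (QI → QI → PolyC 3) where
  carrier := {F | (∀ i, F i ∈ NS e) ∧ ∑ i, XM i • F i = 0}
  add_mem' := by
    rintro a b ⟨ha, ha'⟩ ⟨hb, hb'⟩
    refine ⟨fun i => AddSubgroup.add_mem _ (ha i) (hb i), ?_⟩
    simp [Finset.sum_add_distrib, ha', hb']
  zero_mem' := ⟨fun i => AddSubgroup.zero_mem _, by simp⟩
  neg_mem' := by
    rintro a ⟨ha, ha'⟩
    refine ⟨fun i => AddSubgroup.neg_mem _ (ha i), ?_⟩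
    simp [ha']

/-- first index contraction -/
def muT : (QI → QI → PolyC 3) →ₗ[PolyC 3] (QI → PolyC 3) := ∑ i, XM i • LinearMap.proj i

theorem muT_apply (F : QI → QI → PolyC 3) : muT F = ∑ i, XM i • F i := by simp [muT]

theorem muT_NS {e : ℕ} (F : QI → QI → PolyC 3) (h : ∀ i, F i ∈ NS e) : muT F ∈ NS (e + 5) := by
  rw [muT_apply]
  refine AddSubgroup.sum_mem _ fun i _ => ⟨fun j => XM_mul_Hm _ _ _ ((h i).1 j), ?_⟩
  rw [map_smul, (h i).2, smul_zero]

theorem xsmul_NS {e : ℕ} (k : Fin 3) {n : QI → PolyC 3} (h : n ∈ NS e) : xv k • n ∈ NS (e + 1) :=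
  ⟨fun i => xv_mul_mem k (h.1 i), by rw [map_smul, h.2, smul_zero]⟩

theorem TS_lift (e : ℕ) (F : QI → QI → PolyC 3) (hF : F ∈ TS (e + 3)) :
    ∃ n : Fin 3 → (QI → QI → PolyC 3), (∀ k, n k ∈ TS (e + 2)) ∧
      F = xv 0 • n 0 + xv 1 • n 1 + xv 2 • n 2 := by
  obtain ⟨hF1, hF2⟩ := hF
  rw [← muT_apply] at hF2
  choose c hc1 hc2 using fun i => NS_lift (e + 1) (F i) (hF1 i)
  let φ : Fin 3 → (QI → QI → PolyC 3) := fun k i => c i k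
  have hφ : F = xv 0 • φ 0 + xv 1 • φ 1 + xv 2 • φ 2 := by
    ext1 i; rw [hc2 i]; rfl
  have hφm : ∀ k, muT (φ k) ∈ NS (e + 5 + 2) := fun k => muT_NS (e := e + 2) _ fun i => hc1 i k
  have hrel : xv 0 • muT (φ 0) + xv 1 • muT (φ 1) + xv 2 • muT (φ 2) = 0 := by
    rw [hφ] at hF2
    simpa only [map_add, map_smul] using hF2
  obtain ⟨u0, u1, u2, h0, h1, h2, e0, e1, e2⟩ := NS_koszul _ _ _ _ (hφm 0) (hφm 1) (hφm 2) hrel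
  have e16 : e + 5 + 1 = e + 1 + 5 := by omega
  rw [e16] at h0 h1 h2
  obtain ⟨d0, hd0, hs0⟩ := NS_lift5 e u0 h0
  obtain ⟨d1, hd1, hs1⟩ := NS_lift5 e u1 h1
  obtain ⟨d2, hd2, hs2⟩ := NS_lift5 e u2 h2
  rw [← muT_apply] at hs0 hs1 hs2
  refine ⟨![φ 0 - (xv 1 • d2 - xv 2 • d1), φ 1 - (xv 2 • d0 - xv 0 • d2),
    φ 2 - (xv 0 • d1 - xv 1 • d0)], fun k => ?_, ?_⟩
  · have hx : ∀ k (d : QI → QI → PolyC 3) i, d i ∈ NS (e + 1) → (xv k • d) i ∈ NS (e + 2) :=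
      fun k d i h => xsmul_NS k h
    fin_cases k
    · refine ⟨fun i => AddSubgroup.sub_mem _ (hc1 i 0) (AddSubgroup.sub_mem _ (hx _ _ _ (hd2 i))
        (hx _ _ _ (hd1 i))), ?_⟩
      rw [← muT_apply]
      change muT (φ 0 - (xv 1 • d2 - xv 2 • d1)) = 0
      rw [map_sub, map_sub, map_smul, map_smul, ← hs1, ← hs2, e0]; simp
    · refine ⟨fun i => AddSubgroup.sub_mem _ (hc1 i 1) (AddSubgroup.sub_mem _ (hx _ _ _ (hd0 i))
        (hx _ _ _ (hd2 i))), ?_⟩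
      rw [← muT_apply]
      change muT (φ 1 - (xv 2 • d0 - xv 0 • d2)) = 0
      rw [map_sub, map_sub, map_smul, map_smul, ← hs0, ← hs2, e1]; simp
    · refine ⟨fun i => AddSubgroup.sub_mem _ (hc1 i 2) (AddSubgroup.sub_mem _ (hx _ _ _ (hd1 i))
        (hx _ _ _ (hd0 i))), ?_⟩
      rw [← muT_apply]
      change muT (φ 2 - (xv 0 • d1 - xv 1 • d0)) = 0
      rw [map_sub, map_sub, map_smul, map_smul, ← hs0, ← hs1, e2]; simp
  · conv_lhs => rw [hφ]
    ext1 i; ext1 j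
    simp
    ring

theorem TS_lift5 (e : ℕ) (f : QI → QI → PolyC 3) (hf : f ∈ TS (e + 2 + 5)) :
    ∃ s : QI → QI → QI → PolyC 3, (∀ j, s j ∈ TS (e + 2)) ∧ f = ∑ j, XM j • s j := by
  refine iter_lift TS (e + 2) (fun d F hF => ?_) 5 f hf
  have e1 : e + 2 + d + 1 = (e + d) + 3 := by omega
  have e2 : e + 2 + d = (e + d) + 2 := by omega
  rw [e1] at hF
  rw [e2]
  exact TS_lift _ F hF

/-- constant 0-form -/
abbrev cst (P : PolyC 3) : AA 0 := AlternatingMap.constOfIsEmpty ℂ (QI → ℂ) (Fin 0) P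

theorem cst_eq (f : AA 0) : f = cst (f 0) := by
  ext1 v; rw [Subsingleton.elim v 0]; rfl

/-- one form with given coefficients -/
def alt1 (n : QI → PolyC 3) : AA 1 := ∑ i, wd (psi i) (cst (n i))

theorem alt1_curry (f : AA 1) : alt1 (fun i => f (fun _ => ebas i)) = f := by
  have h := euler f
  simp only [Nat.cast_zero, zero_add, one_smul] at h
  conv_rhs => rw [← h]
  unfold alt1
  refine Finset.sum_congr rfl fun i _ => ?_
  congr 1
  conv_rhs => rw [cst_eq (AlternatingMap.curryLeft f (ebas i))]
  congr 1
  rw [AlternatingMap.curryLeft_apply_apply]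
  change f _ = f _
  congr 1
  ext1 j
  rw [Subsingleton.elim j 0]; rfl

theorem alt1_smul_sum (X : QI → PolyC 3) (s : QI → QI → PolyC 3) :
    alt1 (∑ j, X j • s j) = ∑ j, X j • alt1 (s j) := by
  unfold alt1
  simp only [Finset.smul_sum]
  rw [Finset.sum_comm]
  refine Finset.sum_congr rfl fun i _ => ?_
  simp only [← wd_smul]
  rw [← wd_sum]
  congr 1
  ext1 v
  rw [altsum_apply]
  simp

theorem dK_alt1 (n : QI → PolyC 3) : dK XM (alt1 n) = cst (muS n) := by
  unfold alt1
  rw [dK_sum]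
  simp only [dK_wd_zero, Xof_psi]
  ext1 v
  rw [altsum_apply, muS_apply]
  rfl

theorem exact_71 (f : AA 1) (hf : ∀ v, f v ∈ Hm 7) (hd : dK XM f = 0) : ∃ g, dK XM g = f := by
  set n : QI → PolyC 3 := fun i => f (fun _ => ebas i) with hn
  have hfn : alt1 n = f := alt1_curry f
  have hN : n ∈ NS (1 + 1 + 5) := by
    refine ⟨fun i => hf _, ?_⟩
    rw [← hfn, dK_alt1] at hd
    simpa using congrArg (fun h : AA 0 => h 0) hd
  obtain ⟨s, hs, hns⟩ := NS_lift5 1 n hN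
  refine ⟨∑ j, wd (psi j) (alt1 (s j)), ?_⟩
  rw [dK_sum]
  have : ∀ j, dK XM (wd (psi j) (alt1 (s j))) = XM j • alt1 (s j) := by
    intro j
    rw [dK_wd, Xof_psi, dK_alt1, (hs j).2]
    ext v; simp [wd_apply]
  simp only [this]
  rw [← alt1_smul_sum, ← hns, hfn]

/-- two form with given coefficients -/
def alt2 (F : QI → QI → PolyC 3) : AA 2 := ∑ i, wd (psi i) (alt1 (F i))

theorem alt2_curry (f : AA 2) :
    alt2 (fun i j => f ![ebas i, ebas j]) = (2 : PolyC 3) • f := by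
  have h := euler f
  have h2 : (((1 : ℕ) : ℂ) + 1) • f = (2 : PolyC 3) • f := by
    ext1 v
    simp only [AlternatingMap.smul_apply]
    rw [MvPolynomial.smul_eq_C_mul, smul_eq_mul]
    have : (2 : PolyC 3) = MvPolynomial.C 2 := (map_ofNat _ 2).symm
    rw [this]; norm_num
  rw [← h2, ← h]
  unfold alt2
  refine Finset.sum_congr rfl fun i _ => ?_
  congr 1
  conv_rhs => rw [← alt1_curry (AlternatingMap.curryLeft f (ebas i))]
  congr 1
  ext1 j
  rw [AlternatingMap.curryLeft_apply_apply]
  change f _ = f _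
  congr 1
  ext1 k
  fin_cases k <;> rfl

theorem alt2_smul_sum (X : QI → PolyC 3) (s : QI → QI → QI → PolyC 3) :
    alt2 (∑ j, X j • s j) = ∑ j, X j • alt2 (s j) := by
  unfold alt2
  simp only [Finset.smul_sum]
  rw [Finset.sum_comm]
  refine Finset.sum_congr rfl fun i _ => ?_
  simp only [← wd_smul]
  rw [← wd_sum, ← alt1_smul_sum]
  congr 2
  simp

theorem dK_alt2 (e : ℕ) (F : QI → QI → PolyC 3) (hF : F ∈ TS e) : dK XM (alt2 F) = 0 := by
  unfold alt2
  rw [dK_sum]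
  have : ∀ i, dK XM (wd (psi i) (alt1 (F i))) = XM i • alt1 (F i) := by
    intro j
    rw [dK_wd, Xof_psi, dK_alt1, (hF.1 j).2]
    ext v; simp [wd_apply]
  simp only [this]
  rw [← alt1_smul_sum, hF.2]
  ext v; simp [alt1, altsum_apply, wd_apply]

theorem exact_72 (f : AA 2) (hf : ∀ v, f v ∈ Hm 7) (hd : dK XM f = 0) : ∃ g, dK XM g = f := by
  set F : QI → QI → PolyC 3 := fun i j => f ![ebas i, ebas j] with hn
  have hfn : alt2 F = (2 : PolyC 3) • f := alt2_curry f
  have h1 : ∀ j, ∑ i, XM i * F i j = 0 := by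
    intro j
    have := DFunLike.congr_fun hd (fun _ => ebas j)
    rw [dK_apply] at this
    rw [AlternatingMap.zero_apply] at this
    rw [← this]
    refine Finset.sum_congr rfl fun i _ => ?_
    congr 1
    change f _ = f _
    congr 1
    ext1 k
    fin_cases k <;> rfl
  have hanti : ∀ i j, F i j = - F j i := by
    intro i j
    exact alt_swap f (ebas i) (ebas j) ![]
  have hT : F ∈ TS (0 + 2 + 5) := by
    refine ⟨fun i => ⟨fun j => hf _, ?_⟩, ?_⟩
    · rw [muS_apply]
      have := h1 i
      rw [← neg_eq_zero, ← this, ← Finset.sum_neg_distrib]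
      refine Finset.sum_congr rfl fun j _ => ?_
      rw [hanti i j]; ring
    · ext1 j
      rw [Finset.sum_apply]
      exact h1 j
  obtain ⟨s, hs, hns⟩ := TS_lift5 0 F hT
  refine ⟨(MvPolynomial.C (1/2) : PolyC 3) • ∑ j, wd (psi j) (alt2 (s j)), ?_⟩
  rw [dK_smul, dK_sum]
  have : ∀ j, dK XM (wd (psi j) (alt2 (s j))) = XM j • alt2 (s j) := by
    intro j
    rw [dK_wd, Xof_psi, dK_alt2 _ _ (hs j), wd_zero, sub_zero]
  simp only [this]
  rw [← alt2_smul_sum, ← hns, hfn, smul_smul]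
  have e2 : (MvPolynomial.C (1/2) : PolyC 3) * 2 = 1 := by
    have : (2 : PolyC 3) = MvPolynomial.C 2 := (map_ofNat _ 2).symm
    rw [this, ← MvPolynomial.C_mul]; norm_num
  rw [e2, one_smul]

end

set_option linter.unusedSectionVars false

noncomputable section

theorem Sdeg_nat (e : ℕ) : Sdeg 3 (e : ℤ) = Hm e := by
  simp [Sdeg, Hm]

theorem Sdeg_neg (e : ℤ) (h : e < 0) : Sdeg 3 e = ⊥ := by
  simp [Sdeg, h]

/-- monomial basis of the forms of degree `e` -/
def bS (e : ℕ) : Module.Basis (MIdx e) ℂ ↥(Sdeg 3 (e : ℤ)) :=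
  Module.Basis.mk (v := fun i : MIdx e => (⟨MvPolynomial.monomial i.1 1, by
      rw [Sdeg_nat]; exact MvPolynomial.isHomogeneous_monomial _ i.2⟩ : ↥(Sdeg 3 (e : ℤ))))
    (by
      apply LinearIndependent.of_comp (Sdeg 3 (e : ℤ)).subtype
      have h := (MvPolynomial.basisMonomials (Fin 3) ℂ).linearIndependent.comp
        (fun i : MIdx e => i.1) Subtype.val_injective
      exact h)
    (by
      rintro ⟨P, hP⟩ -
      have hP' : P ∈ Hm e := by rw [← Sdeg_nat]; exact hP
      have h1 : (⟨P, hP⟩ : ↥(Sdeg 3 (e : ℤ))) = ∑ i : MIdx e, P.coeff i.1 •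
          (⟨MvPolynomial.monomial i.1 1, by
            rw [Sdeg_nat]; exact MvPolynomial.isHomogeneous_monomial _ i.2⟩ :
            ↥(Sdeg 3 (e : ℤ))) := by
        apply Subtype.ext
        rw [AddSubmonoidClass.coe_finsetSum]
        ext m
        rw [MvPolynomial.coeff_sum]
        by_cases hm : m.degree = e
        · rw [Finset.sum_eq_single (⟨m, hm⟩ : MIdx e)]
          · simp
          · rintro ⟨b, hb⟩ - hne
            have : b ≠ m := fun h => hne (Subtype.ext h)
            simp [MvPolynomial.coeff_monomial, this]
          · simp
        · rw [Finset.sum_eq_zero]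
          · by_contra hne
            exact hm (by have := hP' hne; rwa [Finsupp.degree_eq_weight_one])
          · rintro ⟨b, hb⟩ -
            have : b ≠ m := fun h => hm (h ▸ hb)
            simp [MvPolynomial.coeff_monomial, this]
      rw [h1]
      exact Submodule.sum_mem _ fun i _ => Submodule.smul_mem _ _ (Submodule.subset_span ⟨i, rfl⟩))

theorem bS_apply (e : ℕ) (i : MIdx e) : ((bS e i : ↥(Sdeg 3 (e : ℤ))) : PolyC 3) =
    MvPolynomial.monomial i.1 1 := by
  simp [bS]

/-- quintics -/
abbrev U5 : Type := ↥(Sdeg 3 (5 : ℤ))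

/-- basis of quintics -/
def b5 : Module.Basis QI ℂ U5 := bS 5

theorem b5_apply (i : QI) : ((b5 i : U5) : PolyC 3) = XM i := bS_apply 5 i

/-- functional on quintics attached to a vector of values on monomials -/
def toD : (QI → ℂ) →ₗ[ℂ] Module.Dual ℂ U5 := (b5.constr ℂ).toLinearMap

theorem toD_b5 (φ : QI → ℂ) (i : QI) : toD φ (b5 i) = φ i := by
  simp [toD]

theorem toD_ebas (i : QI) : toD (ebas i) = b5.coord i := by
  apply b5.ext
  intro j
  rw [toD_b5]
  simp [ebas, Pi.single_apply, Finsupp.single_apply]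

theorem sum_toD (m : U5) : ∑ i, toD (ebas i) m • XM i = (m : PolyC 3) := by
  conv_rhs => rw [← b5.sum_repr m]
  rw [AddSubmonoidClass.coe_finsetSum]
  refine Finset.sum_congr rfl fun i _ => ?_
  rw [toD_ebas, Submodule.coe_smul, b5_apply]
  rfl

/-- scalar form of an exterior element -/
def altOf (p : ℕ) (ω : ↥(⋀[ℂ]^p U5)) : (QI → ℂ) [⋀^Fin p]→ₗ[ℂ] ℂ :=
  (((LinearMap.applyₗ ω) ∘ₗ exteriorPower.pairingDual ℂ U5 p).compAlternatingMap
    (exteriorPower.ιMulti ℂ p)).compLinearMap toD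

theorem altOf_apply (p : ℕ) (ω : ↥(⋀[ℂ]^p U5)) (v : Fin p → (QI → ℂ)) :
    altOf p ω v = exteriorPower.pairingDual ℂ U5 p
      (exteriorPower.ιMulti ℂ p (fun i => toD (v i))) ω := rfl

/-- comparison map -/
def Psi0 (p : ℕ) : (↥(⋀[ℂ]^p U5)) ⊗[ℂ] PolyC 3 →ₗ[ℂ] AA p :=
  TensorProduct.lift (LinearMap.mk₂ ℂ
    (fun ω f => (LinearMap.toSpanSingleton ℂ (PolyC 3) f).compAlternatingMap (altOf p ω))
    (by intro a b f; ext1 v; simp [altOf_apply, add_smul])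
    (by intro c a f; ext1 v; simp [altOf_apply, mul_smul])
    (by intro a f g; ext1 v; simp [altOf_apply])
    (by intro c a f; ext1 v; simp only [LinearMap.compAlternatingMap_apply, LinearMap.toSpanSingleton_apply, AlternatingMap.smul_apply]; rw [smul_comm]))

theorem Psi0_tmul (p : ℕ) (ω : ↥(⋀[ℂ]^p U5)) (f : PolyC 3) (v : Fin p → (QI → ℂ)) :
    Psi0 p (ω ⊗ₜ f) v = altOf p ω v • f := by
  simp [Psi0]

theorem altOf_wedge (p : ℕ) (m : Fin p → U5) (v : Fin p → (QI → ℂ)) :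
    altOf p (wedgeE ℂ U5 p m) v = (Matrix.of fun i j => toD (v j) (m i)).det := by
  rw [altOf_apply]
  exact exteriorPower.pairingDual_ιMulti_ιMulti _ _

/-- enumeration -/
def eQ : QI ≃ Fin 21 := Fintype.equivFinOfCardEq (by rw [card_MIdx]; rfl)

/-- ordered basis -/
def b21 : Module.Basis (Fin 21) ℂ U5 := b5.reindex eQ

/-- ordered standard basis -/
def e21 : Module.Basis (Fin 21) ℂ (QI → ℂ) := (Pi.basisFun ℂ QI).reindex eQ

theorem toD_e21 (i : Fin 21) : toD (e21 i) = b21.coord i := by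
  have : e21 i = ebas (eQ.symm i) := by simp [e21, ebas]
  rw [this, toD_ebas]
  ext m
  simp [b21]

/-- evaluation vectors -/
def es (p : ℕ) (s : Set.powersetCard (Fin 21) p) : Fin p → (QI → ℂ) :=
  fun i => e21 (Set.powersetCard.ofFinEmbEquiv.symm s i)

theorem altOf_es (p : ℕ) (ω : ↥(⋀[ℂ]^p U5)) (s : Set.powersetCard (Fin 21) p) :
    altOf p ω (es p s) = (b21.exteriorPower p).coord s ω := by
  rw [exteriorPower.basis_coord, altOf_apply]
  simp only [es, toD_e21]
  rfl

theorem AA_ext_es {p : ℕ} (f g : AA p) (h : ∀ s, f (es p s) = g (es p s)) : f = g := by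
  apply (exteriorPower.alternatingMapLinearEquiv (R := ℂ)).injective
  apply (e21.exteriorPower p).ext
  intro s
  rw [exteriorPower.basis_apply, exteriorPower.ιMulti_family,
    exteriorPower.alternatingMapLinearEquiv_apply_ιMulti,
    exteriorPower.alternatingMapLinearEquiv_apply_ιMulti]
  exact h s

theorem Psi0_injective (p : ℕ) : Function.Injective (Psi0 p) := by
  let Φ : AA p → (↥(⋀[ℂ]^p U5)) ⊗[ℂ] PolyC 3 :=
    fun f => ∑ s, (b21.exteriorPower p s) ⊗ₜ f (es p s)
  have : Function.LeftInverse Φ (Psi0 p) := by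
    intro x
    induction x with
    | zero => simp [Φ]
    | add x y hx hy =>
      conv_rhs => rw [← hx, ← hy]
      simp only [Φ, map_add, AlternatingMap.add_apply, TensorProduct.tmul_add,
        Finset.sum_add_distrib]
    | tmul ω f =>
      simp only [Φ, Psi0_tmul, altOf_es]
      simp only [← TensorProduct.smul_tmul]
      rw [← TensorProduct.sum_tmul]
      congr 1
      exact (b21.exteriorPower p).sum_repr ω
  exact this.injective

/-- comparison map in fixed degree -/
def Psi (p : ℕ) (e : ℤ) : KosModule 3 5 p e →ₗ[ℂ] AA p :=
  Psi0 p ∘ₗ TensorProduct.map (LinearMap.id (R := ℂ) (M := ↥(⋀[ℂ]^p U5))) (Sdeg 3 e).subtype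

theorem Psi_injective (p : ℕ) (e : ℤ) : Function.Injective (Psi p e) := by
  unfold Psi
  rw [LinearMap.coe_comp]
  refine (Psi0_injective p).comp ?_
  exact Module.Flat.lTensor_preserves_injective_linearMap _ (Submodule.subtype_injective _)

theorem Psi_mem (p : ℕ) (e : ℤ) (x : KosModule 3 5 p e) (v : Fin p → (QI → ℂ)) :
    Psi p e x v ∈ Sdeg 3 e := by
  induction x using TensorProduct.induction_on with
  | zero => simp
  | add x y hx hy => rw [map_add, AlternatingMap.add_apply]; exact Submodule.add_mem _ hx hy
  | tmul ω f =>
    simp only [Psi, LinearMap.comp_apply, TensorProduct.map_tmul, Psi0_tmul]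
    exact Submodule.smul_mem _ _ f.2

theorem Psi_surj (p : ℕ) (e : ℤ) (f : AA p) (hf : ∀ v, f v ∈ Sdeg 3 e) :
    ∃ x, Psi p e x = f := by
  refine ⟨∑ s, (b21.exteriorPower p s) ⊗ₜ ⟨f (es p s), hf _⟩, ?_⟩
  apply AA_ext_es
  intro t
  rw [map_sum, altsum_apply]
  simp only [Psi, LinearMap.comp_apply, TensorProduct.map_tmul, Psi0_tmul, altOf_es]
  rw [Finset.sum_eq_single t]
  · simp
  · intro s _ hs
    simp [Finsupp.single_apply, hs]
  · simp

theorem Psi_D (p : ℕ) (e e' : ℤ) (D : KosModule 3 5 (p + 1) e →ₗ[ℂ] KosModule 3 5 p e')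
    (hD : IsKoszulDiff 3 5 e e' p D) (x : KosModule 3 5 (p + 1) e) :
    Psi p e' (D x) = - dK XM (Psi (p + 1) e x) := by
  induction x using TensorProduct.induction_on with
  | zero => simp [dK_zero]
  | add x y hx hy => rw [map_add, map_add, hx, hy, map_add, dK_add, neg_add]
  | tmul ω f =>
    have hω : ω ∈ Submodule.span ℂ (Set.range (exteriorPower.ιMulti ℂ (p + 1) (M := U5))) := by
      rw [exteriorPower.ιMulti_span]; trivial
    induction hω using Submodule.span_induction with
    | zero => simp [dK_zero]
    | add x y _ _ hx hy =>
      rw [TensorProduct.add_tmul, map_add, map_add, hx, hy, map_add, dK_add, neg_add]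
    | smul c x _ hx =>
      rw [← TensorProduct.smul_tmul', map_smul, map_smul, hx, map_smul]
      have : ∀ h : AA (p + 1), dK XM (c • h) = c • dK XM h := by
        intro h
        have h2 : ∀ (q : ℕ) (h : AA q), c • h = (MvPolynomial.C c : PolyC 3) • h := by
          intro q h
          ext1 v
          simp only [AlternatingMap.smul_apply, smul_eq_mul, MvPolynomial.smul_eq_C_mul]
        rw [h2, dK_smul, ← h2]
      rw [this, smul_neg]
    | mem x hx =>
      obtain ⟨m, rfl⟩ := hx
      have h1 := hD m f
      change TensorProduct.map _ _ (D (exteriorPower.ιMulti ℂ (p + 1) m ⊗ₜ[ℂ] f)) = _ at h1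
      have h2 := congrArg (Psi0 p) h1
      refine Eq.trans (a := Psi p e' (D (exteriorPower.ιMulti ℂ (p + 1) m ⊗ₜ[ℂ] f))) h2 ?_
      ext1 v
      rw [map_sum, altsum_apply, AlternatingMap.neg_apply, dK_apply]
      have h3 : ∀ i, Psi (p + 1) e (exteriorPower.ιMulti ℂ (p + 1) m ⊗ₜ[ℂ] f)
          (Matrix.vecCons (ebas i) v) = ∑ k : Fin (p + 1), ((-1 : ℂ) ^ (k : ℕ) * toD (ebas i) (m k) *
            altOf p (wedgeE ℂ U5 p (fun i => m (Fin.succAbove k i))) v) • (f : PolyC 3) := by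
        intro i
        simp only [Psi, LinearMap.comp_apply, TensorProduct.map_tmul, Psi0_tmul]
        rw [← Finset.sum_smul]
        congr 1
        refine (altOf_wedge (p + 1) m _).trans ?_
        rw [Matrix.det_succ_column_zero]
        refine Finset.sum_congr rfl fun k _ => ?_
        rw [altOf_wedge]
        rfl
      simp only [h3, Finset.mul_sum]
      rw [Finset.sum_comm, ← Finset.sum_neg_distrib]
      refine Finset.sum_congr rfl fun k _ => ?_
      rw [map_smul, AlternatingMap.smul_apply, Psi0_tmul, ← sum_toD (m k)]
      simp only [Finset.sum_mul, Finset.smul_sum, ← Finset.sum_neg_distrib]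
      refine Finset.sum_congr rfl fun i _ => ?_
      simp only [MvPolynomial.smul_eq_C_mul, MvPolynomial.C_mul, pow_succ, map_neg, map_pow,
        map_one]
      ring

instance finiteSdeg (e : ℤ) : Module.Finite ℂ ↥(Sdeg 3 e) := by
  rcases lt_or_ge e 0 with h | h
  · rw [Sdeg_neg e h]; infer_instance
  · lift e to ℕ using h
    exact Module.Finite.of_basis (bS e)

theorem finrank_Sdeg (e : ℕ) : Module.finrank ℂ ↥(Sdeg 3 (e : ℤ)) = (e + 2).choose 2 := by
  rw [Module.finrank_eq_card_basis (bS e), card_MIdx]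

theorem finrank_Kos (p e : ℕ) : Module.finrank ℂ (KosModule 3 5 p (e : ℤ)) =
    (Nat.choose 21 p) * (e + 2).choose 2 := by
  rw [Module.finrank_tensorProduct, exteriorPower.finrank_eq, finrank_Sdeg]
  rw [show Module.finrank ℂ ↥(Sdeg 3 5) = 21 from finrank_Sdeg 5]

end

set_option linter.unusedSectionVars false

noncomputable section

theorem signVar_lt_support (P : Polynomial ℝ) (hP : P ≠ 0) :
    P.signVariations + 1 ≤ P.support.card := by
  induction h : P.support.card using Nat.strong_induction_on generalizing P with
  | _ n ih =>
    subst h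
    by_cases h0 : P.eraseLead = 0
    · have h1 : P = Polynomial.monomial P.natDegree P.leadingCoeff := by
        conv_lhs => rw [← P.eraseLead_add_monomial_natDegree_leadingCoeff, h0, zero_add]
      have h2 : P.signVariations = 0 := by
        rw [h1, Polynomial.signVariations_monomial]
      have h3 : P.support.card ≠ 0 := by
        simpa using hP
      omega
    · have h1 := Polynomial.eraseLead_support_card_lt hP
      have h2 := ih _ h1 P.eraseLead h0 rfl
      have h3 := Polynomial.signVariations_le_eraseLead_succ (P := P)
      omega

/-- exponent of the moment curve -/
def mexp (m : Fin 3 →₀ ℕ) : ℕ := m 1 + 6 * m 2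

/-- parameters of the points -/
def tau (t : Fin 21) : ℝ := (t.val : ℝ) + 1

theorem tau_inj : Function.Injective tau := by
  intro a b h
  simp only [tau, add_left_inj, Nat.cast_inj] at h
  exact Fin.ext h

/-- the points -/
def Pt (t : Fin 21) : Fin 3 → ℂ := ![1, (tau t : ℂ), (tau t : ℂ) ^ 6]

theorem mexp_inj {e : ℕ} (he : e ≤ 5) : Function.Injective (fun i : MIdx e => mexp i.1) := by
  rintro ⟨a, ha⟩ ⟨b, hb⟩ h
  rw [Finsupp.degree_eq_sum, Fin.sum_univ_three] at ha hb
  simp only [mexp] at h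
  apply Subtype.ext
  ext k
  fin_cases k <;> simp <;> omega

theorem real_poised {e : ℕ} (he : e ≤ 5) (r : MIdx e → ℝ) (s : Finset (Fin 21))
    (hs : (e + 2).choose 2 ≤ s.card)
    (h : ∀ t ∈ s, ∑ i, r i * tau t ^ mexp i.1 = 0) : r = 0 := by
  let P : Polynomial ℝ := ∑ i, Polynomial.monomial (mexp i.1) (r i)
  have hc : ∀ i : MIdx e, P.coeff (mexp i.1) = r i := by
    intro i
    simp only [P, Polynomial.finsetSum_coeff, Polynomial.coeff_monomial]
    rw [Finset.sum_eq_single i]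
    · simp
    · intro j _ hj
      rw [if_neg]
      intro hij
      exact hj (mexp_inj he hij)
    · simp
  have hP : P = 0 := by
    by_contra hP
    have h1 := signVar_lt_support P hP
    have h2 : P.support.card ≤ (e + 2).choose 2 := by
      rw [← card_MIdx e, ← Finset.card_univ]
      refine (Finset.card_le_card ?_).trans
        (Finset.card_image_le (s := Finset.univ) (f := fun i : MIdx e => mexp i.1))
      intro n hn
      rw [Polynomial.mem_support_iff] at hn
      simp only [P, Polynomial.finsetSum_coeff] at hn
      obtain ⟨i, -, hi⟩ := Finset.exists_ne_zero_of_sum_ne_zero hn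
      rw [Polynomial.coeff_monomial] at hi
      rw [Finset.mem_image]
      refine ⟨i, Finset.mem_univ _, ?_⟩
      by_contra hne
      exact hi (if_neg hne)
    have h3 := Polynomial.roots_countP_pos_le_signVariations (P := P)
    have h4 : (s.image tau).val ≤ P.roots.filter (0 < ·) := by
      rw [Multiset.le_iff_subset (s.image tau).nodup]
      intro x hx
      rw [Finset.mem_val, Finset.mem_image] at hx
      obtain ⟨t, ht, rfl⟩ := hx
      rw [Multiset.mem_filter, Polynomial.mem_roots hP]
      constructor
      · rw [Polynomial.IsRoot, Polynomial.eval_finsetSum]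
        simpa [Polynomial.eval_monomial] using h t ht
      · unfold tau; positivity
    have h5 := Multiset.card_le_card h4
    rw [← Multiset.countP_eq_card_filter, Finset.card_val, Finset.card_image_of_injective _ tau_inj]
      at h5
    omega
  funext i
  rw [← hc, hP]; simp

theorem eval_Pt {e : ℕ} {c : PolyC 3} (hc : c ∈ Hm e) (t : Fin 21) :
    MvPolynomial.eval (Pt t) c = ∑ i : MIdx e, c.coeff i.1 * (tau t : ℂ) ^ mexp i.1 := by
  have hc' : c ∈ Sdeg 3 (e : ℤ) := by rw [Sdeg_nat]; exact hc
  have h1 : c = ∑ i : MIdx e, MvPolynomial.monomial i.1 (c.coeff i.1) := by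
    ext m
    rw [MvPolynomial.coeff_sum]
    by_cases hm : m.degree = e
    · rw [Finset.sum_eq_single (⟨m, hm⟩ : MIdx e)]
      · simp
      · rintro ⟨b, hb⟩ - hne
        have : b ≠ m := fun h => hne (Subtype.ext h)
        simp [MvPolynomial.coeff_monomial, this]
      · simp
    · rw [Finset.sum_eq_zero, Hm_coeff hc m hm]
      rintro ⟨b, hb⟩ -
      have : b ≠ m := fun h => hm (h ▸ hb)
      simp [MvPolynomial.coeff_monomial, this]
  conv_lhs => rw [h1]
  rw [map_sum]
  refine Finset.sum_congr rfl fun i _ => ?_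
  rw [MvPolynomial.eval_monomial, Finsupp.prod_fintype _ _ (by simp), Fin.prod_univ_three]
  simp only [Pt, mexp, pow_add, pow_mul]
  simp

/-- poisedness of the points -/
theorem poised {e : ℕ} (he : e ≤ 5) {c : PolyC 3} (hc : c ∈ Hm e) (s : Finset (Fin 21))
    (hs : (e + 2).choose 2 ≤ s.card) (h : ∀ t ∈ s, MvPolynomial.eval (Pt t) c = 0) : c = 0 := by
  have h1 : (fun i : MIdx e => (c.coeff i.1).re) = 0 := by
    apply real_poised he _ s hs
    intro t ht
    have := congrArg Complex.re (h t ht)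
    rw [eval_Pt hc, Complex.re_sum] at this
    simp only [← Complex.ofReal_pow, Complex.re_mul_ofReal, Complex.zero_re] at this
    exact this
  have h2 : (fun i : MIdx e => (c.coeff i.1).im) = 0 := by
    apply real_poised he _ s hs
    intro t ht
    have := congrArg Complex.im (h t ht)
    rw [eval_Pt hc, Complex.im_sum] at this
    simp only [← Complex.ofReal_pow, Complex.im_mul_ofReal, Complex.zero_im] at this
    exact this
  ext m
  by_cases hm : m.degree = e
  · rw [MvPolynomial.coeff_zero]
    exact Complex.ext (congrFun h1 ⟨m, hm⟩) (congrFun h2 ⟨m, hm⟩)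
  · rw [Hm_coeff hc m hm, MvPolynomial.coeff_zero]

/-- forms through few points -/
theorem exists_form (e : ℕ) (s : Finset (Fin 21)) (hs : s.card < (e + 2).choose 2) :
    ∃ c ∈ Hm e, c ≠ 0 ∧ ∀ t ∈ s, MvPolynomial.eval (Pt t) c = 0 := by
  let E : ↥(Sdeg 3 (e : ℤ)) →ₗ[ℂ] (s → ℂ) :=
    LinearMap.pi fun t => (MvPolynomial.aeval (Pt t.1) : PolyC 3 →ₐ[ℂ] ℂ).toLinearMap ∘ₗ
      (Sdeg 3 (e : ℤ)).subtype
  have hlt : Module.finrank ℂ (s → ℂ) < Module.finrank ℂ ↥(Sdeg 3 (e : ℤ)) := by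
    rw [finrank_Sdeg]; simpa using hs
  obtain ⟨c, hc, hne⟩ := Submodule.exists_mem_ne_zero_of_ne_bot
    (LinearMap.ker_ne_bot_of_finrank_lt (f := E) hlt)
  refine ⟨c.1, by rw [← Sdeg_nat]; exact c.2, fun h => hne (Subtype.ext h), fun t ht => ?_⟩
  have := congrFun (LinearMap.mem_ker.1 hc) ⟨t, ht⟩
  simpa [E, MvPolynomial.aeval_eq_eval] using this

theorem exists_form' (e : ℕ) (he : e ≤ 5) (s : Finset (Fin 21))
    (hs : s.card + 1 = (e + 2).choose 2) :
    ∃ c ∈ Hm e, (∀ t ∈ s, MvPolynomial.eval (Pt t) c = 0) ∧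
      ∀ t, t ∉ s → MvPolynomial.eval (Pt t) c ≠ 0 := by
  obtain ⟨c, hc, h0, h⟩ := exists_form e s (by omega)
  refine ⟨c, hc, h, fun t ht h1 => h0 ?_⟩
  refine poised he hc (insert t s) ?_ ?_
  · rw [Finset.card_insert_of_notMem ht]; omega
  · intro u hu
    rcases Finset.mem_insert.1 hu with rfl | hu
    · exact h1
    · exact h u hu

/-- evaluation vector -/
def ev (P : Fin 3 → ℂ) : QI → ℂ := fun i => MvPolynomial.eval P (XM i)

theorem ev_eq (P : Fin 3 → ℂ) : ev P = ∑ i, MvPolynomial.eval P (XM i) • ebas i := by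
  funext j
  simp [ev, ebas, Pi.single_apply]

theorem alt_ev {p : ℕ} (f : AA (p + 1)) (P : Fin 3 → ℂ) (v : Fin p → (QI → ℂ)) :
    f (Matrix.vecCons (ev P) v) =
      ∑ i, MvPolynomial.eval P (XM i) • f (Matrix.vecCons (ebas i) v) := by
  rw [← AlternatingMap.curryLeft_apply_apply, ev_eq, map_sum, altsum_apply]
  simp

theorem cyc_eval {p : ℕ} (f : AA (p + 1)) (hd : dK XM f = 0) (P : Fin 3 → ℂ)
    (v : Fin p → (QI → ℂ)) : MvPolynomial.eval P (f (Matrix.vecCons (ev P) v)) = 0 := by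
  have h := congrArg (MvPolynomial.eval P) (DFunLike.congr_fun hd v)
  rw [dK_apply, map_sum] at h
  rw [alt_ev, map_sum]
  simpa [MvPolynomial.smul_eval] using h

end

set_option linter.unusedSectionVars false

noncomputable section

/-- three by three determinant -/
def det3 (x P Q : Fin 3 → ℂ) : ℂ :=
  x 0 * (P 1 * Q 2 - P 2 * Q 1) + x 1 * (P 2 * Q 0 - P 0 * Q 2) + x 2 * (P 0 * Q 1 - P 1 * Q 0)

/-- line through two points -/
def lin (P Q : Fin 3 → ℂ) : PolyC 3 :=
  MvPolynomial.C (P 1 * Q 2 - P 2 * Q 1) * xv 0 + MvPolynomial.C (P 2 * Q 0 - P 0 * Q 2) * xv 1 +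
    MvPolynomial.C (P 0 * Q 1 - P 1 * Q 0) * xv 2

theorem eval_lin (x P Q : Fin 3 → ℂ) : MvPolynomial.eval x (lin P Q) = det3 x P Q := by
  simp [lin, det3]; ring

theorem C_mul_mem {e : ℕ} (c : ℂ) {P : PolyC 3} (h : P ∈ Hm e) : MvPolynomial.C c * P ∈ Hm e := by
  rw [← MvPolynomial.smul_eq_C_mul]; exact Submodule.smul_mem _ _ h

theorem mul_mem_Hm {a b : ℕ} {P Q : PolyC 3} (hP : P ∈ Hm a) (hQ : Q ∈ Hm b) :
    P * Q ∈ Hm (a + b) := MvPolynomial.IsHomogeneous.mul hP hQ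

theorem lin_mem (P Q : Fin 3 → ℂ) : lin P Q ∈ Hm 1 :=
  Submodule.add_mem _ (Submodule.add_mem _ (C_mul_mem _ (xv_mem 0)) (C_mul_mem _ (xv_mem 1)))
    (C_mul_mem _ (xv_mem 2))

theorem lin_coeff2 (P Q : Fin 3 → ℂ) (h : lin P Q = 0) : P 0 * Q 1 - P 1 * Q 0 = 0 := by
  have := congrArg (MvPolynomial.eval ![0, 0, 1]) h
  rw [eval_lin] at this
  simpa [det3] using this

theorem det3_Pt (a b c : Fin 21) (hab : a ≠ b) (hac : a ≠ c) (hbc : b ≠ c) :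
    det3 (Pt a) (Pt b) (Pt c) ≠ 0 := by
  intro h
  have h0 : lin (Pt b) (Pt c) = 0 := by
    refine poised (e := 1) (by norm_num) (lin_mem _ _) {a, b, c} ?_ ?_
    · rw [Finset.card_eq_three.2 ⟨a, b, c, hab, hac, hbc, rfl⟩]; decide
    · intro t ht
      rw [eval_lin]
      simp only [Finset.mem_insert, Finset.mem_singleton] at ht
      rcases ht with rfl | rfl | rfl
      · exact h
      · simp only [det3]; ring
      · simp only [det3]; ring
  have h1 := lin_coeff2 _ _ h0
  simp only [Pt, Matrix.cons_val_zero, Matrix.cons_val_one, one_mul, mul_one] at h1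
  exact hbc (tau_inj (by exact_mod_cast (sub_eq_zero.1 h1).symm))

theorem lin_subst (P Q : Fin 3 → ℂ) (h : lin P Q ≠ 0) :
    ∃ σ : PolyC 3 →ₐ[ℂ] PolyC 3, ∀ G, lin P Q ∣ G ↔ σ G = 0 := by
  set n : Fin 3 → ℂ := ![P 1 * Q 2 - P 2 * Q 1, P 2 * Q 0 - P 0 * Q 2, P 0 * Q 1 - P 1 * Q 0] with hn
  have hl : lin P Q = ∑ k, MvPolynomial.C (n k) * xv k := by
    rw [Fin.sum_univ_three]; rfl
  have hj : ∃ j, n j ≠ 0 := by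
    by_contra hall
    push Not at hall
    apply h
    rw [hl]
    exact Finset.sum_eq_zero fun k _ => by rw [hall k]; simp
  obtain ⟨j, hj⟩ := hj
  let σ : PolyC 3 →ₐ[ℂ] PolyC 3 := MvPolynomial.aeval
    (fun k => if k = j then xv j - MvPolynomial.C (n j)⁻¹ * lin P Q else xv k)
  have hσ : ∀ k, σ (xv k) = if k = j then xv j - MvPolynomial.C (n j)⁻¹ * lin P Q else xv k := by
    intro k; simp [σ]
  have hdv : ∀ G, lin P Q ∣ G - σ G := by
    refine dvd_sub_subst _ σ fun k => ?_
    rw [hσ]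
    split_ifs with hk
    · subst hk
      exact ⟨MvPolynomial.C (n k)⁻¹, by ring⟩
    · simp
  have hC : ∀ c : ℂ, σ (MvPolynomial.C c) = MvPolynomial.C c := fun c => σ.commutes c
  have hz : σ (lin P Q) = 0 := by
    conv_lhs => rw [hl]
    rw [map_sum]
    have h1 : ∀ k, σ (MvPolynomial.C (n k) * xv k) = MvPolynomial.C (n k) * xv k -
        if k = j then lin P Q else 0 := by
      intro k
      rw [map_mul, hC, hσ]
      split_ifs with hk
      · subst hk
        rw [mul_sub, ← mul_assoc, ← MvPolynomial.C_mul, mul_inv_cancel₀ hj]; simp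
      · simp
    simp only [h1, Finset.sum_sub_distrib, ← hl]
    simp
  refine ⟨σ, fun G => ⟨?_, ?_⟩⟩
  · rintro ⟨c, rfl⟩
    rw [map_mul, hz, zero_mul]
  · intro h0
    simpa [h0] using hdv G

theorem lin_dvd_mul (P Q : Fin 3 → ℂ) (h : lin P Q ≠ 0) {a b : PolyC 3} (hd : lin P Q ∣ a * b) :
    lin P Q ∣ a ∨ lin P Q ∣ b := by
  obtain ⟨σ, hσ⟩ := lin_subst P Q h
  rw [hσ] at hd ⊢
  rw [hσ]
  rw [map_mul] at hd
  exact mul_eq_zero.1 hd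

theorem not_lin_dvd {P Q x : Fin 3 → ℂ} (hx : det3 x P Q = 0) {a : PolyC 3}
    (ha : MvPolynomial.eval x a ≠ 0) : ¬ lin P Q ∣ a := by
  rintro ⟨c, rfl⟩
  rw [map_mul, eval_lin, hx, zero_mul] at ha
  exact ha rfl

theorem lin_ne_zero {P Q x : Fin 3 → ℂ} (hx : det3 x P Q ≠ 0) : lin P Q ≠ 0 := by
  intro h
  rw [← eval_lin, h] at hx
  simp at hx

/-- homogeneous quotient -/
theorem homog_quot {d n : ℕ} {Q H : PolyC 3} (hQ : Q ∈ Hm d) (hH : H ∈ Hm (n + d)) (h : Q ∣ H) :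
    ∃ c ∈ Hm n, H = Q * c := by
  obtain ⟨c, hc⟩ := h
  refine ⟨MvPolynomial.homogeneousComponent n c, hc_mem _ _, ?_⟩
  rw [← hc_mul n hQ, ← hc, hc_self hH]

theorem form_sum {e : ℕ} {c : PolyC 3} (hc : c ∈ Hm e) :
    c = ∑ i : MIdx e, MvPolynomial.monomial i.1 (c.coeff i.1) := by
  ext m
  rw [MvPolynomial.coeff_sum]
  by_cases hm : m.degree = e
  · rw [Finset.sum_eq_single (⟨m, hm⟩ : MIdx e)]
    · simp
    · rintro ⟨b, hb⟩ - hne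
      have : b ≠ m := fun h => hne (Subtype.ext h)
      simp [MvPolynomial.coeff_monomial, this]
    · simp
  · rw [Finset.sum_eq_zero, Hm_coeff hc m hm]
    rintro ⟨b, hb⟩ -
    have : b ≠ m := fun h => hm (h ▸ hb)
    simp [MvPolynomial.coeff_monomial, this]

theorem quad_id {q : PolyC 3} (hq : q ∈ Hm 2) (x y z : Fin 3 → ℂ) (s t u : ℂ) :
    MvPolynomial.eval (s • x + t • y + u • z) q =
      s ^ 2 * MvPolynomial.eval x q + t ^ 2 * MvPolynomial.eval y q +
        u ^ 2 * MvPolynomial.eval z q +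
      s * t * (MvPolynomial.eval (x + y) q - MvPolynomial.eval x q - MvPolynomial.eval y q) +
      s * u * (MvPolynomial.eval (x + z) q - MvPolynomial.eval x q - MvPolynomial.eval z q) +
      t * u * (MvPolynomial.eval (y + z) q - MvPolynomial.eval y q - MvPolynomial.eval z q) := by
  rw [form_sum hq]
  simp only [map_sum, Finset.mul_sum, ← Finset.sum_add_distrib, ← Finset.sum_sub_distrib]
  refine Finset.sum_congr rfl ?_
  rintro ⟨m, hm⟩ -
  rw [Finsupp.degree_eq_sum, Fin.sum_univ_three] at hm
  simp only [MvPolynomial.eval_monomial]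
  have hp : ∀ w : Fin 3 → ℂ, (m.prod fun n e => w n ^ e) = w 0 ^ m 0 * w 1 ^ m 1 * w 2 ^ m 2 := by
    intro w
    rw [Finsupp.prod_fintype _ _ (by simp), Fin.prod_univ_three]
  simp only [hp, Pi.add_apply, Pi.smul_apply, smul_eq_mul]
  have h0 : m 0 ≤ 2 := by omega
  have h1 : m 1 ≤ 2 := by omega
  generalize MvPolynomial.coeff m q = c
  generalize m 0 = i at *
  generalize m 1 = j at *
  generalize m 2 = k at *
  obtain rfl : k = 2 - i - j := by omega
  interval_cases i <;> interval_cases j <;> first | omega | (simp; done) | (simp; ring)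

theorem conic3 {q : PolyC 3} (hq : q ∈ Hm 2) (P Q R : Fin 3 → ℂ)
    (hP : MvPolynomial.eval P q = 0) (hQ : MvPolynomial.eval Q q = 0)
    (hR : MvPolynomial.eval R q = 0) :
    MvPolynomial.C (det3 P Q R ^ 2) * q =
      MvPolynomial.C (MvPolynomial.eval (Q + R) q) * (lin R P * lin P Q) +
      MvPolynomial.C (MvPolynomial.eval (P + R) q) * (lin Q R * lin P Q) +
      MvPolynomial.C (MvPolynomial.eval (P + Q) q) * (lin Q R * lin R P) := by
  apply MvPolynomial.funext
  intro x
  simp only [map_mul, map_add, MvPolynomial.eval_C, eval_lin]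
  have h1 : det3 P Q R • x + (0 : ℂ) • x + (0 : ℂ) • x =
      det3 x Q R • P + det3 x R P • Q + det3 x P Q • R := by
    ext k
    simp only [Pi.add_apply, Pi.smul_apply, smul_eq_mul, det3]
    fin_cases k <;> simp <;> ring
  have h2 := quad_id hq x x x (det3 P Q R) 0 0
  rw [h1, quad_id hq P Q R, hP, hQ, hR] at h2
  linear_combination -h2

theorem conic_zero {q : PolyC 3} (hq : q ∈ Hm 2) (P Q R S : Fin 3 → ℂ)
    (hP : MvPolynomial.eval P q = 0) (hQ : MvPolynomial.eval Q q = 0)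
    (hR : MvPolynomial.eval R q = 0) (hS : MvPolynomial.eval S q = 0)
    (h1 : det3 P Q R ≠ 0) (h2 : det3 S R P ≠ 0) (h3 : det3 S P Q ≠ 0)
    (hPQ : MvPolynomial.eval (P + Q) q = 0) (hPR : MvPolynomial.eval (P + R) q = 0) : q = 0 := by
  have h := conic3 hq P Q R hP hQ hR
  rw [hPQ, hPR] at h
  have h' := congrArg (MvPolynomial.eval S) h
  simp only [map_mul, map_add, MvPolynomial.eval_C, eval_lin, hS] at h'
  have h4 : MvPolynomial.eval (Q + R) q = 0 := by
    by_contra hne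
    have : MvPolynomial.eval (Q + R) q * (det3 S R P * det3 S P Q) ≠ 0 := by positivity
    apply this
    linear_combination -h'
  rw [h4] at h
  simp only [map_zero, zero_mul, add_zero, mul_eq_zero, MvPolynomial.C_eq_zero] at h
  exact h.resolve_left (pow_ne_zero 2 h1)

theorem conic4 {q : PolyC 3} (hq : q ∈ Hm 2) (P Q R S : Fin 3 → ℂ)
    (hP : MvPolynomial.eval P q = 0) (hQ : MvPolynomial.eval Q q = 0)
    (hR : MvPolynomial.eval R q = 0) (hS : MvPolynomial.eval S q = 0)
    (h1 : det3 P Q R ≠ 0) (h2 : det3 S R P ≠ 0) (h3 : det3 S P Q ≠ 0) :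
    MvPolynomial.C ((det3 R P Q * det3 P R S) * (det3 Q P R * det3 P Q S)) * q =
      MvPolynomial.C ((det3 Q P R * det3 P Q S) * MvPolynomial.eval (P + R) q) *
        (lin P Q * lin R S) +
      MvPolynomial.C ((det3 R P Q * det3 P R S) * MvPolynomial.eval (P + Q) q) *
        (lin P R * lin Q S) := by
  rw [← sub_eq_zero]
  refine conic_zero ?_ P Q R S ?_ ?_ ?_ ?_ h1 h2 h3 ?_ ?_
  · refine Submodule.sub_mem _ (C_mul_mem _ hq) (Submodule.add_mem _ ?_ ?_) <;>
    exact C_mul_mem _ (mul_mem_Hm (lin_mem _ _) (lin_mem _ _))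
  all_goals simp only [map_sub, map_mul, map_add, MvPolynomial.eval_C, eval_lin, hP, hQ, hR, hS]
  all_goals simp only [det3, Pi.add_apply]
  all_goals ring

end

set_option linter.unusedSectionVars false

noncomputable section

theorem alt_front {p : ℕ} (f : AA (p + 1)) (w : Fin (p + 1) → (QI → ℂ)) (k : Fin (p + 1)) :
    ∃ u : ℂ, f w = u • f (Matrix.vecCons (w k) (fun i => w (Fin.succAbove k i))) := by
  have h : Matrix.vecCons (w k) (fun i => w (Fin.succAbove k i)) =
      w ∘ (Fin.cycleRange k).symm := by
    funext i
    refine Fin.cases ?_ (fun j => ?_) i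
    · simp
    · simp
  rw [h, AlternatingMap.map_perm]
  refine ⟨((Equiv.Perm.sign (Fin.cycleRange k).symm : ℤ) : ℂ), ?_⟩
  rcases Int.units_eq_one_or (Equiv.Perm.sign (Fin.cycleRange k).symm) with hs | hs <;>
    simp [hs]

theorem cyc_eval_at {p : ℕ} (f : AA (p + 1)) (hd : dK XM f = 0) (P : Fin 3 → ℂ)
    (w : Fin (p + 1) → (QI → ℂ)) (k : Fin (p + 1)) (hk : w k = ev P) :
    MvPolynomial.eval P (f w) = 0 := by
  obtain ⟨u, hu⟩ := alt_front f w k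
  rw [hu, hk, MvPolynomial.smul_eval, cyc_eval f hd, mul_zero]

/-- quintic attached to a cycle -/
def gp {p : ℕ} (f : AA (p + 1)) (v : Fin p → (QI → ℂ)) (x0 : Fin 3 → ℂ) : PolyC 3 :=
  ∑ i, MvPolynomial.C (MvPolynomial.eval x0 (f (Matrix.vecCons (ebas i) v))) * XM i

theorem XM_mem (i : QI) : XM i ∈ Hm 5 := MvPolynomial.isHomogeneous_monomial _ i.2

theorem gp_mem {p : ℕ} (f : AA (p + 1)) (v : Fin p → (QI → ℂ)) (x0 : Fin 3 → ℂ) :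
    gp f v x0 ∈ Hm 5 :=
  Submodule.sum_mem _ fun i _ => C_mul_mem _ (XM_mem i)

theorem eval_gp {p : ℕ} (f : AA (p + 1)) (v : Fin p → (QI → ℂ)) (x0 x : Fin 3 → ℂ) :
    MvPolynomial.eval x (gp f v x0) = MvPolynomial.eval x0 (f (Matrix.vecCons (ev x) v)) := by
  rw [alt_ev, gp, map_sum, map_sum]
  refine Finset.sum_congr rfl fun i _ => ?_
  simp [MvPolynomial.smul_eval, mul_comm]

theorem gp_zero {p : ℕ} (f : AA (p + 1)) (v : Fin p → (QI → ℂ)) (x0 : Fin 3 → ℂ)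
    (h : gp f v x0 = 0) (i : QI) :
    MvPolynomial.eval x0 (f (Matrix.vecCons (ebas i) v)) = 0 := by
  have := congrArg (MvPolynomial.coeff i.1) h
  rw [gp, MvPolynomial.coeff_sum, MvPolynomial.coeff_zero] at this
  simp only [XM, MvPolynomial.coeff_C_mul, MvPolynomial.coeff_monomial] at this
  rw [Finset.sum_eq_single i] at this
  · simpa using this
  · intro j _ hj
    rw [if_neg (fun h => hj (Subtype.ext h)), mul_zero]
  · simp

theorem alt_zero_of_ebas {p : ℕ} (f : AA (p + 1)) (v : Fin p → (QI → ℂ))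
    (h : ∀ i, f (Matrix.vecCons (ebas i) v) = 0) (φ : QI → ℂ) :
    f (Matrix.vecCons φ v) = 0 := by
  have : φ = ∑ i, φ i • ebas i := by
    funext j
    simp [ebas, Pi.single_apply]
  rw [← AlternatingMap.curryLeft_apply_apply, this, map_sum, altsum_apply]
  refine Finset.sum_eq_zero fun i _ => ?_
  rw [map_smul, AlternatingMap.smul_apply, AlternatingMap.curryLeft_apply_apply, h, smul_zero]

theorem dvd_of_C_mul {l g : PolyC 3} {c : ℂ} (hc : c ≠ 0) (h : l ∣ MvPolynomial.C c * g) : l ∣ g := by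
  have : g = MvPolynomial.C c⁻¹ * (MvPolynomial.C c * g) := by
    rw [← mul_assoc, ← MvPolynomial.C_mul, inv_mul_cancel₀ hc]; simp
  rw [this]; exact Dvd.dvd.mul_left h _

theorem key4 (f : AA 4) (hf : ∀ v, f v ∈ Hm 2) (hd : dK XM f = 0) (P Q R : Fin 3 → ℂ)
    (h1 : det3 P Q R ≠ 0) :
    ∃ c1 ∈ Hm 4, ∃ c2 ∈ Hm 4, ∃ c3 ∈ Hm 4, c1 + c2 + c3 = 0 ∧
      (∀ x, MvPolynomial.eval (Q + R) (f ![ev x, ev P, ev Q, ev R]) =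
        det3 x Q R * MvPolynomial.eval x c1) ∧
      (∀ x, MvPolynomial.eval (P + R) (f ![ev x, ev P, ev Q, ev R]) =
        det3 x R P * MvPolynomial.eval x c2) ∧
      (∀ x, MvPolynomial.eval (P + Q) (f ![ev x, ev P, ev Q, ev R]) =
        det3 x P Q * MvPolynomial.eval x c3) ∧
      (c1 = 0 → c2 = 0 → c3 = 0 → ∀ φ, f ![φ, ev P, ev Q, ev R] = 0) := by
  set v : Fin 3 → (QI → ℂ) := ![ev P, ev Q, ev R] with hv
  have hq : ∀ i, MvPolynomial.C (det3 P Q R ^ 2) * f (Matrix.vecCons (ebas i) v) =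
      MvPolynomial.C (MvPolynomial.eval (Q + R) (f (Matrix.vecCons (ebas i) v))) *
        (lin R P * lin P Q) +
      MvPolynomial.C (MvPolynomial.eval (P + R) (f (Matrix.vecCons (ebas i) v))) *
        (lin Q R * lin P Q) +
      MvPolynomial.C (MvPolynomial.eval (P + Q) (f (Matrix.vecCons (ebas i) v))) *
        (lin Q R * lin R P) := by
    intro i
    refine conic3 (hf _) P Q R ?_ ?_ ?_
    · exact cyc_eval_at f hd P _ 1 rfl
    · exact cyc_eval_at f hd Q _ 2 rfl
    · exact cyc_eval_at f hd R _ 3 rfl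
  have hrel : gp f v (Q + R) * (lin R P * lin P Q) + gp f v (P + R) * (lin Q R * lin P Q) +
      gp f v (P + Q) * (lin Q R * lin R P) = 0 := by
    have h := DFunLike.congr_fun hd v
    rw [dK_apply, AlternatingMap.zero_apply] at h
    have h' := congrArg (fun y => MvPolynomial.C (det3 P Q R ^ 2) * y) h
    simp only [Finset.mul_sum, mul_zero] at h'
    rw [← h']
    simp only [gp, Finset.sum_mul, ← Finset.sum_add_distrib]
    refine Finset.sum_congr rfl fun i _ => ?_
    linear_combination (- XM i) * hq i
  have e1 : det3 Q R P = det3 P Q R := by simp only [det3]; ring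
  have e2 : det3 R P Q = det3 P Q R := by simp only [det3]; ring
  have n1 : lin Q R ≠ 0 := lin_ne_zero h1
  have n2 : lin R P ≠ 0 := lin_ne_zero (x := Q) (by rwa [e1])
  have n3 : lin P Q ≠ 0 := lin_ne_zero (x := R) (by rwa [e2])
  have z1 : ∀ x y : Fin 3 → ℂ, det3 x x y = 0 := by intro x y; simp only [det3]; ring
  have z2 : ∀ x y : Fin 3 → ℂ, det3 x y x = 0 := by intro x y; simp only [det3]; ring
  have d1 : lin Q R ∣ gp f v (Q + R) := by
    have : lin Q R ∣ gp f v (Q + R) * (lin R P * lin P Q) :=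
      ⟨-(gp f v (P + R) * lin P Q + gp f v (P + Q) * lin R P), by linear_combination hrel⟩
    rcases lin_dvd_mul _ _ n1 this with h | h
    · exact h
    · rcases lin_dvd_mul _ _ n1 h with h | h
      · exact absurd h (not_lin_dvd (x := Q) (z1 _ _) (by rw [eval_lin, e1]; exact h1))
      · exact absurd h (not_lin_dvd (x := R) (z2 _ _) (by rw [eval_lin, e2]; exact h1))
  have d2 : lin R P ∣ gp f v (P + R) := by
    have : lin R P ∣ gp f v (P + R) * (lin Q R * lin P Q) :=
      ⟨-(gp f v (Q + R) * lin P Q + gp f v (P + Q) * lin Q R), by linear_combination hrel⟩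
    rcases lin_dvd_mul _ _ n2 this with h | h
    · exact h
    · rcases lin_dvd_mul _ _ n2 h with h | h
      · exact absurd h (not_lin_dvd (x := P) (z2 _ _) (by rw [eval_lin]; exact h1))
      · exact absurd h (not_lin_dvd (x := R) (z1 _ _) (by rw [eval_lin, e2]; exact h1))
  have d3 : lin P Q ∣ gp f v (P + Q) := by
    have : lin P Q ∣ gp f v (P + Q) * (lin Q R * lin R P) :=
      ⟨-(gp f v (Q + R) * lin R P + gp f v (P + R) * lin Q R), by linear_combination hrel⟩
    rcases lin_dvd_mul _ _ n3 this with h | h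
    · exact h
    · rcases lin_dvd_mul _ _ n3 h with h | h
      · exact absurd h (not_lin_dvd (x := P) (z1 _ _) (by rw [eval_lin]; exact h1))
      · exact absurd h (not_lin_dvd (x := Q) (z2 _ _) (by rw [eval_lin, e1]; exact h1))
  obtain ⟨c1, hc1, g1⟩ := homog_quot (n := 4) (lin_mem _ _) (gp_mem f v (Q + R)) d1
  obtain ⟨c2, hc2, g2⟩ := homog_quot (n := 4) (lin_mem _ _) (gp_mem f v (P + R)) d2
  obtain ⟨c3, hc3, g3⟩ := homog_quot (n := 4) (lin_mem _ _) (gp_mem f v (P + Q)) d3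
  refine ⟨c1, hc1, c2, hc2, c3, hc3, ?_, ?_, ?_, ?_, ?_⟩
  · have : (lin Q R * lin R P * lin P Q) * (c1 + c2 + c3) = 0 := by
      rw [g1, g2, g3] at hrel
      linear_combination hrel
    exact (mul_eq_zero.1 this).resolve_left (mul_ne_zero (mul_ne_zero n1 n2) n3)
  · intro x
    rw [← eval_lin, ← map_mul, ← g1, eval_gp]
  · intro x
    rw [← eval_lin, ← map_mul, ← g2, eval_gp]
  · intro x
    rw [← eval_lin, ← map_mul, ← g3, eval_gp]
  · rintro rfl rfl rfl
    rw [mul_zero] at g1 g2 g3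
    refine alt_zero_of_ebas f v fun i => ?_
    have := hq i
    rw [gp_zero f v _ g1, gp_zero f v _ g2, gp_zero f v _ g3] at this
    simp only [map_zero, zero_mul, add_zero, mul_eq_zero, MvPolynomial.C_eq_zero] at this
    exact this.resolve_left (pow_ne_zero 2 h1)

theorem key5 (f : AA 5) (hf : ∀ v, f v ∈ Hm 2) (hd : dK XM f = 0) (P Q R S : Fin 3 → ℂ)
    (h1 : det3 P Q R ≠ 0) (h2 : det3 P Q S ≠ 0) (h3 : det3 P R S ≠ 0) (h4 : det3 Q R S ≠ 0) :
    ∃ c ∈ Hm 3,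
      (∀ x, MvPolynomial.eval (P + Q) (f ![ev x, ev P, ev Q, ev R, ev S]) =
        det3 x P Q * det3 x R S * MvPolynomial.eval x c) ∧
      (c = 0 → ∀ φ, f ![φ, ev P, ev Q, ev R, ev S] = 0) := by
  set v : Fin 4 → (QI → ℂ) := ![ev P, ev Q, ev R, ev S] with hv
  have k1 : det3 S R P ≠ 0 := by
    have : det3 S R P = - det3 P R S := by simp only [det3]; ring
    rw [this]; exact neg_ne_zero.2 h3
  have k2 : det3 S P Q ≠ 0 := by
    have : det3 S P Q = det3 P Q S := by simp only [det3]; ring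
    rw [this]; exact h2
  have k3 : det3 R P Q ≠ 0 := by
    have : det3 R P Q = det3 P Q R := by simp only [det3]; ring
    rw [this]; exact h1
  have k4 : det3 Q P R ≠ 0 := by
    have : det3 Q P R = - det3 P Q R := by simp only [det3]; ring
    rw [this]; exact neg_ne_zero.2 h1
  have k5 : det3 R Q S ≠ 0 := by
    have : det3 R Q S = - det3 Q R S := by simp only [det3]; ring
    rw [this]; exact neg_ne_zero.2 h4
  set a : ℂ := det3 R P Q * det3 P R S with ha
  set b : ℂ := det3 Q P R * det3 P Q S with hb
  have ha0 : a ≠ 0 := mul_ne_zero k3 h3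
  have hb0 : b ≠ 0 := mul_ne_zero k4 h2
  have hq : ∀ i, MvPolynomial.C (a * b) * f (Matrix.vecCons (ebas i) v) =
      MvPolynomial.C (b * MvPolynomial.eval (P + R) (f (Matrix.vecCons (ebas i) v))) *
        (lin P Q * lin R S) +
      MvPolynomial.C (a * MvPolynomial.eval (P + Q) (f (Matrix.vecCons (ebas i) v))) *
        (lin P R * lin Q S) := by
    intro i
    refine conic4 (hf _) P Q R S ?_ ?_ ?_ ?_ h1 k1 k2
    · exact cyc_eval_at f hd P _ 1 rfl
    · exact cyc_eval_at f hd Q _ 2 rfl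
    · exact cyc_eval_at f hd R _ 3 rfl
    · exact cyc_eval_at f hd S _ 4 rfl
  have hrel : MvPolynomial.C b * gp f v (P + R) * (lin P Q * lin R S) +
      MvPolynomial.C a * gp f v (P + Q) * (lin P R * lin Q S) = 0 := by
    have h := DFunLike.congr_fun hd v
    rw [dK_apply, AlternatingMap.zero_apply] at h
    have h' := congrArg (fun y => MvPolynomial.C (a * b) * y) h
    simp only [Finset.mul_sum, mul_zero] at h'
    rw [← h']
    simp only [gp, Finset.sum_mul, Finset.mul_sum, ← Finset.sum_add_distrib]
    refine Finset.sum_congr rfl fun i _ => ?_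
    have := hq i
    simp only [MvPolynomial.C_mul] at this ⊢
    linear_combination (- XM i) * this
  have z1 : ∀ x y : Fin 3 → ℂ, det3 x x y = 0 := by intro x y; simp only [det3]; ring
  have z2 : ∀ x y : Fin 3 → ℂ, det3 x y x = 0 := by intro x y; simp only [det3]; ring
  have n1 : lin P Q ≠ 0 := lin_ne_zero k3
  have n2 : lin R S ≠ 0 := lin_ne_zero h3
  have d1 : lin P Q ∣ gp f v (P + Q) := by
    have : lin P Q ∣ MvPolynomial.C a * (gp f v (P + Q) * (lin P R * lin Q S)) :=
      ⟨-(MvPolynomial.C b * gp f v (P + R) * lin R S), by linear_combination hrel⟩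
    rcases lin_dvd_mul _ _ n1 (dvd_of_C_mul ha0 this) with h | h
    · exact h
    · rcases lin_dvd_mul _ _ n1 h with h | h
      · exact absurd h (not_lin_dvd (x := Q) (z2 _ _) (by rw [eval_lin]; exact k4))
      · exact absurd h (not_lin_dvd (x := P) (z1 _ _) (by rw [eval_lin]; exact h2))
  have d2 : lin R S ∣ gp f v (P + Q) := by
    have : lin R S ∣ MvPolynomial.C a * (gp f v (P + Q) * (lin P R * lin Q S)) :=
      ⟨-(MvPolynomial.C b * gp f v (P + R) * lin P Q), by linear_combination hrel⟩
    rcases lin_dvd_mul _ _ n2 (dvd_of_C_mul ha0 this) with h | h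
    · exact h
    · rcases lin_dvd_mul _ _ n2 h with h | h
      · exact absurd h (not_lin_dvd (x := S) (z2 _ _) (by
          rw [eval_lin]
          have : det3 S P R = - det3 S R P := by simp only [det3]; ring
          rw [this]; exact neg_ne_zero.2 k1))
      · exact absurd h (not_lin_dvd (x := R) (z1 _ _) (by rw [eval_lin]; exact k5))
  have d3 : lin P Q * lin R S ∣ gp f v (P + Q) := by
    obtain ⟨u, hu⟩ := d1
    rw [hu] at d2 ⊢
    rcases lin_dvd_mul _ _ n2 d2 with h | h
    · exact absurd h (not_lin_dvd (x := R) (z1 _ _) (by rw [eval_lin]; exact k3))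
    · exact mul_dvd_mul_left _ h
  obtain ⟨c, hc, g⟩ := homog_quot (n := 3) (mul_mem_Hm (lin_mem P Q) (lin_mem R S))
    (gp_mem f v (P + Q)) d3
  refine ⟨c, hc, ?_, ?_⟩
  · intro x
    rw [← eval_lin, ← eval_lin, ← map_mul, ← map_mul, ← g, eval_gp]
  · rintro rfl
    rw [mul_zero] at g
    rw [g] at hrel
    have g2 : gp f v (P + R) = 0 := by
      have hne : MvPolynomial.C b * (lin P Q * lin R S) ≠ 0 :=
        mul_ne_zero (by simpa using hb0) (mul_ne_zero n1 n2)
      have : (MvPolynomial.C b * (lin P Q * lin R S)) * gp f v (P + R) = 0 := by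
        linear_combination hrel
      exact (mul_eq_zero.1 this).resolve_left hne
    refine alt_zero_of_ebas f v fun i => ?_
    have := hq i
    rw [gp_zero f v _ g, gp_zero f v _ g2] at this
    simp only [map_zero, zero_mul, mul_zero, add_zero, mul_eq_zero, MvPolynomial.C_eq_zero] at this
    exact this.resolve_left (by simp [ha0, hb0])

end

set_option linter.unusedSectionVars false

noncomputable section

theorem sort_zero {p n : ℕ} (x : Fin n → (QI → ℂ)) (f : AA p)
    (h : ∀ T : Fin p ↪o Fin n, f (fun i => x (T i)) = 0) (T : Fin p → Fin n) :
    f (fun i => x (T i)) = 0 := by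
  let B := Pi.basisFun ℂ (Fin n)
  let L : (Fin n → ℂ) →ₗ[ℂ] (QI → ℂ) := B.constr ℂ x
  have hL : ∀ t, L (B t) = x t := fun t => B.constr_basis ℂ x t
  have h0 : f.compLinearMap L = 0 := by
    apply (exteriorPower.alternatingMapLinearEquiv (R := ℂ)).injective
    apply (B.exteriorPower p).ext
    intro s
    rw [exteriorPower.basis_apply, exteriorPower.ιMulti_family,
      exteriorPower.alternatingMapLinearEquiv_apply_ιMulti,
      exteriorPower.alternatingMapLinearEquiv_apply_ιMulti]
    rw [AlternatingMap.compLinearMap_apply, AlternatingMap.zero_apply]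
    refine Eq.trans ?_ (h (Set.powersetCard.ofFinEmbEquiv.symm s))
    congr 1
    funext i
    exact hL _
  have := DFunLike.congr_fun h0 (fun i => B (T i))
  rw [AlternatingMap.compLinearMap_apply, AlternatingMap.zero_apply] at this
  rw [← this]
  congr 1
  funext i
  exact (hL _).symm

/-- evaluation at the chosen points -/
abbrev evP (t : Fin 21) : QI → ℂ := ev (Pt t)

theorem evP_span : (⊤ : Submodule ℂ (QI → ℂ)) ≤ Submodule.span ℂ (Set.range evP) := by
  by_contra hlt
  obtain ⟨φ, hφ, hle⟩ := Submodule.exists_le_ker_of_lt_top _ (lt_top_iff_ne_top.2 fun h => hlt h.ge)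
  apply hφ
  have h0 : ∑ i, MvPolynomial.C (φ (ebas i)) * XM i = (0 : PolyC 3) := by
    refine poised (e := 5) le_rfl (Submodule.sum_mem _ fun i _ => C_mul_mem _ (XM_mem i))
      Finset.univ (by decide) ?_
    intro t _
    have h1 : φ (evP t) = 0 := hle (Submodule.subset_span ⟨t, rfl⟩)
    rw [evP, ev_eq, map_sum] at h1
    rw [map_sum, ← h1]
    refine Finset.sum_congr rfl fun i _ => ?_
    simp [mul_comm]
  apply (Pi.basisFun ℂ QI).ext
  intro i
  have := congrArg (MvPolynomial.coeff i.1) h0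
  rw [MvPolynomial.coeff_sum, MvPolynomial.coeff_zero] at this
  simp only [XM, MvPolynomial.coeff_C_mul, MvPolynomial.coeff_monomial] at this
  rw [Finset.sum_eq_single i] at this
  · simpa [ebas] using this
  · intro j _ hj
    rw [if_neg (fun h => hj (Subtype.ext h)), mul_zero]
  · simp

theorem evP_ext {p : ℕ} (f : AA p)
    (h : ∀ T : Fin p → Fin 21, Function.Injective T → f (fun i => evP (T i)) = 0) : f = 0 := by
  let B := basisOfTopLeSpanOfCardEqFinrank evP evP_span (by
    rw [Module.finrank_fintype_fun_eq_card, card_MIdx]; rfl)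
  apply B.ext_alternating
  intro T hT
  rw [AlternatingMap.zero_apply, ← h T hT]
  congr 1
  funext i
  simp [B]

/-- two-degree cycles -/
def Zc (p : ℕ) : Submodule ℂ (AA (p + 1)) where
  carrier := {f | (∀ v, f v ∈ Hm 2) ∧ dK XM f = 0}
  add_mem' := by
    rintro a b ⟨ha, ha'⟩ ⟨hb, hb'⟩
    refine ⟨fun v => Submodule.add_mem _ (ha v) (hb v), ?_⟩
    rw [dK_add, ha', hb', add_zero]
  zero_mem' := ⟨fun v => Submodule.zero_mem _, dK_zero _⟩
  smul_mem' := by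
    rintro c f ⟨hf, hf'⟩
    refine ⟨fun v => Submodule.smul_mem _ _ (hf v), ?_⟩
    have h2 : c • f = (MvPolynomial.C c : PolyC 3) • f := by
      ext1 v
      simp only [AlternatingMap.smul_apply, smul_eq_mul, MvPolynomial.smul_eq_C_mul]
    rw [h2, dK_smul, hf', smul_zero]

theorem Zc_big (p : ℕ) (hp : 5 ≤ p) (f : AA (p + 1)) (hf : f ∈ Zc p) : f = 0 := by
  apply evP_ext
  intro T hT
  refine poised (e := 2) (by norm_num) (hf.1 _) (Finset.univ.image T) ?_ ?_
  · rw [Finset.card_image_of_injective _ hT, Finset.card_univ, Fintype.card_fin,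
      show Nat.choose (2 + 2) 2 = 6 from rfl]
    omega
  · intro t ht
    obtain ⟨k, -, rfl⟩ := Finset.mem_image.1 ht
    exact cyc_eval_at f hf.2 _ _ k rfl

/-- number of indices outside the first `n` -/
def outn (n : ℕ) {p : ℕ} (T : Fin p → Fin 21) : ℕ := ∑ i, if n ≤ (T i).val then 1 else 0

theorem evP_cons {p : ℕ} (s : Fin 21) (T : Fin p → Fin 21) :
    (fun i => evP (Matrix.vecCons s T i)) = Matrix.vecCons (evP s) (fun i => evP (T i)) := by
  funext i
  refine Fin.cases ?_ (fun j => ?_) i <;> simp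

theorem out_induct (n : ℕ) {p : ℕ} (f : AA (p + 1))
    (base : ∀ T : Fin (p + 1) → Fin 21, (∀ i, (T i).val < n) → f (fun i => evP (T i)) = 0)
    (step : ∀ T' : Fin p → Fin 21, Function.Injective T' →
      (∀ s : Fin 21, s.val < n → f (Matrix.vecCons (evP s) (fun i => evP (T' i))) = 0) →
      ∀ φ, f (Matrix.vecCons φ (fun i => evP (T' i))) = 0) : f = 0 := by
  apply evP_ext
  have main : ∀ (m : ℕ) (T : Fin (p + 1) → Fin 21), outn n T = m → f (fun i => evP (T i)) = 0 := by
    intro m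
    induction m using Nat.strong_induction_on with
    | _ m ih =>
      intro T hm
      by_cases hall : ∀ i, (T i).val < n
      · exact base T hall
      · push Not at hall
        obtain ⟨k, hk⟩ := hall
        obtain ⟨u, hu⟩ := alt_front f (fun i => evP (T i)) k
        rw [hu]
        by_cases hinj : Function.Injective (fun i => T (Fin.succAbove k i))
        · rw [step (fun i => T (Fin.succAbove k i)) hinj ?_, smul_zero]
          intro s hs
          rw [← evP_cons s (fun i => T (Fin.succAbove k i))]
          refine ih _ ?_ _ rfl
          rw [← hm]
          have hA : outn n T = 1 + outn n (fun i => T (Fin.succAbove k i)) := by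
            unfold outn
            rw [Fin.sum_univ_succAbove _ k, if_pos hk]
          have hB : outn n (Matrix.vecCons s (fun i => T (Fin.succAbove k i))) =
              outn n (fun i => T (Fin.succAbove k i)) := by
            unfold outn
            rw [Fin.sum_univ_succ, Matrix.cons_val_zero, if_neg (by omega), zero_add]
            rfl
          omega
        · rw [AlternatingMap.map_eq_zero_of_not_injective, smul_zero]
          intro hi
          apply hinj
          intro a b hab
          have : (Fin.succ a) = Fin.succ b := hi (congrArg evP hab)
          exact Fin.succ_injective _ this
  exact fun T _ => main _ T rfl

/-- the first `n` indices -/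
abbrev firstn (n : ℕ) : Finset (Fin 21) := Finset.univ.filter fun s => s.val < n

theorem card_first (n : ℕ) {p : ℕ} (T' : Fin p → Fin 21) :
    (firstn n).card ≤ (firstn n \ Finset.univ.image T').card + p := by
  have h1 := Finset.le_card_sdiff (Finset.univ.image T') (firstn n)
  have h2 := Finset.card_image_le (s := Finset.univ) (f := T')
  rw [Finset.card_univ, Fintype.card_fin] at h2
  omega

theorem base_of_sorted {n p : ℕ} (hn : n ≤ 21) (f : AA p)
    (h : ∀ T : Fin p ↪o Fin n, f (fun i => evP (Fin.castLE hn (T i))) = 0)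
    (T : Fin p → Fin 21) (hT : ∀ i, (T i).val < n) : f (fun i => evP (T i)) = 0 :=
  sort_zero (fun t => evP (Fin.castLE hn t)) f h (fun i => ⟨(T i).val, hT i⟩)

theorem upper5 (f : AA 5) (hf : f ∈ Zc 4)
    (h : ∀ T : Fin 5 ↪o Fin 14, MvPolynomial.eval (Pt 14)
      (f (fun i => evP (Fin.castLE (by norm_num) (T i)))) = 0) : f = 0 := by
  apply out_induct 14 f
  · apply base_of_sorted (by norm_num : 14 ≤ 21) f
    intro T
    have hinj : Function.Injective (fun i => (Fin.castLE (by norm_num) (T i) : Fin 21)) :=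
      (Fin.castLE_injective _).comp T.injective
    have hnot : (14 : Fin 21) ∉
        Finset.univ.image (fun i => (Fin.castLE (by norm_num) (T i) : Fin 21)) := by
      intro hm
      obtain ⟨k, -, hk⟩ := Finset.mem_image.1 hm
      have := congrArg Fin.val hk
      have h2 := (T k).2
      simp at this; omega
    refine poised (e := 2) (by norm_num) (hf.1 _) (insert 14 (Finset.univ.image
      (fun i => (Fin.castLE (by norm_num) (T i) : Fin 21)))) ?_ ?_
    · rw [Finset.card_insert_of_notMem hnot, Finset.card_image_of_injective _ hinj]
      decide
    · intro t ht
      rcases Finset.mem_insert.1 ht with rfl | ht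
      · exact h T
      · obtain ⟨k, -, rfl⟩ := Finset.mem_image.1 ht
        exact cyc_eval_at f hf.2 _ _ k rfl
  · intro T hinj hz φ
    have hd : ∀ i j k : Fin 4, i ≠ j → i ≠ k → j ≠ k →
        det3 (Pt (T i)) (Pt (T j)) (Pt (T k)) ≠ 0 :=
      fun i j k hij hik hjk => det3_Pt _ _ _ (hinj.ne hij) (hinj.ne hik) (hinj.ne hjk)
    have hT : (fun i => evP (T i)) = ![ev (Pt (T 0)), ev (Pt (T 1)), ev (Pt (T 2)), ev (Pt (T 3))] := by
      funext i; fin_cases i <;> rfl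
    obtain ⟨c, hc, h1, h2⟩ := key5 f hf.1 hf.2 (Pt (T 0)) (Pt (T 1)) (Pt (T 2)) (Pt (T 3))
      (hd 0 1 2 (by decide) (by decide) (by decide)) (hd 0 1 3 (by decide) (by decide) (by decide))
      (hd 0 2 3 (by decide) (by decide) (by decide)) (hd 1 2 3 (by decide) (by decide) (by decide))
    rw [hT] at hz ⊢
    refine h2 ?_ φ
    refine poised (e := 3) (by norm_num) hc (firstn 14 \ Finset.univ.image T) ?_ ?_
    · have := card_first 14 T
      have h14 : (firstn 14).card = 14 := by decide
      rw [show Nat.choose (3 + 2) 2 = 10 from rfl]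
      omega
    · intro s hs
      rw [Finset.mem_sdiff, Finset.mem_filter] at hs
      have hne : ∀ i, s ≠ T i := fun i hi => hs.2 (Finset.mem_image.2 ⟨i, Finset.mem_univ _, hi.symm⟩)
      have h3 := h1 (Pt s)
      rw [hz s hs.1.2, map_zero] at h3
      have d1 := det3_Pt s (T 0) (T 1) (hne 0) (hne 1) (hinj.ne (by decide))
      have d2 := det3_Pt s (T 2) (T 3) (hne 2) (hne 3) (hinj.ne (by decide))
      exact (mul_eq_zero.1 h3.symm).resolve_left (mul_ne_zero d1 d2)

/-- cast of indices -/
abbrev c16 (t : Fin 16) : Fin 21 := Fin.castLE (by norm_num) t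

theorem upper4 (f : AA 4) (hf : f ∈ Zc 3)
    (h1 : ∀ T : Fin 4 ↪o Fin 16, MvPolynomial.eval (Pt (c16 (T 0)) + Pt (c16 (T 1)))
      (f (fun i => evP (c16 (T i)))) = 0)
    (h2 : ∀ T : Fin 4 ↪o Fin 16, MvPolynomial.eval (Pt (c16 (T 0)) + Pt (c16 (T 2)))
      (f (fun i => evP (c16 (T i)))) = 0)
    (h3 : ∀ T : Fin 3 ↪o Fin 16, MvPolynomial.eval (Pt (c16 (T 1)) + Pt (c16 (T 2)))
      (f ![evP 16, evP (c16 (T 0)), evP (c16 (T 1)), evP (c16 (T 2))]) = 0) : f = 0 := by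
  have base : ∀ T : Fin 4 → Fin 21, (∀ i, (T i).val < 16) → f (fun i => evP (T i)) = 0 := by
    apply base_of_sorted (by norm_num : 16 ≤ 21) f
    intro T
    have hinj : Function.Injective (fun i => c16 (T i)) :=
      (Fin.castLE_injective _).comp T.injective
    have hd : ∀ i j k : Fin 4, i ≠ j → i ≠ k → j ≠ k →
        det3 (Pt (c16 (T i))) (Pt (c16 (T j))) (Pt (c16 (T k))) ≠ 0 :=
      fun i j k hij hik hjk => det3_Pt _ _ _ (hinj.ne hij) (hinj.ne hik) (hinj.ne hjk)
    exact conic_zero (hf.1 _) (Pt (c16 (T 0))) (Pt (c16 (T 1))) (Pt (c16 (T 2))) (Pt (c16 (T 3)))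
      (cyc_eval_at f hf.2 _ _ 0 rfl) (cyc_eval_at f hf.2 _ _ 1 rfl)
      (cyc_eval_at f hf.2 _ _ 2 rfl) (cyc_eval_at f hf.2 _ _ 3 rfl)
      (hd 0 1 2 (by decide) (by decide) (by decide)) (hd 3 2 0 (by decide) (by decide) (by decide))
      (hd 3 0 1 (by decide) (by decide) (by decide)) (h1 T) (h2 T)
  have h16 : (firstn 16).card = 16 := by decide
  -- general analysis of a triple
  have triple : ∀ T : Fin 3 → Fin 21, Function.Injective T →
      (∀ s : Fin 21, s.val < 16 → f (Matrix.vecCons (evP s) (fun i => evP (T i))) = 0) →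
      ((∃ k, 16 ≤ (T k).val) ∨ ((∀ k, (T k).val < 16) ∧ MvPolynomial.eval (Pt (T 1) + Pt (T 2))
        (f ![evP 16, evP (T 0), evP (T 1), evP (T 2)]) = 0)) →
      ∀ φ, f (Matrix.vecCons φ (fun i => evP (T i))) = 0 := by
    intro T hinj hz hor φ
    have hT : (fun i => evP (T i)) = ![ev (Pt (T 0)), ev (Pt (T 1)), ev (Pt (T 2))] := by
      funext i; fin_cases i <;> rfl
    have n01 : T 0 ≠ T 1 := hinj.ne (by decide)
    have n02 : T 0 ≠ T 2 := hinj.ne (by decide)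
    have n12 : T 1 ≠ T 2 := hinj.ne (by decide)
    have hd := det3_Pt _ _ _ n01 n02 n12
    obtain ⟨a1, ha1, a2, ha2, a3, ha3, hsum, e1, e2, e3, hfin⟩ :=
      key4 f hf.1 hf.2 (Pt (T 0)) (Pt (T 1)) (Pt (T 2)) hd
    rw [hT] at hz ⊢
    set S := firstn 16 \ Finset.univ.image T with hS
    have hSne : ∀ s ∈ S, ∀ i, s ≠ T i := by
      intro s hs i hi
      exact (Finset.mem_sdiff.1 hs).2 (Finset.mem_image.2 ⟨i, Finset.mem_univ _, hi.symm⟩)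
    have hSlt : ∀ s ∈ S, s.val < 16 := fun s hs =>
      (Finset.mem_filter.1 (Finset.mem_sdiff.1 hs).1).2
    have hTS : ∀ i, T i ∉ S := fun i hi => hSne _ hi i rfl
    have z1 : ∀ s ∈ S, MvPolynomial.eval (Pt s) a1 = 0 := by
      intro s hs
      have := e1 (Pt s)
      rw [hz s (hSlt s hs), map_zero] at this
      exact (mul_eq_zero.1 this.symm).resolve_left
        (det3_Pt _ _ _ (hSne s hs 1) (hSne s hs 2) n12)
    have z2 : ∀ s ∈ S, MvPolynomial.eval (Pt s) a2 = 0 := by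
      intro s hs
      have := e2 (Pt s)
      rw [hz s (hSlt s hs), map_zero] at this
      exact (mul_eq_zero.1 this.symm).resolve_left
        (det3_Pt _ _ _ (hSne s hs 2) (hSne s hs 0) n02.symm)
    have z3 : ∀ s ∈ S, MvPolynomial.eval (Pt s) a3 = 0 := by
      intro s hs
      have := e3 (Pt s)
      rw [hz s (hSlt s hs), map_zero] at this
      exact (mul_eq_zero.1 this.symm).resolve_left
        (det3_Pt _ _ _ (hSne s hs 0) (hSne s hs 1) n01)
    have y1 : MvPolynomial.eval (Pt (T 0)) a1 = 0 := by
      have := e1 (Pt (T 0))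
      rw [f.map_eq_zero_of_eq _ (i := 0) (j := 1) rfl (by decide), map_zero] at this
      exact (mul_eq_zero.1 this.symm).resolve_left hd
    have y2 : MvPolynomial.eval (Pt (T 1)) a2 = 0 := by
      have := e2 (Pt (T 1))
      rw [f.map_eq_zero_of_eq _ (i := 0) (j := 2) rfl (by decide), map_zero] at this
      exact (mul_eq_zero.1 this.symm).resolve_left (det3_Pt _ _ _ n12 n01.symm n02.symm)
    have y3 : MvPolynomial.eval (Pt (T 2)) a3 = 0 := by
      have := e3 (Pt (T 2))
      rw [f.map_eq_zero_of_eq _ (i := 0) (j := 3) rfl (by decide), map_zero] at this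
      exact (mul_eq_zero.1 this.symm).resolve_left (det3_Pt _ _ _ n02.symm n12.symm n01)
    have hcard : 13 ≤ S.card := by
      have := card_first 16 T
      rw [← hS, h16] at this
      omega
    rcases hor with ⟨k, hk⟩ | ⟨hlt, hv⟩
    · have hcard' : 14 ≤ S.card := by
        have hsub : firstn 16 \ ((Finset.univ.erase k).image T) ⊆ S := by
          intro s hs
          rw [hS, Finset.mem_sdiff] at *
          refine ⟨hs.1, fun hm => hs.2 ?_⟩
          obtain ⟨i, -, hi⟩ := Finset.mem_image.1 hm
          refine Finset.mem_image.2 ⟨i, Finset.mem_erase.2 ⟨?_, Finset.mem_univ _⟩, hi⟩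
          rintro rfl
          have := (Finset.mem_filter.1 hs.1).2
          rw [← hi] at this; omega
        refine le_trans ?_ (Finset.card_le_card hsub)
        have q1 := Finset.le_card_sdiff ((Finset.univ.erase k).image T) (firstn 16)
        have q2 := Finset.card_image_le (s := Finset.univ.erase k) (f := T)
        rw [Finset.card_erase_of_mem (Finset.mem_univ _), Finset.card_univ, Fintype.card_fin] at q2
        omega
      have fin : ∀ (a : PolyC 3) (i : Fin 3), a ∈ Hm 4 → (∀ s ∈ S, MvPolynomial.eval (Pt s) a = 0) →
          MvPolynomial.eval (Pt (T i)) a = 0 → a = 0 := by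
        intro a i ha hz hy
        refine poised (e := 4) (by norm_num) ha (insert (T i) S) ?_ ?_
        · rw [Finset.card_insert_of_notMem (hTS i), show Nat.choose (4 + 2) 2 = 15 from rfl]
          omega
        · intro t ht
          rcases Finset.mem_insert.1 ht with rfl | ht
          · exact hy
          · exact hz t ht
      exact hfin (fin a1 0 ha1 z1 y1) (fin a2 1 ha2 z2 y2) (fin a3 2 ha3 z3 y3) φ
    · have hlt16 : (16 : Fin 21) ∉ S := fun hm => by
        have := hSlt _ hm
        revert this; decide
      have hne16 : ∀ i, (16 : Fin 21) ≠ T i := by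
        intro i hi
        have := hlt i
        rw [← hi] at this
        revert this; decide
      have x1 : MvPolynomial.eval (Pt 16) a1 = 0 := by
        have := e1 (Pt 16)
        rw [hv] at this
        exact (mul_eq_zero.1 this.symm).resolve_left (det3_Pt _ _ _ (hne16 1) (hne16 2) n12)
      have A1 : a1 = 0 := by
        refine poised (e := 4) (by norm_num) ha1 (insert 16 (insert (T 0) S)) ?_ ?_
        · rw [Finset.card_insert_of_notMem, Finset.card_insert_of_notMem (hTS 0),
            show Nat.choose (4 + 2) 2 = 15 from rfl]
          · omega
          · rw [Finset.mem_insert]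
            rintro (h | h)
            · exact hne16 0 h
            · exact hlt16 h
        · intro t ht
          rcases Finset.mem_insert.1 ht with rfl | ht
          · exact x1
          rcases Finset.mem_insert.1 ht with rfl | ht
          · exact y1
          · exact z1 t ht
      have h23 : a2 = - a3 := by
        rw [A1] at hsum; linear_combination hsum
      have A2 : a2 = 0 := by
        refine poised (e := 4) (by norm_num) ha2 (insert (T 2) (insert (T 1) S)) ?_ ?_
        · rw [Finset.card_insert_of_notMem, Finset.card_insert_of_notMem (hTS 1),
            show Nat.choose (4 + 2) 2 = 15 from rfl]
          · omega
          · rw [Finset.mem_insert]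
            rintro (h | h)
            · exact n12 h.symm
            · exact hTS 2 h
        · intro t ht
          rcases Finset.mem_insert.1 ht with rfl | ht
          · rw [h23, map_neg, y3, neg_zero]
          rcases Finset.mem_insert.1 ht with rfl | ht
          · exact y2
          · exact z2 t ht
      have A3 : a3 = 0 := by
        rw [A2] at h23; exact neg_eq_zero.1 h23.symm
      exact hfin A1 A2 A3 φ
  have stepA : ∀ T : Fin 3 → Fin 21, (∀ i, (T i).val < 16) →
      ∀ φ, f (Matrix.vecCons φ (fun i => evP (T i))) = 0 := by
    intro T hT φ
    rw [← AlternatingMap.curryLeft_apply_apply]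
    refine base_of_sorted (by norm_num : 16 ≤ 21) (f.curryLeft φ) ?_ T hT
    intro T
    rw [AlternatingMap.curryLeft_apply_apply]
    refine triple (fun i => c16 (T i)) ((Fin.castLE_injective _).comp T.injective) ?_
      (Or.inr ⟨fun k => (T k).2, h3 T⟩) φ
    intro s hs
    rw [← evP_cons s (fun i => c16 (T i))]
    apply base
    intro i
    refine Fin.cases ?_ (fun j => ?_) i
    · simpa using hs
    · simp
  apply out_induct 16 f base
  intro T hinj hz φ
  by_cases hall : ∀ i, (T i).val < 16
  · exact stepA T hall φ
  · push Not at hall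
    exact triple T hinj hz (Or.inl hall) φ

end

set_option linter.unusedSectionVars false

noncomputable section

/-- coefficientwise pairing of a functional with a tuple of quintics -/
def Lq (a : Fin 6 → PolyC 3) : (QI → ℂ) →ₗ[ℂ] (Fin 6 → PolyC 3) where
  toFun φ j := MvPolynomial.C (∑ i, φ i * (a j).coeff i.1)
  map_add' φ ψ := by
    funext j
    simp only [Pi.add_apply, add_mul, Finset.sum_add_distrib, map_add]
  map_smul' c φ := by
    funext j
    simp only [Pi.smul_apply, smul_eq_mul, mul_assoc, ← Finset.mul_sum, map_mul,
      RingHom.id_apply, MvPolynomial.smul_eq_C_mul]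

theorem quintic_sum {P : PolyC 3} (hP : P ∈ Hm 5) :
    P = ∑ i : QI, XM i * MvPolynomial.C (P.coeff i.1) := by
  ext m
  rw [MvPolynomial.coeff_sum]
  simp only [XM, mul_comm _ (MvPolynomial.C _), MvPolynomial.coeff_C_mul,
    MvPolynomial.coeff_monomial]
  by_cases hm : m.degree = 5
  · rw [Finset.sum_eq_single (⟨m, hm⟩ : QI)]
    · simp
    · intro j _ hj
      rw [if_neg (fun h => hj (Subtype.ext h)), mul_zero]
    · simp
  · rw [Hm_coeff hP m hm, Finset.sum_eq_zero]
    intro j _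
    rw [if_neg (fun h : j.1 = m => hm (h ▸ j.2)), mul_zero]

theorem Lq_sum (a : Fin 6 → PolyC 3) (ha : ∀ j, a j ∈ Hm 5) :
    ∑ i, XM i • Lq a (ebas i) = a := by
  funext j
  rw [Finset.sum_apply]
  conv_rhs => rw [quintic_sum (ha j)]
  refine Finset.sum_congr rfl fun i _ => ?_
  simp [Lq, ebas, Pi.single_apply]

theorem Lq_ev (a : Fin 6 → PolyC 3) (ha : ∀ j, a j ∈ Hm 5) (P : Fin 3 → ℂ) (j : Fin 6) :
    Lq a (ev P) j = MvPolynomial.C (MvPolynomial.eval P (a j)) := by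
  change MvPolynomial.C _ = _
  congr 1
  conv_rhs => rw [quintic_sum (ha j)]
  simp [ev]

/-- pull back of an alternating form along `Lq a` -/
def DF {p : ℕ} (A : (Fin 6 → PolyC 3) [⋀^Fin p]→ₗ[PolyC 3] PolyC 3) (a : Fin 6 → PolyC 3) :
    AA p :=
  { (A.toMultilinearMap.restrictScalars ℂ).compLinearMap (fun _ => Lq a) with
    map_eq_zero_of_eq' := by
      intro v i j hv hij
      exact A.map_eq_zero_of_eq (fun i => Lq a (v i)) (congrArg (Lq a) hv) hij }

theorem DF_apply {p : ℕ} (A : (Fin 6 → PolyC 3) [⋀^Fin p]→ₗ[PolyC 3] PolyC 3)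
    (a : Fin 6 → PolyC 3) (v : Fin p → (QI → ℂ)) : DF A a v = A (fun i => Lq a (v i)) := rfl

theorem DF_dK {p : ℕ} (A : (Fin 6 → PolyC 3) [⋀^Fin (p + 1)]→ₗ[PolyC 3] PolyC 3)
    (a : Fin 6 → PolyC 3) (ha : ∀ j, a j ∈ Hm 5)
    (h : ∀ w, A (Matrix.vecCons a w) = 0) : dK XM (DF A a) = 0 := by
  ext1 v
  rw [dK_apply, AlternatingMap.zero_apply, ← h (fun i => Lq a (v i))]
  have key : ∀ i : QI, XM i * DF A a (Matrix.vecCons (ebas i) v) =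
      (A.curryLeft (XM i • Lq a (ebas i))) (fun i => Lq a (v i)) := by
    intro i
    rw [map_smul, AlternatingMap.smul_apply, AlternatingMap.curryLeft_apply_apply, smul_eq_mul,
      DF_apply]
    congr 2
    funext k
    refine Fin.cases ?_ (fun j => ?_) k <;> simp
  rw [Finset.sum_congr rfl fun i _ => key i, ← AlternatingMap.curryLeft_apply_apply]
  have hs : A.curryLeft a = ∑ i, A.curryLeft (XM i • Lq a (ebas i)) := by
    rw [← map_sum, Lq_sum a ha]
  rw [hs]
  generalize (Finset.univ : Finset QI) = s
  induction s using Finset.induction_on with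
  | empty => simp
  | insert a s ha ih => rw [Finset.sum_insert ha, Finset.sum_insert ha, AlternatingMap.add_apply, ih]

theorem det_Hm (M : Matrix (Fin 6) (Fin 6) (PolyC 3)) (d : Fin 6 → ℕ)
    (h : ∀ i j, M i j ∈ Hm (d i)) : M.det ∈ Hm (∑ i, d i) := by
  rw [Matrix.det_apply]
  refine Submodule.sum_mem _ fun σ _ => ?_
  have h1 : ∏ i, M (σ i) i ∈ Hm (∑ i, d i) := by
    rw [← Equiv.sum_comp σ d]
    exact MvPolynomial.IsHomogeneous.prod _ _ _ fun i _ => h (σ i) i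
  rcases Int.units_eq_one_or (Equiv.Perm.sign σ) with hs | hs
  · rw [hs, one_smul]; exact h1
  · rw [hs, Units.neg_smul, one_smul]; exact Submodule.neg_mem _ h1

/-- the form for five arguments -/
def DF5 (w a : Fin 6 → PolyC 3) : AA 5 :=
  DF ((Matrix.detRowAlternating (R := PolyC 3) (n := Fin 6)).curryLeft w) a

/-- the form for four arguments -/
def DF4 (w w' a : Fin 6 → PolyC 3) : AA 4 :=
  DF (((Matrix.detRowAlternating (R := PolyC 3) (n := Fin 6)).curryLeft w).curryLeft w') a

theorem detRow_eq {R : Type} [CommRing R] {n : ℕ} (M : Fin n → Fin n → R) :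
    (Matrix.detRowAlternating (R := R) (n := Fin n)) M = (Matrix.of M).det := rfl

theorem DF5_apply (w a : Fin 6 → PolyC 3) (v : Fin 5 → (QI → ℂ)) :
    DF5 w a v = Matrix.det (Matrix.of (Matrix.vecCons w (fun i => Lq a (v i)))) := by
  rw [DF5, DF_apply, AlternatingMap.curryLeft_apply_apply, detRow_eq]

theorem DF4_apply (w w' a : Fin 6 → PolyC 3) (v : Fin 4 → (QI → ℂ)) :
    DF4 w w' a v =
      Matrix.det (Matrix.of (Matrix.vecCons w (Matrix.vecCons w' (fun i => Lq a (v i))))) := by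
  rw [DF4, DF_apply, AlternatingMap.curryLeft_apply_apply, AlternatingMap.curryLeft_apply_apply,
    detRow_eq]

theorem DF5_mem (w a : Fin 6 → PolyC 3) (g : PolyC 3) (hg : g ∈ Hm 3) (hw : ∀ j, w j ∈ Hm 2)
    (ha : a = g • w) : DF5 w a ∈ Zc 4 := by
  have ha5 : ∀ j, a j ∈ Hm 5 := by
    intro j
    rw [ha]
    exact mul_mem_Hm hg (hw j)
  refine ⟨fun v => ?_, ?_⟩
  · rw [DF5_apply]
    refine (det_Hm _ ![2, 0, 0, 0, 0, 0] ?_ : _ ∈ Hm 2)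
    intro i j
    refine Fin.cases ?_ (fun i => ?_) i
    · exact hw j
    · have : (![2, 0, 0, 0, 0, 0] : Fin 6 → ℕ) i.succ = 0 := by fin_cases i <;> rfl
      rw [this]
      exact MvPolynomial.isHomogeneous_C _ _
  · refine DF_dK _ a ha5 fun v => ?_
    rw [← AlternatingMap.curryLeft_apply_apply, ha, map_smul, AlternatingMap.curryLeft_same,
      smul_zero, AlternatingMap.zero_apply]

theorem DF4_mem (w w' a : Fin 6 → PolyC 3) (g h : PolyC 3) (hg : g ∈ Hm 4) (hh : h ∈ Hm 4)
    (hw : ∀ j, w j ∈ Hm 1) (hw' : ∀ j, w' j ∈ Hm 1)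
    (ha : a = g • w + h • w') : DF4 w w' a ∈ Zc 3 := by
  have ha5 : ∀ j, a j ∈ Hm 5 := by
    intro j
    rw [ha]
    exact Submodule.add_mem _ (mul_mem_Hm hg (hw j)) (mul_mem_Hm hh (hw' j))
  refine ⟨fun v => ?_, ?_⟩
  · rw [DF4_apply]
    refine (det_Hm _ ![1, 1, 0, 0, 0, 0] ?_ : _ ∈ Hm 2)
    intro i j
    refine Fin.cases ?_ (fun i => Fin.cases ?_ (fun i => ?_) i) i
    · exact hw j
    · exact hw' j
    · have : (![1, 1, 0, 0, 0, 0] : Fin 6 → ℕ) i.succ.succ = 0 := by fin_cases i <;> rfl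
      rw [this]
      exact MvPolynomial.isHomogeneous_C _ _
  · refine DF_dK _ a ha5 fun v => ?_
    rw [← AlternatingMap.curryLeft_apply_apply, ha, map_add, map_smul, map_smul,
      AlternatingMap.curryLeft_same, smul_zero, add_zero, AlternatingMap.smul_apply,
      AlternatingMap.curryLeft_apply_apply, AlternatingMap.curryLeft_apply_apply,
      AlternatingMap.curryLeft_apply_apply,
      AlternatingMap.map_eq_zero_of_eq _ _ (i := 0) (j := 2) rfl (by decide), smul_zero]

theorem DF5_eval (w a : Fin 6 → PolyC 3) (ha : ∀ j, a j ∈ Hm 5) (Q : Fin 3 → ℂ)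
    (P : Fin 5 → (Fin 3 → ℂ)) :
    MvPolynomial.eval Q (DF5 w a (fun i => ev (P i))) =
      Matrix.det (Matrix.of (Matrix.vecCons (fun j => MvPolynomial.eval Q (w j))
        (fun i j => MvPolynomial.eval (P i) (a j)))) := by
  rw [DF5_apply, RingHom.map_det]
  congr 1
  ext i j
  refine Fin.cases ?_ (fun i => ?_) i
  · rfl
  · change MvPolynomial.eval Q (Lq a (ev (P i)) j) = _
    rw [Lq_ev a ha, MvPolynomial.eval_C]
    rfl

theorem DF4_eval (w w' a : Fin 6 → PolyC 3) (ha : ∀ j, a j ∈ Hm 5) (Q : Fin 3 → ℂ)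
    (P : Fin 4 → (Fin 3 → ℂ)) :
    MvPolynomial.eval Q (DF4 w w' a (fun i => ev (P i))) =
      Matrix.det (Matrix.of (Matrix.vecCons (fun j => MvPolynomial.eval Q (w j))
        (Matrix.vecCons (fun j => MvPolynomial.eval Q (w' j))
        (fun i j => MvPolynomial.eval (P i) (a j))))) := by
  rw [DF4_apply, RingHom.map_det]
  congr 1
  ext i j
  refine Fin.cases ?_ (fun i => Fin.cases ?_ (fun i => ?_) i) i
  · rfl
  · rfl
  · change MvPolynomial.eval Q (Lq a (ev (P i)) j) = _
    rw [Lq_ev a ha, MvPolynomial.eval_C]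
    rfl

end

set_option linter.unusedSectionVars false

noncomputable section

theorem natcard_emb (p n : ℕ) : Nat.card (Fin p ↪o Fin n) = n.choose p := by
  rw [Nat.card_congr Set.powersetCard.ofFinEmbEquiv, Set.powersetCard.card, Nat.card_fin]

instance finite_emb (p n : ℕ) : Finite (Fin p ↪o Fin n) :=
  Finite.of_injective (fun T => (T : Fin p → Fin n)) DFunLike.coe_injective

theorem emb_not_sub {p n : ℕ} {T T' : Fin p ↪o Fin n} (h : T' ≠ T) : ∃ i, ∀ j, T' i ≠ T j := by
  by_contra hc
  push Not at hc
  apply h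
  have hsub : Finset.univ.image T' ⊆ Finset.univ.image T := by
    intro x hx
    obtain ⟨i, -, rfl⟩ := Finset.mem_image.1 hx
    obtain ⟨j, hj⟩ := hc i
    exact Finset.mem_image.2 ⟨j, Finset.mem_univ _, hj.symm⟩
  have heq := Finset.eq_of_subset_of_card_le hsub (by
    rw [Finset.card_image_of_injective _ T.injective, Finset.card_image_of_injective _ T'.injective])
  apply OrderEmbedding.range_inj.1
  have := congrArg (fun s : Finset (Fin n) => (s : Set (Fin n))) heq
  simpa using this

theorem tri_mem {I : Type} [Fintype I] [DecidableEq I] (W : Submodule ℂ (I → ℂ)) (y : I → ℂ)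
    (hy : y ∈ W) (i : I) (hi : y i ≠ 0) (h : ∀ j, j ≠ i → y j ≠ 0 → Pi.single j (1 : ℂ) ∈ W) :
    Pi.single i (1 : ℂ) ∈ W := by
  have h1 : y = y i • Pi.single i (1 : ℂ) + ∑ j ∈ Finset.univ.erase i, y j • Pi.single j (1 : ℂ) := by
    rw [Finset.add_sum_erase _ (fun j => y j • Pi.single j (1 : ℂ)) (Finset.mem_univ i)]
    funext k
    simp [Finset.sum_apply, Pi.single_apply]
  have h2 : y i • Pi.single i (1 : ℂ) ∈ W := by
    have h3 : y i • Pi.single i (1 : ℂ) =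
        y - ∑ j ∈ Finset.univ.erase i, y j • Pi.single j (1 : ℂ) := eq_sub_of_add_eq h1.symm
    rw [h3]
    refine Submodule.sub_mem _ hy (Submodule.sum_mem _ fun j hj => ?_)
    by_cases hz : y j = 0
    · rw [hz, zero_smul]; exact Submodule.zero_mem _
    · exact Submodule.smul_mem _ _ (h j (Finset.ne_of_mem_erase hj) hz)
  have := W.smul_mem (y i)⁻¹ h2
  rwa [smul_smul, inv_mul_cancel₀ hi, one_smul] at this

theorem top_of_single {I : Type} [Fintype I] [DecidableEq I] (W : Submodule ℂ (I → ℂ))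
    (h : ∀ i, Pi.single i (1 : ℂ) ∈ W) : W = ⊤ := by
  rw [eq_top_iff]
  intro y _
  have : y = ∑ j, y j • Pi.single j (1 : ℂ) := by
    funext k
    simp [Finset.sum_apply, Pi.single_apply]
  rw [this]
  exact Submodule.sum_mem _ fun j _ => Submodule.smul_mem _ _ (h j)

/-- numbering of conic monomials -/
def e6 : Fin 6 ≃ MIdx 2 := (Fintype.equivFinOfCardEq (card_MIdx 2)).symm

/-- conic monomials -/
def w6 (j : Fin 6) : PolyC 3 := MvPolynomial.monomial (e6 j).1 1

theorem w6_mem (j : Fin 6) : w6 j ∈ Hm 2 := MvPolynomial.isHomogeneous_monomial _ (e6 j).2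

theorem w6_comb (u : Fin 6 → ℂ) (h : ∑ j, MvPolynomial.C (u j) * w6 j = 0) : u = 0 := by
  funext k
  have := congrArg (MvPolynomial.coeff (e6 k).1) h
  rw [MvPolynomial.coeff_sum, MvPolynomial.coeff_zero] at this
  simp only [w6, MvPolynomial.coeff_C_mul, MvPolynomial.coeff_monomial] at this
  rw [Finset.sum_eq_single k] at this
  · simpa using this
  · intro j _ hj
    rw [if_neg (fun h => hj (e6.injective (Subtype.ext h))), mul_zero]
  · simp

/-- functionals on cycles, five arguments -/
def Phi5 : Zc 4 →ₗ[ℂ] ((Fin 5 ↪o Fin 14) → ℂ) where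
  toFun f T := MvPolynomial.eval (Pt 14) (f.1 (fun i => evP (Fin.castLE (by norm_num) (T i))))
  map_add' f g := by
    funext T
    simp
  map_smul' c f := by
    funext T
    simp [MvPolynomial.smul_eval]

theorem Phi5_apply (f : Zc 4) (T : Fin 5 ↪o Fin 14) : Phi5 f T =
    MvPolynomial.eval (Pt 14) (f.1 (fun i => ev (Pt (Fin.castLE (by norm_num) (T i))))) := rfl

theorem inj_of_monoid {V W : Type} [AddCommMonoid V] [Module ℂ V] [AddCommGroup W] [Module ℂ W]
    (Φ : V →ₗ[ℂ] W) (h : ∀ f, Φ f = 0 → f = 0) : Function.Injective Φ := by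
  intro a b hab
  have h0 : a + (-1 : ℂ) • b = 0 := h _ (by rw [map_add, map_smul, hab, neg_one_smul, add_neg_cancel])
  have h1 : (-1 : ℂ) • b + b = 0 := by
    conv_lhs => rw [← one_smul ℂ b]
    rw [smul_smul, ← add_smul]
    norm_num
  calc a = a + ((-1 : ℂ) • b + b) := by rw [h1, add_zero]
    _ = b := by rw [← add_assoc, h0, zero_add]

theorem Phi5_inj : Function.Injective Phi5 := by
  refine inj_of_monoid Phi5 ?_
  intro f hf
  apply Subtype.ext
  exact upper5 f.1 f.2 fun T => congrFun hf T

/-- image of an embedding in the full index set -/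
abbrev imT {p n : ℕ} (hn : n ≤ 21) (T : Fin p ↪o Fin n) : Finset (Fin 21) :=
  Finset.univ.image (fun i => Fin.castLE hn (T i))

theorem first_card14 : (firstn 14).card = 14 := by decide
theorem first_card16 : (firstn 16).card = 16 := by decide

theorem imT_card {p n : ℕ} (hn : n ≤ 21) (T : Fin p ↪o Fin n) : (imT hn T).card = p := by
  refine (Finset.card_image_of_injective _ ((Fin.castLE_injective hn).comp T.injective)).trans ?_
  rw [Finset.card_univ, Fintype.card_fin]

theorem imT_sub {p n : ℕ} (hn : n ≤ 21) (T : Fin p ↪o Fin n) : imT hn T ⊆ firstn n := by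
  intro x hx
  obtain ⟨i, -, rfl⟩ := Finset.mem_image.1 hx
  rw [Finset.mem_filter]
  exact ⟨Finset.mem_univ _, (T i).2⟩

theorem Phi5_single (T : Fin 5 ↪o Fin 14) : ∃ f : Zc 4, Phi5 f T ≠ 0 ∧ ∀ T', T' ≠ T → Phi5 f T' = 0 := by
  obtain ⟨g, hg, hz, hn⟩ := exists_form' 3 (by norm_num) (firstn 14 \ imT (by norm_num) T) (by
    rw [Finset.card_sdiff_of_subset (imT_sub _ T), first_card14, imT_card]; rfl)
  have hw5 : ∀ j, (g • w6) j ∈ Hm 5 := fun j => mul_mem_Hm hg (w6_mem j)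
  refine ⟨⟨DF5 w6 (g • w6), DF5_mem _ _ g hg w6_mem rfl⟩, ?_, ?_⟩
  · rw [Phi5_apply, DF5_eval w6 _ hw5]
    intro hdet
    obtain ⟨u, hu, hMu⟩ := Matrix.exists_mulVec_eq_zero_iff.2 hdet
    apply hu
    apply w6_comb
    have hnot : (14 : Fin 21) ∉ imT (by norm_num) T := fun hm => by
      have := (Finset.mem_filter.1 (imT_sub _ T hm)).2
      revert this; decide
    refine poised (e := 2) (by norm_num) (Submodule.sum_mem _ fun j _ => C_mul_mem _ (w6_mem j))
      (insert 14 (imT (by norm_num) T)) ?_ ?_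
    · rw [Finset.card_insert_of_notMem hnot, imT_card]; decide
    · intro t ht
      rcases Finset.mem_insert.1 ht with rfl | ht
      · have h0 := congrFun hMu 0
        simp only [Matrix.mulVec, dotProduct, Matrix.of_apply, Matrix.cons_val_zero,
          Pi.zero_apply] at h0
        rw [map_sum, ← h0]
        refine Finset.sum_congr rfl fun j _ => ?_
        rw [map_mul, MvPolynomial.eval_C, mul_comm]
      · obtain ⟨i, -, rfl⟩ := Finset.mem_image.1 ht
        have h0 := congrFun hMu i.succ
        simp only [Matrix.mulVec, dotProduct, Matrix.of_apply, Matrix.cons_val_succ,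
          Pi.zero_apply, Pi.smul_apply, smul_eq_mul, map_mul, mul_assoc, ← Finset.mul_sum] at h0
        have hgi := hn _ (fun hm => (Finset.mem_sdiff.1 hm).2 ht)
        rw [map_sum, ← (mul_eq_zero.1 h0).resolve_left hgi]
        refine Finset.sum_congr rfl fun j _ => ?_
        rw [map_mul, MvPolynomial.eval_C, mul_comm]
  · intro T' hT'
    obtain ⟨i, hi⟩ := emb_not_sub hT'
    rw [Phi5_apply, DF5_eval w6 _ hw5]
    apply Matrix.det_eq_zero_of_row_eq_zero i.succ
    intro j
    rw [Matrix.of_apply, Matrix.cons_val_succ, Pi.smul_apply, smul_eq_mul, map_mul, hz, zero_mul]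
    rw [Finset.mem_sdiff, Finset.mem_filter]
    refine ⟨⟨Finset.mem_univ _, (T' i).2⟩, fun hm => ?_⟩
    obtain ⟨k, -, hk⟩ := Finset.mem_image.1 hm
    exact hi k (Fin.castLE_injective _ hk).symm

theorem finrank_of_inj_single {V I : Type} [AddCommMonoid V] [Module ℂ V] [Finite I]
    (Φ : V →ₗ[ℂ] (I → ℂ)) (hi : Function.Injective Φ) (hs : LinearMap.range Φ = ⊤) :
    Module.finrank ℂ V = Nat.card I := by
  have := Fintype.ofFinite I
  rw [(LinearEquiv.ofBijective Φ ⟨hi, LinearMap.range_eq_top.1 hs⟩).finrank_eq,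
    Module.finrank_fintype_fun_eq_card, Nat.card_eq_fintype_card]

theorem finrank_Zc4 : Module.finrank ℂ (Zc 4) = 2002 := by
  classical
  have := Fintype.ofFinite (Fin 5 ↪o Fin 14)
  refine (finrank_of_inj_single Phi5 Phi5_inj ?_).trans (natcard_emb 5 14)
  · apply top_of_single
    intro T
    obtain ⟨f, h1, h2⟩ := Phi5_single T
    exact tri_mem (LinearMap.range Phi5) (Phi5 f) (LinearMap.mem_range_self _ _) T h1 fun j hj hne => absurd (h2 j hj) hne

end

set_option linter.unusedSectionVars false

noncomputable section

/-- pairing -/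
def dt (u P : Fin 3 → ℂ) : ℂ := u 0 * P 0 + u 1 * P 1 + u 2 * P 2

theorem dt_add (u P Q : Fin 3 → ℂ) : dt u (P + Q) = dt u P + dt u Q := by
  simp only [dt, Pi.add_apply]; ring

theorem dt_zero (u P Q R : Fin 3 → ℂ) (h : det3 P Q R ≠ 0) (h1 : dt u P = 0) (h2 : dt u Q = 0)
    (h3 : dt u R = 0) : u = 0 := by
  simp only [dt] at h1 h2 h3
  funext k
  apply (mul_eq_zero.1 (_ : det3 P Q R * u k = 0)).resolve_left h
  simp only [det3]
  fin_cases k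
  · simp only [Fin.zero_eta]
    linear_combination (Q 1 * R 2 - Q 2 * R 1) * h1 + (R 1 * P 2 - R 2 * P 1) * h2 +
      (P 1 * Q 2 - P 2 * Q 1) * h3
  · simp only [Fin.mk_one]
    linear_combination (Q 2 * R 0 - Q 0 * R 2) * h1 + (R 2 * P 0 - R 0 * P 2) * h2 +
      (P 2 * Q 0 - P 0 * Q 2) * h3
  · simp only [Fin.reduceFinMk]
    linear_combination (Q 0 * R 1 - Q 1 * R 0) * h1 + (R 0 * P 1 - R 1 * P 0) * h2 +
      (P 0 * Q 1 - P 1 * Q 0) * h3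

/-- first block of variables -/
def wa : Fin 6 → PolyC 3 := ![xv 0, xv 1, xv 2, 0, 0, 0]
/-- second block of variables -/
def wb : Fin 6 → PolyC 3 := ![0, 0, 0, xv 0, xv 1, xv 2]

theorem wa_mem (j : Fin 6) : wa j ∈ Hm 1 := by
  fin_cases j
  · exact xv_mem 0
  · exact xv_mem 1
  · exact xv_mem 2
  all_goals exact Submodule.zero_mem _

theorem wb_mem (j : Fin 6) : wb j ∈ Hm 1 := by
  fin_cases j
  · exact Submodule.zero_mem _
  · exact Submodule.zero_mem _
  · exact Submodule.zero_mem _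
  · exact xv_mem 0
  · exact xv_mem 1
  · exact xv_mem 2

/-- cycles from pairs of quartics -/
def G4 (g h : PolyC 3) : AA 4 := DF4 wa wb (g • wa + h • wb)

theorem G4_mem {g h : PolyC 3} (hg : g ∈ Hm 4) (hh : h ∈ Hm 4) : G4 g h ∈ Zc 3 :=
  DF4_mem wa wb _ g h hg hh wa_mem wb_mem rfl

/-- the evaluation matrix -/
def M4 (g h : PolyC 3) (Q : Fin 3 → ℂ) (P : Fin 4 → (Fin 3 → ℂ)) : Matrix (Fin 6) (Fin 6) ℂ :=
  Matrix.of (Matrix.vecCons (fun j => MvPolynomial.eval Q (wa j))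
        (Matrix.vecCons (fun j => MvPolynomial.eval Q (wb j))
        (fun i j => MvPolynomial.eval (P i) ((g • wa + h • wb) j))))

theorem G4_eval {g h : PolyC 3} (hg : g ∈ Hm 4) (hh : h ∈ Hm 4) (Q : Fin 3 → ℂ)
    (P : Fin 4 → (Fin 3 → ℂ)) :
    MvPolynomial.eval Q (G4 g h (fun i => ev (P i))) = (M4 g h Q P).det := by
  have ha : ∀ j, (g • wa + h • wb) j ∈ Hm 5 := fun j =>
    Submodule.add_mem _ (mul_mem_Hm hg (wa_mem j)) (mul_mem_Hm hh (wb_mem j))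
  rw [G4, DF4_eval wa wb _ ha, M4]

theorem M4_zero_row {g h : PolyC 3} (Q : Fin 3 → ℂ) (P : Fin 4 → (Fin 3 → ℂ)) (i : Fin 4)
    (h1 : MvPolynomial.eval (P i) g = 0) (h2 : MvPolynomial.eval (P i) h = 0) :
    (M4 g h Q P).det = 0 := by
  apply Matrix.det_eq_zero_of_row_eq_zero i.succ.succ
  intro j
  change MvPolynomial.eval (P i) ((g • wa + h • wb) j) = 0
  simp [h1, h2]

theorem M4_mulVec {g h : PolyC 3} (Q : Fin 3 → ℂ) (P : Fin 4 → (Fin 3 → ℂ)) (u : Fin 6 → ℂ) :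
    (M4 g h Q P).mulVec u = Matrix.vecCons (dt ![u 0, u 1, u 2] Q)
      (Matrix.vecCons (dt ![u 3, u 4, u 5] Q)
      (fun i => MvPolynomial.eval (P i) g * dt ![u 0, u 1, u 2] (P i) +
        MvPolynomial.eval (P i) h * dt ![u 3, u 4, u 5] (P i))) := by
  funext i
  refine Fin.cases ?_ (fun i => Fin.cases ?_ (fun i => ?_) i) i
  · simp [Matrix.mulVec, dotProduct, M4, Fin.sum_univ_six, wa, dt]; ring
  · simp [Matrix.mulVec, dotProduct, M4, Fin.sum_univ_six, wb, dt]; ring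
  · simp [Matrix.mulVec, dotProduct, M4, Fin.sum_univ_six, wa, wb, dt]; ring

theorem M4_ne {g h : PolyC 3} (Q : Fin 3 → ℂ) (P : Fin 4 → (Fin 3 → ℂ))
    (H : ∀ u u' : Fin 3 → ℂ, dt u Q = 0 → dt u' Q = 0 →
      (∀ i, MvPolynomial.eval (P i) g * dt u (P i) + MvPolynomial.eval (P i) h * dt u' (P i) = 0) →
      u = 0 ∧ u' = 0) : (M4 g h Q P).det ≠ 0 := by
  intro hdet
  obtain ⟨u, hu, hMu⟩ := Matrix.exists_mulVec_eq_zero_iff.2 hdet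
  apply hu
  rw [M4_mulVec] at hMu
  obtain ⟨h1, h2⟩ := H _ _ (congrFun hMu 0) (congrFun hMu 1) (fun i => congrFun hMu i.succ.succ)
  funext j
  fin_cases j
  · exact congrFun h1 0
  · exact congrFun h1 1
  · exact congrFun h1 2
  · exact congrFun h2 0
  · exact congrFun h2 1
  · exact congrFun h2 2

theorem M4_eq_zero {g h : PolyC 3} (Q : Fin 3 → ℂ) (P : Fin 4 → (Fin 3 → ℂ))
    (u : Fin 3 → ℂ) (hu : u ≠ 0) (h1 : dt u Q = 0)
    (h2 : ∀ i, MvPolynomial.eval (P i) g * dt u (P i) = 0) : (M4 g h Q P).det = 0 := by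
  apply Matrix.exists_mulVec_eq_zero_iff.1
  refine ⟨![u 0, u 1, u 2, 0, 0, 0], ?_, ?_⟩
  · intro h0
    apply hu
    funext k
    fin_cases k
    · exact congrFun h0 0
    · exact congrFun h0 1
    · exact congrFun h0 2
  · rw [M4_mulVec]
    have e1 : dt ![u 0, u 1, u 2] = dt u := by funext P; simp [dt]
    have e2 : ∀ P, dt ![(0 : ℂ), 0, 0] P = 0 := by intro P; simp [dt]
    funext i
    refine Fin.cases ?_ (fun i => Fin.cases ?_ (fun i => ?_) i) i
    · exact (congrFun e1 Q).trans h1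
    · exact e2 Q
    · have := h2 i
      rw [← e1] at this
      change _ * dt ![u 0, u 1, u 2] (P i) + _ * dt ![(0 : ℂ), 0, 0] (P i) = 0
      rw [this, e2, mul_zero, add_zero]

theorem quart (x y : Fin 16) (hxy : x ≠ y) : ∃ g ∈ Hm 4,
    (∀ t : Fin 16, t ≠ x → t ≠ y → MvPolynomial.eval (Pt (c16 t)) g = 0) ∧
    MvPolynomial.eval (Pt (c16 x)) g ≠ 0 ∧ MvPolynomial.eval (Pt (c16 y)) g ≠ 0 ∧
    MvPolynomial.eval (Pt 16) g ≠ 0 := by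
  have hi : Function.Injective c16 := Fin.castLE_injective _
  have hlt : ∀ t, c16 t ∈ firstn 16 := fun t => Finset.mem_filter.2 ⟨Finset.mem_univ _, t.2⟩
  obtain ⟨g, hg, hz, hn⟩ := exists_form' 4 (by norm_num) (firstn 16 \ {c16 x, c16 y}) (by
    rw [Finset.card_sdiff_of_subset, first_card16, Finset.card_pair (hi.ne hxy)]
    · rfl
    · intro t ht
      rcases Finset.mem_insert.1 ht with rfl | ht
      · exact hlt x
      · rw [Finset.mem_singleton.1 ht]; exact hlt y)
  refine ⟨g, hg, ?_, hn _ ?_, hn _ ?_, hn _ ?_⟩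
  · intro t h1 h2
    apply hz
    rw [Finset.mem_sdiff, Finset.mem_insert, Finset.mem_singleton]
    exact ⟨hlt t, fun h => h.elim (fun h => h1 (hi h)) (fun h => h2 (hi h))⟩
  · simp
  · simp
  · intro hm
    have := (Finset.mem_filter.1 (Finset.mem_sdiff.1 hm).1).2
    revert this; decide

theorem exists_f4 (T : Fin 4 ↪o Fin 16) (α β γ δ : Fin 4) (hall : ∀ i, i = α ∨ i = β ∨ i = γ ∨ i = δ)
    (hαβ : α ≠ β) (hαγ : α ≠ γ) (hαδ : α ≠ δ) (hβγ : β ≠ γ) (hβδ : β ≠ δ) (hγδ : γ ≠ δ) :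
    ∃ f ∈ Zc 3,
      MvPolynomial.eval (Pt (c16 (T α)) + Pt (c16 (T γ))) (f (fun i => ev (Pt (c16 (T i))))) ≠ 0 ∧
      MvPolynomial.eval (Pt (c16 (T α)) + Pt (c16 (T β))) (f (fun i => ev (Pt (c16 (T i))))) = 0 ∧
      ∀ T' : Fin 4 ↪o Fin 16, T' ≠ T → ∀ Q,
        MvPolynomial.eval Q (f (fun i => ev (Pt (c16 (T' i))))) = 0 := by
  obtain ⟨g, hg, gz, g1, g2, -⟩ := quart (T α) (T β) (T.injective.ne hαβ)
  obtain ⟨h, hh, hz, h1, h2, -⟩ := quart (T γ) (T δ) (T.injective.ne hγδ)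
  have hi : Function.Injective c16 := Fin.castLE_injective _
  have hd : ∀ i j k : Fin 4, i ≠ j → i ≠ k → j ≠ k →
        det3 (Pt (c16 (T i))) (Pt (c16 (T j))) (Pt (c16 (T k))) ≠ 0 :=
      fun i j k hij hik hjk => det3_Pt _ _ _ (hi.ne (T.injective.ne hij))
        (hi.ne (T.injective.ne hik)) (hi.ne (T.injective.ne hjk))
  have gγ := gz (T γ) (T.injective.ne hαγ.symm) (T.injective.ne hβγ.symm)
  have gδ := gz (T δ) (T.injective.ne hαδ.symm) (T.injective.ne hβδ.symm)
  have hα := hz (T α) (T.injective.ne hαγ) (T.injective.ne hαδ)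
  have hβ := hz (T β) (T.injective.ne hβγ) (T.injective.ne hβδ)
  refine ⟨G4 g h, G4_mem hg hh, ?_, ?_, ?_⟩
  · rw [G4_eval hg hh]
    apply M4_ne
    intro u u' hu hu' H
    rw [dt_add] at hu hu'
    have Hα := H α
    have Hβ := H β
    have Hγ := H γ
    have Hδ := H δ
    rw [hα, zero_mul, add_zero] at Hα
    rw [hβ, zero_mul, add_zero] at Hβ
    rw [gγ, zero_mul, zero_add] at Hγ
    rw [gδ, zero_mul, zero_add] at Hδ
    have Hα := (mul_eq_zero.1 Hα).resolve_left g1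
    have Hβ := (mul_eq_zero.1 Hβ).resolve_left g2
    have Hγ := (mul_eq_zero.1 Hγ).resolve_left h1
    have Hδ := (mul_eq_zero.1 Hδ).resolve_left h2
    rw [Hα, zero_add] at hu
    rw [Hγ, add_zero] at hu'
    exact ⟨dt_zero u _ _ _ (hd α β γ hαβ hαγ hβγ) Hα Hβ hu,
      dt_zero u' _ _ _ (hd α γ δ hαγ hαδ hγδ) hu' Hγ Hδ⟩
  · rw [G4_eval hg hh]
    set A := Pt (c16 (T α))
    set B := Pt (c16 (T β))
    have hA : dt ![A 1 * B 2 - A 2 * B 1, A 2 * B 0 - A 0 * B 2, A 0 * B 1 - A 1 * B 0] A = 0 := by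
      simp [dt]; ring
    have hB : dt ![A 1 * B 2 - A 2 * B 1, A 2 * B 0 - A 0 * B 2, A 0 * B 1 - A 1 * B 0] B = 0 := by
      simp [dt]; ring
    refine M4_eq_zero _ _ ![A 1 * B 2 - A 2 * B 1, A 2 * B 0 - A 0 * B 2, A 0 * B 1 - A 1 * B 0]
      ?_ ?_ ?_
    · intro h0
      apply hd γ α β hαγ.symm hβγ.symm hαβ
      have e0 : A 1 * B 2 - A 2 * B 1 = 0 := congrFun h0 0
      have e1 : A 2 * B 0 - A 0 * B 2 = 0 := congrFun h0 1
      have e2 : A 0 * B 1 - A 1 * B 0 = 0 := congrFun h0 2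
      change _ * (A 1 * B 2 - A 2 * B 1) + _ * (A 2 * B 0 - A 0 * B 2) +
        _ * (A 0 * B 1 - A 1 * B 0) = 0
      rw [e0, e1, e2]; ring
    · rw [dt_add, hA, hB, add_zero]
    · intro i
      rcases hall i with rfl | rfl | rfl | rfl
      · rw [hA, mul_zero]
      · rw [hB, mul_zero]
      · rw [gγ, zero_mul]
      · rw [gδ, zero_mul]
  · intro T' hT' Q
    obtain ⟨i, hi'⟩ := emb_not_sub hT'
    rw [G4_eval hg hh]
    exact M4_zero_row _ _ i (gz _ (hi' _) (hi' _)) (hz _ (hi' _) (hi' _))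

theorem vec4 (T : Fin 3 ↪o Fin 16) :
    ![evP 16, evP (c16 (T 0)), evP (c16 (T 1)), evP (c16 (T 2))] =
      fun i => ev ((Matrix.vecCons (Pt 16) (fun i => Pt (c16 (T i))) : Fin 4 → (Fin 3 → ℂ)) i) := by
  funext i
  fin_cases i <;> rfl

theorem exists_f3 (T : Fin 3 ↪o Fin 16) :
    ∃ f ∈ Zc 3,
      MvPolynomial.eval (Pt (c16 (T 1)) + Pt (c16 (T 2)))
        (f ![evP 16, evP (c16 (T 0)), evP (c16 (T 1)), evP (c16 (T 2))]) ≠ 0 ∧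
      (∀ T' : Fin 3 ↪o Fin 16, T' ≠ T → ∀ Q, MvPolynomial.eval Q
        (f ![evP 16, evP (c16 (T' 0)), evP (c16 (T' 1)), evP (c16 (T' 2))]) = 0) ∧
      ∀ T' : Fin 4 ↪o Fin 16, ∀ Q, MvPolynomial.eval Q (f (fun i => ev (Pt (c16 (T' i))))) = 0 := by
  have n01 : T 0 ≠ T 1 := T.injective.ne (by decide)
  have n02 : T 0 ≠ T 2 := T.injective.ne (by decide)
  have n12 : T 1 ≠ T 2 := T.injective.ne (by decide)
  obtain ⟨g, hg, gz, g1, g2, g16⟩ := quart (T 0) (T 1) n01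
  obtain ⟨h, hh, hz, h1, h2, h16⟩ := quart (T 1) (T 2) n12
  have hi : Function.Injective c16 := Fin.castLE_injective _
  have h0 := hz (T 0) n01 n02
  have g2' := gz (T 2) n02.symm n12.symm
  have ne16 : ∀ t : Fin 16, (16 : Fin 21) ≠ c16 t := by
    intro t ht
    have := t.2
    have h3 := congrArg Fin.val ht
    simp at h3
    omega
  refine ⟨G4 g h, G4_mem hg hh, ?_, ?_, ?_⟩
  · rw [vec4, G4_eval hg hh]
    apply M4_ne
    intro u u' hu hu' H
    rw [dt_add] at hu hu'
    have H3 : MvPolynomial.eval (Pt 16) g * dt u (Pt 16) +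
      MvPolynomial.eval (Pt 16) h * dt u' (Pt 16) = 0 := H 0
    have H0 : MvPolynomial.eval (Pt (c16 (T 0))) g * dt u (Pt (c16 (T 0))) +
      MvPolynomial.eval (Pt (c16 (T 0))) h * dt u' (Pt (c16 (T 0))) = 0 := H 1
    have H1 : MvPolynomial.eval (Pt (c16 (T 1))) g * dt u (Pt (c16 (T 1))) +
      MvPolynomial.eval (Pt (c16 (T 1))) h * dt u' (Pt (c16 (T 1))) = 0 := H 2
    have H2 : MvPolynomial.eval (Pt (c16 (T 2))) g * dt u (Pt (c16 (T 2))) +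
      MvPolynomial.eval (Pt (c16 (T 2))) h * dt u' (Pt (c16 (T 2))) = 0 := H 3
    rw [h0, zero_mul, add_zero] at H0
    rw [g2', zero_mul, zero_add] at H2
    have H0 := (mul_eq_zero.1 H0).resolve_left g1
    have H2 := (mul_eq_zero.1 H2).resolve_left h2
    rw [H2, add_zero] at hu'
    rw [hu', mul_zero, add_zero] at H1
    have H1 := (mul_eq_zero.1 H1).resolve_left g2
    rw [H1, zero_add] at hu
    have hu0 : u = 0 := dt_zero u _ _ _ (det3_Pt _ _ _ (hi.ne n01) (hi.ne n02) (hi.ne n12)) H0 H1 hu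
    refine ⟨hu0, ?_⟩
    have : dt u (Pt 16) = 0 := by rw [hu0]; simp [dt]
    rw [this, mul_zero, zero_add] at H3
    exact dt_zero u' _ _ _ (det3_Pt _ _ _ (ne16 _) (ne16 _) (hi.ne n12))
      ((mul_eq_zero.1 H3).resolve_left h16) hu' H2
  · intro T' hT' Q
    obtain ⟨i, hi'⟩ := emb_not_sub hT'
    rw [vec4, G4_eval hg hh]
    exact M4_zero_row _ _ i.succ (gz _ (hi' _) (hi' _)) (hz _ (hi' _) (hi' _))
  · intro T' Q
    have : ∃ i, ∀ j, T' i ≠ T j := by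
      by_contra hc
      push Not at hc
      have hsub : Finset.univ.image T' ⊆ Finset.univ.image T := by
        intro x hx
        obtain ⟨i, -, rfl⟩ := Finset.mem_image.1 hx
        obtain ⟨j, hj⟩ := hc i
        exact Finset.mem_image.2 ⟨j, Finset.mem_univ _, hj.symm⟩
      have := Finset.card_le_card hsub
      rw [Finset.card_image_of_injective _ T.injective,
        Finset.card_image_of_injective _ T'.injective] at this
      revert this; decide
    obtain ⟨i, hi'⟩ := this
    rw [G4_eval hg hh]
    exact M4_zero_row _ _ i (gz _ (hi' _) (hi' _)) (hz _ (hi' _) (hi' _))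

/-- index set of functionals -/
abbrev I4 : Type := (Fin 4 ↪o Fin 16) ⊕ (Fin 4 ↪o Fin 16) ⊕ (Fin 3 ↪o Fin 16)

/-- functionals -/
def lam4 (f : AA 4) : I4 → ℂ
  | Sum.inl T => MvPolynomial.eval (Pt (c16 (T 0)) + Pt (c16 (T 1)))
      (f (fun i => ev (Pt (c16 (T i)))))
  | Sum.inr (Sum.inl T) => MvPolynomial.eval (Pt (c16 (T 0)) + Pt (c16 (T 2)))
      (f (fun i => ev (Pt (c16 (T i)))))
  | Sum.inr (Sum.inr T) => MvPolynomial.eval (Pt (c16 (T 1)) + Pt (c16 (T 2)))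
      (f ![evP 16, evP (c16 (T 0)), evP (c16 (T 1)), evP (c16 (T 2))])

/-- functionals on cycles, four arguments -/
def Phi4 : Zc 3 →ₗ[ℂ] (I4 → ℂ) where
  toFun f := lam4 f.1
  map_add' f g := by
    funext T
    rcases T with T | T | T <;> simp [lam4]
  map_smul' c f := by
    funext T
    rcases T with T | T | T <;> simp [lam4, MvPolynomial.smul_eval]

theorem Phi4_inj : Function.Injective Phi4 := by
  refine inj_of_monoid Phi4 ?_
  intro f hf
  apply Subtype.ext
  exact upper4 f.1 f.2 (fun T => congrFun hf (Sum.inl T))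
    (fun T => congrFun hf (Sum.inr (Sum.inl T))) (fun T => congrFun hf (Sum.inr (Sum.inr T)))

theorem finrank_Zc3 : Module.finrank ℂ (Zc 3) = 4200 := by
  classical
  have := Fintype.ofFinite I4
  refine (finrank_of_inj_single Phi4 Phi4_inj ?_).trans ?_
  · have mem3 : ∀ T : Fin 3 ↪o Fin 16,
        Pi.single (Sum.inr (Sum.inr T) : I4) (1 : ℂ) ∈ LinearMap.range Phi4 := by
      intro T
      obtain ⟨f, hf, h1, h2, h3⟩ := exists_f3 T
      refine tri_mem (LinearMap.range Phi4) (Phi4 ⟨f, hf⟩) (LinearMap.mem_range_self _ _) _ h1 ?_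
      intro j hj hne
      exfalso
      apply hne
      rcases j with T' | T' | T'
      · exact h3 T' _
      · exact h3 T' _
      · exact h2 T' (fun h => hj (by rw [h])) _
    apply top_of_single
    rintro (T | T | T)
    · obtain ⟨f, hf, h1, h2, h3⟩ := exists_f4 T 0 2 1 3 (by decide) (by decide) (by decide)
        (by decide) (by decide) (by decide) (by decide)
      refine tri_mem (LinearMap.range Phi4) (Phi4 ⟨f, hf⟩) (LinearMap.mem_range_self _ _) _ h1 ?_
      intro j hj hne
      rcases j with T' | T' | T'
      · exact absurd (h3 T' (fun h => hj (by rw [h])) _) hne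
      · by_cases hT : T' = T
        · subst hT
          exact absurd h2 hne
        · exact absurd (h3 T' hT _) hne
      · exact mem3 T'
    · obtain ⟨f, hf, h1, h2, h3⟩ := exists_f4 T 0 1 2 3 (by decide) (by decide) (by decide)
        (by decide) (by decide) (by decide) (by decide)
      refine tri_mem (LinearMap.range Phi4) (Phi4 ⟨f, hf⟩) (LinearMap.mem_range_self _ _) _ h1 ?_
      intro j hj hne
      rcases j with T' | T' | T'
      · by_cases hT : T' = T
        · subst hT
          exact absurd h2 hne
        · exact absurd (h3 T' hT _) hne
      · exact absurd (h3 T' (fun h => hj (by rw [h])) _) hne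
      · exact mem3 T'
    · exact mem3 T
  · rw [Nat.card_sum, Nat.card_sum, natcard_emb, natcard_emb]
    decide

end

set_option linter.unusedSectionVars false

noncomputable section

section generic
variable {V W : Type*} [AddCommMonoid V] [Module ℂ V] [AddCommMonoid W] [Module ℂ W]

theorem g_rn [Module.Finite ℂ V] (f : V →ₗ[ℂ] W) :
    Module.finrank ℂ ↥(LinearMap.range f) + Module.finrank ℂ ↥(LinearMap.ker f) =
      Module.finrank ℂ V := by
  letI : AddCommGroup V := Module.addCommMonoidToAddCommGroup ℂ
  letI : AddCommGroup W := Module.addCommMonoidToAddCommGroup ℂ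
  exact LinearMap.finrank_range_add_finrank_ker f

theorem g_mono [Module.Finite ℂ V] (A B : Submodule ℂ V) (h : A ≤ B) :
    Module.finrank ℂ A ≤ Module.finrank ℂ B := by
  letI : AddCommGroup V := Module.addCommMonoidToAddCommGroup ℂ
  exact Submodule.finrank_mono h

theorem g_le [Module.Finite ℂ V] (A : Submodule ℂ V) :
    Module.finrank ℂ A ≤ Module.finrank ℂ V := by
  letI : AddCommGroup V := Module.addCommMonoidToAddCommGroup ℂ
  exact Submodule.finrank_le A

theorem g_codim [Module.Finite ℂ V] (K R : Submodule ℂ V) (φ : V →ₗ[ℂ] ℂ)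
    (h : ∀ x ∈ K, φ x = 0 → x ∈ R) : Module.finrank ℂ K ≤ Module.finrank ℂ R + 1 := by
  letI : AddCommGroup V := Module.addCommMonoidToAddCommGroup ℂ
  have h1 := LinearMap.finrank_range_add_finrank_ker (φ ∘ₗ K.subtype)
  have h2 : Module.finrank ℂ (LinearMap.range (φ ∘ₗ K.subtype)) ≤ 1 :=
    (Submodule.finrank_le _).trans (Module.finrank_self ℂ).le
  have h3 : Module.finrank ℂ (LinearMap.ker (φ ∘ₗ K.subtype)) ≤ Module.finrank ℂ R := by
    have : (LinearMap.ker (φ ∘ₗ K.subtype)).map K.subtype ≤ R := by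
      rintro _ ⟨x, hx, rfl⟩
      exact h x.1 x.2 hx
    refine le_trans (le_of_eq ?_) (Submodule.finrank_mono this)
    exact (LinearEquiv.finrank_eq
      (Submodule.equivMapOfInjective K.subtype K.injective_subtype _))
  omega

end generic

instance finiteU5p (p : ℕ) : Module.Finite ℂ ↥(⋀[ℂ]^p ↥(Sdeg 3 5)) := inferInstance

instance finiteKos (p : ℕ) (e : ℤ) : Module.Finite ℂ (KosModule 3 5 p e) := inferInstance

/-- dimension of the cycles in wedge degree `p`, polynomial degree `e` -/
def zz (D : KFam 3 5) : ℕ → ℤ → ℕ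
  | 0, e => Module.finrank ℂ (KosModule 3 5 0 e)
  | p + 1, e => Module.finrank ℂ ↥(LinearMap.ker (D p e (e + 5)))

/-- dimension of the boundaries in wedge degree `p`, polynomial degree `e` -/
def rr (D : KFam 3 5) (p : ℕ) (e : ℤ) : ℕ :=
  Module.finrank ℂ ↥(LinearMap.range (D p (e - 5) e))

theorem range_le_kerK (D : KFam 3 5) (hD : IsKoszulFam 3 5 D) (p : ℕ) (e : ℤ) :
    LinearMap.range (D (p + 1) (e - 5) e) ≤ LinearMap.ker (D p e (e + 5)) := by
  rintro _ ⟨x, rfl⟩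
  rw [LinearMap.mem_ker]
  apply Psi_injective p (e + 5)
  rw [Psi_D p e (e + 5) _ (hD p e (e + 5) rfl), Psi_D (p + 1) (e - 5) e _ (hD _ _ _ (by ring)),
    dK_neg, dK_dK, map_zero, neg_zero, neg_zero]

theorem Kdim_aux0 (D : KFam 3 5) (e e0 : ℤ) (h0 : e0 = e - 5) :
    cdim (KosModule 3 5 0 e) - cdim ↥(LinearMap.range (D 0 e0 e)) = zz D 0 e - rr D 0 e := by
  subst h0
  rfl

theorem Kdim_aux (D : KFam 3 5) (hD : IsKoszulFam 3 5 D) (p : ℕ) (e e0 e1 : ℤ)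
    (h0 : e0 = e - 5) (h1 : e1 = e + 5) :
    cdim ↥(LinearMap.ker (D p e e1)) -
      cdim ↥(LinearMap.range (D (p + 1) e0 e) ⊓ LinearMap.ker (D p e e1)) =
      zz D (p + 1) e - rr D (p + 1) e := by
  subst h0 h1
  rw [inf_eq_left.2 (range_le_kerK D hD p _)]
  rfl

theorem rr_aux (D : KFam 3 5) (p : ℕ) (e e0 : ℤ) (h0 : e0 = e - 5) :
    Module.finrank ℂ ↥(LinearMap.range (D p e0 e)) = rr D p e := by
  subst h0
  rfl

theorem Kdim_zz (D : KFam 3 5) (hD : IsKoszulFam 3 5 D) (p : ℕ) (q : ℤ) :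
    Kdim 3 5 D 2 p q = zz D p (2 + q * 5) - rr D p (2 + q * 5) := by
  have h0 : 2 + (q - 1) * 5 = 2 + q * 5 - 5 := by ring
  have h1 : 2 + (q + 1) * 5 = 2 + q * 5 + 5 := by ring
  cases p with
  | zero =>
    exact Kdim_aux0 D _ _ h0
  | succ p =>
    exact Kdim_aux D hD p _ _ _ h0 h1

theorem rr_le_zz (D : KFam 3 5) (hD : IsKoszulFam 3 5 D) (p : ℕ) (e : ℤ) :
    rr D p e ≤ zz D p e := by
  cases p with
  | zero => exact g_le _
  | succ p => exact g_mono _ _ (range_le_kerK D hD p e)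

theorem rank_null (D : KFam 3 5) (p : ℕ) (e : ℤ) :
    zz D (p + 1) e + rr D p (e + 5) = Module.finrank ℂ (KosModule 3 5 (p + 1) e) := by
  rw [← rr_aux D p (e + 5) e (by ring), add_comm]
  exact g_rn (D p e (e + 5))

theorem mem_range_of (D : KFam 3 5) (hD : IsKoszulFam 3 5 D) (p : ℕ) (e : ℤ)
    (x : KosModule 3 5 p e) (g : AA (p + 1)) (hg : ∀ v, g v ∈ Sdeg 3 (e - 5))
    (h : dK XM g = Psi p e x) : x ∈ LinearMap.range (D p (e - 5) e) := by
  obtain ⟨y, hy⟩ := Psi_surj (p + 1) (e - 5) (-g) (fun v => Submodule.neg_mem _ (hg v))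
  refine ⟨y, ?_⟩
  apply Psi_injective p e
  rw [Psi_D p (e - 5) e _ (hD _ _ _ (by ring)), hy, dK_neg, neg_neg, h]

theorem rr_eq_zz0 (D : KFam 3 5) (hD : IsKoszulFam 3 5 D) (e : ℕ) :
    rr D 0 ((e : ℤ) + 5) = zz D 0 ((e : ℤ) + 5) := by
  have : LinearMap.range (D 0 ((e : ℤ) + 5 - 5) ((e : ℤ) + 5)) = ⊤ := by
    rw [eq_top_iff]
    rintro x -
    obtain ⟨g, hg, hg'⟩ := exact_p0 e (Psi 0 ((e : ℤ) + 5) x) (by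
      intro v
      have h := Sdeg_nat (e + 5)
      push_cast at h
      exact h.le (Psi_mem 0 ((e : ℤ) + 5) x v))
    refine mem_range_of D hD 0 _ x g ?_ hg'
    intro v
    rw [show (e : ℤ) + 5 - 5 = ((e : ℕ) : ℤ) by ring, Sdeg_nat]
    exact hg v
  simp only [rr, zz]
  rw [this]
  exact finrank_top _ _

theorem mem_range_cyc (D : KFam 3 5) (hD : IsKoszulFam 3 5 D) (p e : ℕ) (E : ℤ)
    (hE : E = ((e + 5 : ℕ) : ℤ))
    (P : AA (p + 1) → Prop)
    (hex : ∀ f : AA (p + 1), (∀ v, f v ∈ Hm (e + 5)) → dK XM f = 0 → P f → ∃ g, dK XM g = f)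
    (x : KosModule 3 5 (p + 1) E) (hx : x ∈ LinearMap.ker (D p E (E + 5)))
    (hP : P (Psi (p + 1) E x)) : x ∈ LinearMap.range (D (p + 1) (E - 5) E) := by
  have hm : ∀ v, Psi (p + 1) E x v ∈ Hm (e + 5) := by
    intro v
    have h : Sdeg 3 E = Hm (e + 5) := by rw [hE, Sdeg_nat]
    exact h.le (Psi_mem (p + 1) E x v)
  have hd : dK XM (Psi (p + 1) E x) = 0 := by
    have := Psi_D p E (E + 5) _ (hD p E (E + 5) rfl) x
    rw [LinearMap.mem_ker.1 hx, map_zero] at this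
    exact neg_eq_zero.1 this.symm
  obtain ⟨g, hg⟩ := hex _ hm hd hP
  obtain ⟨g', hg1, hg2⟩ := homog_prim e _ hm g hg
  refine mem_range_of D hD (p + 1) _ x g' ?_ hg2
  intro v
  rw [show E - 5 = ((e : ℕ) : ℤ) by rw [hE]; push_cast; ring, Sdeg_nat]
  exact hg1 v

theorem rr_eq_zz (D : KFam 3 5) (hD : IsKoszulFam 3 5 D) (p e : ℕ) (E : ℤ)
    (hE : E = ((e + 5 : ℕ) : ℤ))
    (hex : ∀ f : AA (p + 1), (∀ v, f v ∈ Hm (e + 5)) → dK XM f = 0 → ∃ g, dK XM g = f) :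
    rr D (p + 1) E = zz D (p + 1) E := by
  have : LinearMap.range (D (p + 1) (E - 5) E) = LinearMap.ker (D p E (E + 5)) := by
    refine le_antisymm (range_le_kerK D hD p E) fun x hx => ?_
    exact mem_range_cyc D hD p e E hE (fun _ => True) (fun f h1 h2 _ => hex f h1 h2) x hx trivial
  simp only [rr, zz]
  rw [this]

theorem zz_le_rr18 (D : KFam 3 5) (hD : IsKoszulFam 3 5 D) : zz D 18 12 ≤ rr D 18 12 + 1 := by
  refine g_codim _ _ (lam18 ∘ₗ Psi 18 12) fun x hx hl => ?_
  exact mem_range_cyc D hD 17 7 12 (by norm_num) (fun f => lam18 f = 0)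
    (fun f h1 h2 h3 => exact_18 f h1 h2 h3) x hx hl

theorem zz_2 (D : KFam 3 5) (hD : IsKoszulFam 3 5 D) (p : ℕ) :
    zz D (p + 1) 2 = Module.finrank ℂ (Zc p) := by
  simp only [zz]
  set K := LinearMap.ker (D p 2 (2 + 5)) with hK
  have hS : Sdeg 3 2 = Hm 2 := by exact_mod_cast Sdeg_nat 2
  have hmem : ∀ x : K, Psi (p + 1) 2 x.1 ∈ Zc p := by
    intro x
    refine ⟨fun v => ?_, ?_⟩
    · rw [← hS]; exact Psi_mem (p + 1) 2 x.1 v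
    · have := Psi_D p 2 (2 + 5) _ (hD p 2 (2 + 5) rfl) x.1
      rw [LinearMap.mem_ker.1 x.2, map_zero] at this
      exact neg_eq_zero.1 this.symm
  refine LinearEquiv.finrank_eq (LinearEquiv.ofBijective
    (LinearMap.codRestrict (Zc p) ((Psi (p + 1) 2) ∘ₗ K.subtype) hmem) ⟨?_, ?_⟩)
  · intro x y hxy
    exact Subtype.ext (Psi_injective (p + 1) 2 (congrArg Subtype.val hxy))
  · rintro ⟨f, hf⟩
    obtain ⟨x, hx⟩ := Psi_surj (p + 1) 2 f (by rw [hS]; exact hf.1)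
    refine ⟨⟨x, ?_⟩, Subtype.ext hx⟩
    rw [hK, LinearMap.mem_ker]
    apply Psi_injective p (2 + 5)
    rw [Psi_D p 2 (2 + 5) _ (hD p 2 (2 + 5) rfl), hx, map_zero]
    exact neg_eq_zero.2 hf.2

theorem finrank_Kos_neg (p : ℕ) (e : ℤ) (he : e < 0) :
    Module.finrank ℂ (KosModule 3 5 p e) = 0 := by
  rw [Module.finrank_tensorProduct, Sdeg_neg e he, finrank_bot, mul_zero]

theorem zz_le (D : KFam 3 5) (p : ℕ) (e : ℤ) :
    zz D p e ≤ Module.finrank ℂ (KosModule 3 5 p e) := by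
  cases p with
  | zero => exact le_rfl
  | succ p => exact g_le _

theorem rr_neg (D : KFam 3 5) (p : ℕ) (e : ℤ) (he : e < 5) : rr D p e = 0 := by
  have h := rank_null D p (e - 5)
  rw [finrank_Kos_neg _ _ (by omega), show e - 5 + 5 = e by ring] at h
  omega

theorem rr_zz_12 (D : KFam 3 5) (hD : IsKoszulFam 3 5 D) (p : ℕ) (hp : p ≠ 18) :
    rr D p 12 = zz D p 12 := by
  cases p with
  | zero => exact rr_eq_zz0 D hD 7
  | succ p => exact rr_eq_zz D hD p 7 12 (by norm_num) (fun f h1 h2 => exact_12 p hp f h1 h2)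

theorem rr_zz_ge (D : KFam 3 5) (hD : IsKoszulFam 3 5 D) (p e : ℕ) (he : 13 ≤ e) :
    rr D p (e : ℤ) = zz D p (e : ℤ) := by
  obtain ⟨e, rfl⟩ : ∃ e', e = e' + 5 := ⟨e - 5, by omega⟩
  cases p with
  | zero => exact_mod_cast rr_eq_zz0 D hD e
  | succ p => exact rr_eq_zz D hD p e _ rfl (fun f h1 h2 => exact_ge13 p _ he f h1 h2)

theorem rr_zz_7 (D : KFam 3 5) (hD : IsKoszulFam 3 5 D) (p : ℕ) (hp : p ≤ 2) :
    rr D p 7 = zz D p 7 := by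
  interval_cases p
  · exact rr_eq_zz0 D hD 2
  · exact rr_eq_zz D hD 0 2 7 (by norm_num) exact_71
  · exact rr_eq_zz D hD 1 2 7 (by norm_num) exact_72

theorem rank_nullN (D : KFam 3 5) (p e : ℕ) :
    zz D (p + 1) (e : ℤ) + rr D p ((e + 5 : ℕ) : ℤ) = Nat.choose 21 (p + 1) * (e + 2).choose 2 := by
  rw [← finrank_Kos]
  exact_mod_cast rank_null D p e

/-- recursion in degrees at least 17 -/
theorem zz_rec (D : KFam 3 5) (hD : IsKoszulFam 3 5 D) (p e : ℕ) (he : 8 ≤ e) :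
    zz D (p + 1) (e : ℤ) + zz D p ((e + 5 : ℕ) : ℤ) =
      Nat.choose 21 (p + 1) * (e + 2).choose 2 := by
  rw [← rr_zz_ge D hD p (e + 5) (by omega)]
  exact rank_nullN D p e

theorem zz_zeroN (D : KFam 3 5) (e : ℕ) : zz D 0 (e : ℤ) = (e + 2).choose 2 := by
  have := finrank_Kos 0 e
  simpa [zz] using this

/-- cycles in high degree as an alternating sum -/
theorem zz_alt (D : KFam 3 5) (hD : IsKoszulFam 3 5 D) : ∀ (p e : ℕ), 8 ≤ e →
    (zz D p (e : ℤ) : ℤ) = ∑ i ∈ Finset.range (p + 1),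
      (-1 : ℤ) ^ i * ((Nat.choose 21 (p - i) : ℤ) * ((e + 5 * i + 2).choose 2 : ℕ)) := by
  intro p
  induction p with
  | zero =>
    intro e he
    rw [zz_zeroN]
    simp
  | succ p ih =>
    intro e he
    have h := zz_rec D hD p e he
    have h2 := ih (e + 5) (by omega)
    rw [Finset.sum_range_succ']
    have h3 : ∑ k ∈ Finset.range (p + 1), (-1 : ℤ) ^ (k + 1) *
        ((Nat.choose 21 (p + 1 - (k + 1)) : ℤ) * ((e + 5 * (k + 1) + 2).choose 2 : ℕ)) =
        - (zz D p ((e + 5 : ℕ) : ℤ) : ℤ) := by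
      rw [h2, ← Finset.sum_neg_distrib]
      refine Finset.sum_congr rfl fun k _ => ?_
      rw [show p + 1 - (k + 1) = p - k by omega, show e + 5 * (k + 1) + 2 = e + 5 + 5 * k + 2 by ring]
      ring
    rw [h3]
    have h4 : (zz D (p + 1) (e : ℤ) : ℤ) + zz D p ((e + 5 : ℕ) : ℤ) =
      (Nat.choose 21 (p + 1) : ℤ) * ((e + 2).choose 2 : ℕ) := by exact_mod_cast h
    simp only [pow_zero, one_mul, mul_zero, Nat.sub_zero, Nat.add_zero]
    linarith

end

set_option linter.unusedSectionVars false

noncomputable section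

theorem zz_big (D : KFam 3 5) (p e : ℕ) (hp : 22 ≤ p) : zz D p (e : ℤ) = 0 := by
  have := zz_le D p (e : ℤ)
  rw [finrank_Kos, Nat.choose_eq_zero_of_lt (by omega), zero_mul] at this
  omega

/-- the values of `dim ⋀^p S_5 ⊗ S_2` and the values in degree 7 and 12 -/
theorem zz12_val (D : KFam 3 5) (hD : IsKoszulFam 3 5 D) (p : ℕ) :
    (zz D p 12 : ℤ) = ∑ i ∈ Finset.range (p + 1),
      (-1 : ℤ) ^ i * ((Nat.choose 21 (p - i) : ℤ) * ((12 + 5 * i + 2).choose 2 : ℕ)) :=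
  zz_alt D hD p 12 (by norm_num)

theorem rn7 (D : KFam 3 5) (p : ℕ) :
    zz D (p + 1) 7 + rr D p 12 = Nat.choose 21 (p + 1) * 36 := rank_nullN D p 7

theorem rn2 (D : KFam 3 5) (p : ℕ) :
    zz D (p + 1) 2 + rr D p 7 = Nat.choose 21 (p + 1) * 6 := rank_nullN D p 2

theorem zz2_big (D : KFam 3 5) (hD : IsKoszulFam 3 5 D) (p : ℕ) (hp : 5 ≤ p) :
    zz D (p + 1) 2 = 0 := by
  rw [zz_2 D hD p]
  have : Zc p = ⊥ := by
    refine le_antisymm (fun f hf => ?_) bot_le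
    rw [Submodule.mem_bot]
    exact Zc_big p hp f hf
  rw [this]
  exact finrank_bot ℂ _

/-- all Betti numbers outside of the last statement and the vanishing at `q = 1` -/
theorem zr7 (D : KFam 3 5) (hD : IsKoszulFam 3 5 D) :
    zz D 0 7 = 36 ∧ (∀ p, p < 18 →  (zz D (p + 1) 7 : ℤ) = Nat.choose 21 (p + 1) * 36 -
      ∑ i ∈ Finset.range (p + 1),
      (-1 : ℤ) ^ i * ((Nat.choose 21 (p - i) : ℤ) * ((12 + 5 * i + 2).choose 2 : ℕ))) := by
  refine ⟨zz_zeroN D 7, fun p hp => ?_⟩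
  have h := rn7 D p
  rw [rr_zz_12 D hD p (by omega)] at h
  rw [← zz12_val D hD]
  have : (zz D (p + 1) 7 : ℤ) + zz D p 12 = Nat.choose 21 (p + 1) * 36 := by exact_mod_cast h
  linarith

end

set_option linter.unusedSectionVars false

noncomputable section

/-- table of the dimensions of the degree 12 cycles -/
def tab12 : ℕ → ℕ
  | 0 => 91
  | 1 => 1740
  | 2 => 15795
  | 3 => 90510
  | 4 => 367200
  | 5 => 1121184
  | 6 => 2673420
  | 7 => 5097960
  | 8 => 7896330
  | 9 => 10033400
  | 10 => 10516506
  | 11 => 9109620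
  | 12 => 6510660
  | 13 => 3818880
  | 14 => 1820700
  | 15 => 694824
  | 16 => 207315
  | 17 => 46620
  | 18 => 7435
  | 19 => 750
  | 20 => 36
  | _ => 0

theorem zz12_tab (D : KFam 3 5) (hD : IsKoszulFam 3 5 D) (p : ℕ) (hp : p ≤ 20) :
    zz D p 12 = tab12 p := by
  have h := zz12_val D hD p
  interval_cases p <;> simp [Finset.sum_range_succ, Nat.choose] at h <;> simp only [tab12] <;>
    exact_mod_cast h

/-- table of the dimensions of `⋀^p S_5` -/
def tabC : ℕ → ℕ
  | 0 => 1
  | 1 => 21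
  | 2 => 210
  | 3 => 1330
  | 4 => 5985
  | 5 => 20349
  | 6 => 54264
  | 7 => 116280
  | 8 => 203490
  | 9 => 293930
  | 10 => 352716
  | 11 => 352716
  | 12 => 293930
  | 13 => 203490
  | 14 => 116280
  | 15 => 54264
  | 16 => 20349
  | 17 => 5985
  | 18 => 1330
  | 19 => 210
  | 20 => 21
  | 21 => 1
  | _ => 0

theorem choose_tab (p : ℕ) (hp : p ≤ 21) : Nat.choose 21 p = tabC p := by
  interval_cases p <;> simp [tabC, Nat.choose]

theorem rr18 (D : KFam 3 5) (hD : IsKoszulFam 3 5 D) : rr D 18 12 = 7434 := by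
  have h1 := zz_le_rr18 D hD
  have h2 : zz D 18 12 = 7435 := zz12_tab D hD 18 (by norm_num)
  have h3 : zz D 19 7 + rr D 18 12 = Nat.choose 21 19 * 36 := rn7 D 18
  have h4 : zz D 20 2 + rr D 19 7 = Nat.choose 21 20 * 6 := rn2 D 19
  have h5 : zz D 20 2 = 0 := zz2_big D hD 19 (by norm_num)
  have h6 := rr_le_zz D hD 19 7
  have h7 := rr_le_zz D hD 18 12
  rw [choose_tab _ (by norm_num)] at h3 h4
  simp only [tabC] at h3 h4
  omega

/-- table of the dimensions of the degree 12 boundaries -/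
def tabR : ℕ → ℕ
  | 18 => 7434
  | p => tab12 p

theorem rr12_tab (D : KFam 3 5) (hD : IsKoszulFam 3 5 D) (p : ℕ) (hp : p ≤ 20) :
    rr D p 12 = tabR p := by
  by_cases h : p = 18
  · subst h; exact rr18 D hD
  · rw [rr_zz_12 D hD p h, zz12_tab D hD p hp]
    interval_cases p <;> first | rfl | exact absurd rfl h

/-- cycles in degree 7 -/
theorem zz7_tab (D : KFam 3 5) (hD : IsKoszulFam 3 5 D) (p : ℕ) (hp : p ≤ 20) :
    zz D (p + 1) 7 = tabC (p + 1) * 36 - tabR p := by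
  have h := rn7 D p
  rw [choose_tab _ (by omega), rr12_tab D hD p hp] at h
  omega

theorem rr7_tab (D : KFam 3 5) (p : ℕ) (hp : p ≤ 20) :
    rr D p 7 = tabC (p + 1) * 6 - zz D (p + 1) 2 := by
  have h := rn2 D p
  rw [choose_tab _ (by omega)] at h
  omega

theorem zz2_vals (D : KFam 3 5) (hD : IsKoszulFam 3 5 D) :
    zz D 0 2 = 6 ∧ zz D 1 2 = 90 ∧ zz D 2 2 = 595 ∧ zz D 3 2 = 2160 ∧ zz D 4 2 = 4200 ∧
      zz D 5 2 = 2002 := by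
  have z0 : zz D 0 7 = 36 := zz_zeroN D 7
  have z1 := zz7_tab D hD 0 (by norm_num)
  have z2 := zz7_tab D hD 1 (by norm_num)
  have r0 := rr_zz_7 D hD 0 (by norm_num)
  have r1 := rr_zz_7 D hD 1 (by norm_num)
  have r2 := rr_zz_7 D hD 2 (by norm_num)
  have c0 := rn2 D 0
  have c1 := rn2 D 1
  have c2 := rn2 D 2
  rw [choose_tab _ (by norm_num)] at c0 c1 c2
  simp only [tabC, tabR, tab12, Nat.zero_add, Nat.reduceAdd] at z1 z2 c0 c1 c2
  refine ⟨zz_zeroN D 2, by omega, by omega, by omega, ?_, ?_⟩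
  · exact (zz_2 D hD 3).trans finrank_Zc3
  · exact (zz_2 D hD 4).trans finrank_Zc4

theorem K0 (D : KFam 3 5) (hD : IsKoszulFam 3 5 D) (p : ℕ) : Kdim 3 5 D 2 p 0 = zz D p 2 := by
  rw [Kdim_zz D hD, rr_neg D p _ (by norm_num)]
  simp

theorem K1 (D : KFam 3 5) (hD : IsKoszulFam 3 5 D) (p : ℕ) :
    Kdim 3 5 D 2 p 1 = zz D p 7 - rr D p 7 := by
  rw [Kdim_zz D hD]
  norm_num

theorem K2 (D : KFam 3 5) (hD : IsKoszulFam 3 5 D) (p : ℕ) :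
    Kdim 3 5 D 2 p 2 = zz D p 12 - rr D p 12 := by
  rw [Kdim_zz D hD]
  norm_num

theorem zz2_zero (D : KFam 3 5) (hD : IsKoszulFam 3 5 D) (p : ℕ) (hp : 6 ≤ p) : zz D p 2 = 0 := by
  obtain ⟨k, rfl⟩ : ∃ k, p = k + 1 := ⟨p - 1, by omega⟩
  exact zz2_big D hD k (by omega)

/-- table for the row `q = 1` -/
theorem K1_tab (D : KFam 3 5) (hD : IsKoszulFam 3 5 D) (p : ℕ) (hp : p ≤ 20) :
    Kdim 3 5 D 2 (p + 1) 1 = (tabC (p + 1) * 36 - tabR p) - (tabC (p + 2) * 6 - zz D (p + 2) 2) := by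
  rw [K1 D hD, zz7_tab D hD p hp]
  by_cases h : p = 20
  · subst h
    simp [tabC, tabR, tab12]
  · rw [rr7_tab D (p + 1) (by omega)]

theorem K1_van (D : KFam 3 5) (hD : IsKoszulFam 3 5 D) (p : ℕ) (hp : ¬ (3 ≤ p ∧ p ≤ 17)) :
    Kdim 3 5 D 2 p 1 = 0 := by
  by_cases h2 : p ≤ 2
  · rw [K1 D hD, rr_zz_7 D hD p h2, Nat.sub_self]
  by_cases h22 : 22 ≤ p
  · rw [K1 D hD]
    have : zz D p 7 = 0 := zz_big D p 7 h22
    rw [this, Nat.zero_sub]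
  obtain ⟨k, rfl⟩ : ∃ k, p = k + 1 := ⟨p - 1, by omega⟩
  rw [K1_tab D hD k (by omega), zz2_zero D hD _ (by omega)]
  have : 17 ≤ k := by omega
  have : k ≤ 20 := by omega
  interval_cases k <;> rfl

theorem K_van (D : KFam 3 5) (hD : IsKoszulFam 3 5 D) (p : ℕ) (q : ℤ)
    (h : ¬((p ≤ 5 ∧ q = 0) ∨ (3 ≤ p ∧ p ≤ 17 ∧ q = 1) ∨ (p = 18 ∧ q = 2))) :
    Kdim 3 5 D 2 p q = 0 := by
  rcases lt_or_ge q 0 with hq | hq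
  · rw [Kdim_zz D hD]
    have := zz_le D p (2 + q * 5)
    rw [finrank_Kos_neg _ _ (by omega)] at this
    omega
  by_cases q0 : q = 0
  · subst q0
    rw [K0 D hD, zz2_zero D hD p (by omega)]
  by_cases q1 : q = 1
  · subst q1
    exact K1_van D hD p (by omega)
  by_cases q2 : q = 2
  · subst q2
    rw [K2 D hD, rr_zz_12 D hD p (by omega), Nat.sub_self]
  obtain ⟨n, rfl⟩ : ∃ n : ℕ, q = (n : ℤ) + 3 := ⟨(q - 3).toNat, by omega⟩
  rw [Kdim_zz D hD]
  have h3 : (2 + ((n : ℤ) + 3) * 5) = ((17 + 5 * n : ℕ) : ℤ) := by push_cast; ring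
  rw [h3, rr_zz_ge D hD p _ (by omega), Nat.sub_self]

end

/-- Betti table of the pushforward of O(b=2) under the 5-uple Veronese embedding of P^2. -/
theorem veronese_betti_P2_b2_d5 (D : KFam 3 5) (hD : IsKoszulFam 3 5 D) :
    Kdim 3 5 D 2 0 0 = 6 ∧
    Kdim 3 5 D 2 1 0 = 90 ∧
    Kdim 3 5 D 2 2 0 = 595 ∧
    Kdim 3 5 D 2 3 0 = 2160 ∧
    Kdim 3 5 D 2 4 0 = 4200 ∧
    Kdim 3 5 D 2 5 0 = 2002 ∧
    Kdim 3 5 D 2 3 1 = 375 ∧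
    Kdim 3 5 D 2 4 1 = 4858 ∧
    Kdim 3 5 D 2 5 1 = 39780 ∧
    Kdim 3 5 D 2 6 1 = 134640 ∧
    Kdim 3 5 D 2 7 1 = 291720 ∧
    Kdim 3 5 D 2 8 1 = 464100 ∧
    Kdim 3 5 D 2 9 1 = 568854 ∧
    Kdim 3 5 D 2 10 1 = 548080 ∧
    Kdim 3 5 D 2 11 1 = 417690 ∧
    Kdim 3 5 D 2 12 1 = 250920 ∧
    Kdim 3 5 D 2 13 1 = 117300 ∧
    Kdim 3 5 D 2 14 1 = 41616 ∧
    Kdim 3 5 D 2 15 1 = 10710 ∧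
    Kdim 3 5 D 2 16 1 = 1830 ∧
    Kdim 3 5 D 2 17 1 = 165 ∧
    Kdim 3 5 D 2 18 2 = 1 ∧
    (∀ (p : ℕ) (q : ℤ), ¬((p ≤ 5 ∧ q = 0) ∨ (3 ≤ p ∧ p ≤ 17 ∧ q = 1) ∨ (p = 18 ∧ q = 2)) →
      Kdim 3 5 D 2 p q = 0) := by
  obtain ⟨a0, a1, a2, a3, a4, a5⟩ := zz2_vals D hD
  have hz := zz2_zero D hD
  have t := K1_tab D hD
  refine ⟨?_, ?_, ?_, ?_, ?_, ?_, ?_, ?_, ?_, ?_, ?_, ?_, ?_, ?_, ?_, ?_, ?_, ?_, ?_, ?_, ?_, ?_,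
    K_van D hD⟩
  · rw [K0 D hD, a0]
  · rw [K0 D hD, a1]
  · rw [K0 D hD, a2]
  · rw [K0 D hD, a3]
  · rw [K0 D hD, a4]
  · rw [K0 D hD, a5]
  · rw [t 2 (by norm_num), a4]; rfl
  · rw [t 3 (by norm_num), a5]; rfl
  · rw [t 4 (by norm_num), hz _ (by norm_num)]; rfl
  · rw [t 5 (by norm_num), hz _ (by norm_num)]; rfl
  · rw [t 6 (by norm_num), hz _ (by norm_num)]; rfl
  · rw [t 7 (by norm_num), hz _ (by norm_num)]; rfl
  · rw [t 8 (by norm_num), hz _ (by norm_num)]; rfl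
  · rw [t 9 (by norm_num), hz _ (by norm_num)]; rfl
  · rw [t 10 (by norm_num), hz _ (by norm_num)]; rfl
  · rw [t 11 (by norm_num), hz _ (by norm_num)]; rfl
  · rw [t 12 (by norm_num), hz _ (by norm_num)]; rfl
  · rw [t 13 (by norm_num), hz _ (by norm_num)]; rfl
  · rw [t 14 (by norm_num), hz _ (by norm_num)]; rfl
  · rw [t 15 (by norm_num), hz _ (by norm_num)]; rfl
  · rw [t 16 (by norm_num), hz _ (by norm_num)]; rfl
  · rw [K2 D hD, zz12_tab D hD 18 (by norm_num), rr18 D hD]; rfl
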